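/- arXiv:1410.7934 — 3 statements merged into one kernel-verified Lean document; each statement's English description precedes it below -/
import Mathlib

section
/- Let α > 1 and let f and its Müntz operator Pf both belong to the Müntz class M_α. Then the Voronoi operator equals the iterated Müntz operator: (Vf)(x) = (P(Pf))(x) for all x > 0. -/
open MeasureTheory Filter Asymptotics Set Complex

noncomputable section

/-- The Mellin transform of `f`. -/
def mellinT (f : ℝ → ℂ) (s : ℂ) : ℂ := ∫ x in Ioi (0:ℝ), (x : ℂ) ^ (s - 1) * f x

/-- The Müntz class `M_α`. -/
def MuntzClass (α : ℝ) (f : ℝ → ℂ) : Prop :=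
  ContDiffOn ℝ 2 f (Ici 0) ∧
  ∀ j : ℕ, j ≤ 2 →
    (iteratedDerivWithin j f (Ici 0)) =O[atTop] fun x : ℝ => x ^ (-(α + (j : ℝ)))

/-- The Möbius transformation `(Θf)(x) = ∑ f(nx)`. -/
def thetaOp (f : ℝ → ℂ) (x : ℝ) : ℂ := ∑' n : ℕ, f ((n + 1 : ℝ) * x)

/-- The Müntz operator. -/
def muntzOp (f : ℝ → ℂ) (x : ℝ) : ℂ :=
  thetaOp f x - (x : ℂ)⁻¹ * ∫ y in Ioi (0:ℝ), f y

/-- `(1/(2πi)) ∫_{σ-i∞}^{σ+i∞} g(s) ds`. -/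
def lineIntegral (g : ℂ → ℂ) (σ : ℝ) : ℂ :=
  (2 * Real.pi)⁻¹ • ∫ t : ℝ, g (σ + t * Complex.I)

/-- The Fourier cosine transform. -/
def fourierCos (f : ℝ → ℂ) (x : ℝ) : ℂ :=
  (Real.sqrt (2 / Real.pi) : ℂ) * ∫ t in Ioi (0:ℝ), f t * (Real.cos (x * t) : ℂ)

/-- The reduced Möbius operator. -/
def thetaHat (f : ℝ → ℂ) (x : ℝ) : ℂ :=
  ∑' n : ℕ, ((|ArithmeticFunction.moebius (n + 1)| : ℤ) : ℂ) * f ((n + 1 : ℝ) * x)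

/-- The Voronoi operator. -/
def voronoiOp (f : ℝ → ℂ) (x : ℝ) : ℂ :=
  (∑' n : ℕ, ((n + 1 : ℕ).divisors.card : ℂ) * f ((n + 1 : ℝ) * x)) -
    ∫ y in Ioi (0:ℝ), f (x * y) *
      ((Real.log y + 2 * Real.eulerMascheroniConstant : ℝ) : ℂ)


open Topology

lemma mc_cont {α : ℝ} {f : ℝ → ℂ} (hf : MuntzClass α f) : ContinuousOn f (Ici 0) :=
  hf.1.continuousOn

lemma mc_bound {α : ℝ} (hα : 1 < α) {f : ℝ → ℂ} (hf : MuntzClass α f) :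
    ∃ C : ℝ, 0 ≤ C ∧ ∀ u : ℝ, 0 < u → ‖f u‖ ≤ C * u ^ (-α) := by
  have h0 := hf.2 0 (by norm_num)
  simp only [iteratedDerivWithin_zero, Nat.cast_zero, add_zero] at h0
  obtain ⟨K, hK⟩ := h0.bound
  obtain ⟨A, hA⟩ := eventually_atTop.1 hK
  have hc : ContinuousOn (fun u : ℝ => f u * ((u ^ α : ℝ) : ℂ)) (Icc 0 A) := by
    apply ContinuousOn.mul
    · exact (mc_cont hf).mono Icc_subset_Ici_self
    · exact (Complex.continuous_ofReal.comp
        (Real.continuous_rpow_const (by linarith))).continuousOn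
  obtain ⟨B, hB⟩ := isCompact_Icc.exists_bound_of_continuousOn hc
  refine ⟨max (max K B) 0, le_max_right _ _, fun u hu => ?_⟩
  have hp : 0 < u ^ (-α) := Real.rpow_pos_of_pos hu _
  rcases le_total A u with h | h
  · have := hA u h
    rw [Real.norm_of_nonneg hp.le] at this
    refine this.trans (mul_le_mul_of_nonneg_right ?_ hp.le)
    exact (le_max_left _ _).trans (le_max_left _ _)
  · have := hB u ⟨hu.le, h⟩
    have hp' : 0 < u ^ α := Real.rpow_pos_of_pos hu _
    rw [norm_mul, Complex.norm_real, Real.norm_of_nonneg hp'.le] at this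
    rw [Real.rpow_neg hu.le, ← div_eq_mul_inv, le_div_iff₀ hp']
    exact this.trans ((le_max_right _ _).trans (le_max_left _ _))

lemma int_pow {α : ℝ} {f : ℝ → ℂ} (hc : ContinuousOn f (Ici 0)) {C : ℝ}
    (hC : ∀ u : ℝ, 0 < u → ‖f u‖ ≤ C * u ^ (-α)) {s : ℝ} (hs : -1 < s) (hs' : s < α - 1) :
    IntegrableOn (fun u => ‖f u‖ * u ^ s) (Ioi 0) := by
  have hm : ∀ S ⊆ Ioi (0:ℝ), MeasurableSet S →
      AEStronglyMeasurable (fun u => ‖f u‖ * u ^ s) (volume.restrict S) := by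
    intro S hS hSm
    refine ContinuousOn.aestronglyMeasurable ?_ hSm
    refine ContinuousOn.mul ((hc.mono (hS.trans Ioi_subset_Ici_self)).norm) ?_
    intro u hu
    exact (Real.continuousAt_rpow_const u s (Or.inl (hS hu).ne')).continuousWithinAt
  rw [← Ioc_union_Ioi_eq_Ioi (zero_le_one' ℝ)]
  refine IntegrableOn.union ?_ ?_
  · obtain ⟨B, hB⟩ := (isCompact_Icc (a := (0:ℝ)) (b := 1)).exists_bound_of_continuousOn
      (hc.mono Icc_subset_Ici_self)
    have hi : IntegrableOn (fun u : ℝ => B * u ^ s) (Ioc 0 1) := by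
      have := (intervalIntegral.intervalIntegrable_rpow' (a := 0) (b := 1) hs).const_mul B
      rwa [intervalIntegrable_iff_integrableOn_Ioc_of_le zero_le_one] at this
    refine Integrable.mono' hi (hm _ (fun u hu => hu.1) measurableSet_Ioc) ?_
    filter_upwards [ae_restrict_mem measurableSet_Ioc] with u hu
    have hp : 0 < u ^ s := Real.rpow_pos_of_pos hu.1 _
    rw [norm_mul, norm_norm, Real.norm_of_nonneg hp.le]
    exact mul_le_mul_of_nonneg_right (hB u ⟨hu.1.le, hu.2⟩) hp.le
  · have hi : IntegrableOn (fun u : ℝ => C * u ^ (-α + s)) (Ioi 1) :=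
      (integrableOn_Ioi_rpow_of_lt (by linarith) one_pos).const_mul C
    refine Integrable.mono' hi (hm _ (Ioi_subset_Ioi zero_le_one) measurableSet_Ioi) ?_
    filter_upwards [ae_restrict_mem measurableSet_Ioi] with u hu
    have hu0 : 0 < u := one_pos.trans hu
    have hp : 0 < u ^ s := Real.rpow_pos_of_pos hu0 _
    rw [norm_mul, norm_norm, Real.norm_of_nonneg hp.le, Real.rpow_add hu0, ← mul_assoc]
    exact mul_le_mul_of_nonneg_right (hC u hu0) hp.le

lemma int_f {α : ℝ} (hα : 1 < α) {f : ℝ → ℂ} (hc : ContinuousOn f (Ici 0)) {C : ℝ}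
    (hC : ∀ u : ℝ, 0 < u → ‖f u‖ ≤ C * u ^ (-α)) : IntegrableOn f (Ioi 0) := by
  have h := int_pow hc hC (s := 0) (by norm_num) (by linarith)
  simp only [Real.rpow_zero, mul_one] at h
  exact (integrable_norm_iff
    ((hc.mono Ioi_subset_Ici_self).aestronglyMeasurable measurableSet_Ioi)).1 h

lemma int_flog {α : ℝ} (hα : 1 < α) {f : ℝ → ℂ} (hc : ContinuousOn f (Ici 0)) {C : ℝ}
    (hC : ∀ u : ℝ, 0 < u → ‖f u‖ ≤ C * u ^ (-α)) :
    IntegrableOn (fun u => f u * (Real.log u : ℂ)) (Ioi 0) := by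
  have h1 := int_pow hc hC (s := -(1/2)) (by norm_num) (by linarith)
  have h2 := int_pow hc hC (s := (α-1)/2) (by linarith) (by linarith)
  refine Integrable.mono' ((h1.const_mul 2).add (h2.const_mul (2/(α-1)))) ?_ ?_
  · refine ContinuousOn.aestronglyMeasurable ?_ measurableSet_Ioi
    refine ContinuousOn.mul (hc.mono Ioi_subset_Ici_self) ?_
    intro u hu
    exact (Complex.continuous_ofReal.continuousAt.comp
      (Real.continuousAt_log (ne_of_gt hu))).continuousWithinAt
  · filter_upwards [ae_restrict_mem measurableSet_Ioi] with u hu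
    have hu : 0 < u := hu
    rw [norm_mul, Complex.norm_real, Real.norm_eq_abs]
    have e1 : Real.log u ≤ u ^ ((α-1)/2) / ((α-1)/2) :=
      Real.log_le_rpow_div hu.le (by linarith)
    have e2 : -Real.log u ≤ 2 * u ^ (-(1/2) : ℝ) := by
      have := Real.log_le_rpow_div (x := u⁻¹) (by positivity) (show (0:ℝ) < 1/2 by norm_num)
      rw [Real.log_inv, Real.inv_rpow hu.le, ← Real.rpow_neg hu.le] at this
      linarith
    have e3 : 0 < u ^ ((α-1)/2) / ((α-1)/2) :=
      div_pos (Real.rpow_pos_of_pos hu _) (by linarith)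
    have e4 : 0 < u ^ (-(1/2) : ℝ) := Real.rpow_pos_of_pos hu _
    have e5 : |Real.log u| ≤ 2 * u ^ (-(1/2) : ℝ) + u ^ ((α-1)/2) / ((α-1)/2) :=
      abs_le.2 ⟨by linarith, by linarith⟩
    calc ‖f u‖ * |Real.log u| ≤ ‖f u‖ * _ := mul_le_mul_of_nonneg_left e5 (norm_nonneg _)
      _ = _ := by
        have : α - 1 ≠ 0 := by linarith
        simp only [Pi.add_apply]
        field_simp

lemma harm_bound {t : ℝ} (ht : 0 < t) :
    |(harmonic ⌊t⌋₊ : ℝ) - Real.log t - Real.eulerMascheroniConstant| ≤ 3 * t ^ (-(1/2) : ℝ) := by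
  have e4 : 0 < t ^ (-(1/2) : ℝ) := Real.rpow_pos_of_pos ht _
  have g1 := Real.one_half_lt_eulerMascheroniConstant
  have g2 := Real.eulerMascheroniConstant_lt_two_thirds
  rcases lt_or_ge t 1 with h | h
  · rw [Nat.floor_eq_zero.2 h]
    have e2 : -Real.log t ≤ 2 * t ^ (-(1/2) : ℝ) := by
      have := Real.log_le_rpow_div (x := t⁻¹) (by positivity) (show (0:ℝ) < 1/2 by norm_num)
      rw [Real.log_inv, Real.inv_rpow ht.le, ← Real.rpow_neg ht.le] at this
      linarith
    have e3 : 1 ≤ t ^ (-(1/2) : ℝ) :=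
      Real.one_le_rpow_of_pos_of_le_one_of_nonpos ht h.le (by norm_num)
    have e5 := Real.log_neg ht h
    simp only [harmonic_zero, Rat.cast_zero]
    exact abs_le.2 ⟨by linarith, by linarith⟩
  · set N := ⌊t⌋₊ with hN
    have hN1 : 1 ≤ N := Nat.one_le_floor_iff _ |>.2 h
    have hNt : (N:ℝ) ≤ t := Nat.floor_le ht.le
    have hNt' : t < N + 1 := Nat.lt_floor_add_one t
    have hN0 : (1:ℝ) ≤ N := by exact_mod_cast hN1
    have a1 := Real.eulerMascheroniSeq_lt_eulerMascheroniConstant N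
    have a2 := Real.eulerMascheroniConstant_lt_eulerMascheroniSeq' N
    simp only [Real.eulerMascheroniSeq, Real.eulerMascheroniSeq'] at a1 a2
    rw [if_neg (by omega)] at a2
    have b1 : Real.log (N+1) - Real.log t ≤ 1/t := by
      rw [← Real.log_div (by positivity) ht.ne']
      refine (Real.log_le_sub_one_of_pos (by positivity)).trans ?_
      rw [div_sub_one ht.ne']
      gcongr; linarith
    have b2 : Real.log t - Real.log N ≤ 2/t := by
      rw [← Real.log_div ht.ne' (by positivity)]
      refine (Real.log_le_sub_one_of_pos (by positivity)).trans ?_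
      rw [div_sub_one (by positivity), div_le_div_iff₀ (by positivity) ht]
      nlinarith
    have c : 1/t ≤ t ^ (-(1/2) : ℝ) := by
      rw [one_div, ← Real.rpow_neg_one]
      exact Real.rpow_le_rpow_of_exponent_le h (by norm_num)
    have b3 : 2/t = 2*(1/t) := by ring
    have : 0 < 1/t := by positivity
    exact abs_le.2 ⟨by linarith, by linarith⟩

lemma summ_base {α : ℝ} (hα : 1 < α) : Summable (fun n : ℕ => ((n:ℝ)+1) ^ (-α)) := by
  have := (summable_nat_add_iff 1).2 (Real.summable_nat_rpow.2 (show -α < -1 by linarith))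
  simpa using this

lemma theta_bound {α : ℝ} (hα : 1 < α) {f : ℝ → ℂ} {C : ℝ}
    (hC : ∀ u : ℝ, 0 < u → ‖f u‖ ≤ C * u ^ (-α)) (x : ℝ) (hx : 0 < x) :
    ‖thetaOp f x‖ ≤ C * (∑' n : ℕ, ((n:ℝ)+1) ^ (-α)) * x ^ (-α) := by
  have hs := ((summ_base hα).mul_left C).mul_right (x ^ (-α))
  rw [← tsum_mul_left, ← tsum_mul_right]
  refine tsum_of_norm_bounded hs.hasSum fun n => ?_
  refine (hC _ (by positivity)).trans_eq ?_
  rw [Real.mul_rpow (by positivity) hx.le, mul_assoc]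

lemma int_zero {α : ℝ} (hα : 1 < α) {f : ℝ → ℂ} 
    (hf : MuntzClass α f) (hPf : MuntzClass α (muntzOp f)) : ∫ y in Ioi (0:ℝ), f y = 0 := by
  obtain ⟨C, hC0, hC⟩ := mc_bound hα hf
  obtain ⟨D, hD0, hD⟩ := mc_bound hα hPf
  set I := ∫ y in Ioi (0:ℝ), f y with hI
  set K := C * (∑' n : ℕ, ((n:ℝ)+1) ^ (-α)) + D with hK
  have key : ∀ x : ℝ, 0 < x → ‖I‖ ≤ K * x ^ (-(α-1)) := by
    intro x hx
    have e : (x:ℂ)⁻¹ * I = thetaOp f x - muntzOp f x := by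
      simp only [muntzOp]; ring
    have e1 : ‖(x:ℂ)⁻¹ * I‖ ≤ K * x ^ (-α) := by
      rw [e, hK, add_mul]
      exact (norm_sub_le _ _).trans (add_le_add (theta_bound hα hC x hx) (hD x hx))
    rw [norm_mul, norm_inv, Complex.norm_real, Real.norm_of_nonneg hx.le,
      inv_mul_le_iff₀ hx] at e1
    refine e1.trans_eq ?_
    rw [show -(α-1) = 1 + -α by ring, Real.rpow_add hx, Real.rpow_one]; ring
  have ht : Tendsto (fun x : ℝ => K * x ^ (-(α-1))) atTop (𝓝 (K * 0)) :=
    (tendsto_rpow_neg_atTop (by linarith)).const_mul K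
  have : ‖I‖ ≤ K * 0 := ge_of_tendsto ht (by
    filter_upwards [eventually_gt_atTop 0] with x hx using key x hx)
  rw [mul_zero] at this
  exact norm_le_zero_iff.1 this

lemma theta_int {α : ℝ} (hα : 1 < α) {f : ℝ → ℂ} (hc : ContinuousOn f (Ici 0)) {C : ℝ}
    (hC : ∀ u : ℝ, 0 < u → ‖f u‖ ≤ C * u ^ (-α)) {ε : ℝ} (hε : 0 < ε) :
    ∫ y in Ioi ε, thetaOp f y = ∫ u in Ioi (0:ℝ), f u * ((harmonic ⌊u/ε⌋₊ : ℝ) : ℂ) := by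
  have hfi := int_f hα hc hC
  have hn : ∀ n : ℕ, (0:ℝ) < (n:ℝ) + 1 := fun n => by positivity
  have hfi' : ∀ n : ℕ, IntegrableOn f (Ioi (((n:ℝ)+1)*ε)) := fun n =>
    hfi.mono_set (Ioi_subset_Ioi (mul_pos (hn n) hε).le)
  have hF1 : ∀ n : ℕ, IntegrableOn (fun y => f (((n:ℝ)+1) * y)) (Ioi ε) := fun n =>
    (integrableOn_Ioi_comp_mul_left_iff f ε (hn n)).2 (hfi' n)
  have hpi : IntegrableOn (fun y : ℝ => y ^ (-α)) (Ioi ε) :=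
    integrableOn_Ioi_rpow_of_lt (by linarith) hε
  have hS1 : Summable (fun n : ℕ => ∫ y in Ioi ε, ‖f (((n:ℝ)+1) * y)‖) := by
    refine Summable.of_nonneg_of_le (fun n => integral_nonneg fun _ => norm_nonneg _) (fun n => ?_)
      (((summ_base hα).mul_left C).mul_right (∫ y in Ioi ε, y ^ (-α)))
    rw [← integral_const_mul]
    refine setIntegral_mono_on (hF1 n).norm (hpi.const_mul _) measurableSet_Ioi fun y hy => ?_
    have hy0 : 0 < y := hε.trans hy
    refine (hC _ (mul_pos (hn n) hy0)).trans_eq ?_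
    rw [Real.mul_rpow (hn n).le hy0.le, mul_assoc]
  have hs1 := hasSum_integral_of_summable_integral_norm hF1 hS1
  set F : ℕ → ℝ → ℂ := fun n => (Ici (((n:ℝ)+1)*ε)).indicator
    (fun u => (((n:ℝ)+1)⁻¹ : ℝ) • f u) with hF
  have hsub : ∀ n : ℕ, Ici (((n:ℝ)+1)*ε) ∩ Ioi 0 = Ici (((n:ℝ)+1)*ε) := fun n =>
    inter_eq_left.2 fun u hu => (mul_pos (hn n) hε).trans_le hu
  have hF2 : ∀ n, Integrable (F n) (volume.restrict (Ioi 0)) := fun n =>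
    (hfi.smul ((((n:ℝ)+1)⁻¹ : ℝ))).indicator measurableSet_Ici
  have hI2 : ∀ n : ℕ, ∫ u in Ioi (0:ℝ), F n u = ∫ y in Ioi ε, f (((n:ℝ)+1) * y) := by
    intro n
    rw [hF, integral_indicator measurableSet_Ici, Measure.restrict_restrict measurableSet_Ici,
      hsub, integral_Ici_eq_integral_Ioi, integral_smul, integral_comp_mul_left_Ioi f _ (hn n)]
  have hI3 : ∀ n : ℕ, ∫ u in Ioi (0:ℝ), ‖F n u‖ = ∫ y in Ioi ε, ‖f (((n:ℝ)+1) * y)‖ := by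
    intro n
    have e : (fun u => ‖F n u‖) = (Ici (((n:ℝ)+1)*ε)).indicator
        (fun u => (((n:ℝ)+1)⁻¹ : ℝ) • ‖f u‖) := by
      funext u
      simp only [hF, norm_indicator_eq_indicator_norm, norm_smul, smul_eq_mul,
        Real.norm_of_nonneg (inv_pos.2 (hn n)).le]
    rw [e, integral_indicator measurableSet_Ici, Measure.restrict_restrict measurableSet_Ici,
      hsub, integral_Ici_eq_integral_Ioi, integral_smul,
      integral_comp_mul_left_Ioi (fun u => ‖f u‖) _ (hn n)]
  have hs2 := hasSum_integral_of_summable_integral_norm hF2 (by simpa only [hI3] using hS1)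
  simp only [hI2] at hs2
  have := hs1.unique hs2
  simp only [thetaOp]
  rw [this]
  refine setIntegral_congr_fun measurableSet_Ioi fun u hu => ?_
  have hu : 0 < u := hu
  have hue : 0 < u/ε := div_pos hu hε
  rw [tsum_eq_sum (s := Finset.range ⌊u/ε⌋₊)]
  · rw [harmonic, mul_comm]
    push_cast
    rw [Finset.sum_mul]
    refine Finset.sum_congr rfl fun n hnr => ?_
    have h1 : n + 1 ≤ ⌊u/ε⌋₊ := Finset.mem_range.1 hnr
    have h2 : ((n+1:ℕ):ℝ) ≤ u/ε := (Nat.le_floor_iff hue.le).1 h1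
    rw [le_div_iff₀ hε] at h2
    push_cast at h2
    rw [hF]
    simp only
    rw [indicator_of_mem (mem_Ici.2 h2), Complex.real_smul]
    push_cast
    rfl
  · intro n hnr
    have h1 : ⌊u/ε⌋₊ < n + 1 := by
      have := Finset.mem_range.not.1 hnr; omega
    have h2 : u/ε < ((n+1:ℕ):ℝ) := (Nat.floor_lt hue.le).1 h1
    rw [div_lt_iff₀ hε] at h2
    push_cast at h2
    exact indicator_of_notMem (fun h => absurd (mem_Ici.1 h) (not_le.2 h2)) _

lemma theta_int_bound {α : ℝ} (hα : 1 < α) {f : ℝ → ℂ} (hc : ContinuousOn f (Ici 0)) {C : ℝ}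
    (hC : ∀ u : ℝ, 0 < u → ‖f u‖ ≤ C * u ^ (-α)) (h0 : ∫ y in Ioi (0:ℝ), f y = 0)
    {ε : ℝ} (hε : 0 < ε) :
    ‖(∫ y in Ioi ε, thetaOp f y) - ∫ u in Ioi (0:ℝ), f u * (Real.log u : ℂ)‖ ≤
      3 * ε ^ (1/2 : ℝ) * ∫ u in Ioi (0:ℝ), ‖f u‖ * u ^ (-(1/2) : ℝ) := by
  have hfi := int_f hα hc hC
  have hl := int_flog hα hc hC
  have h1 := int_pow hc hC (s := -(1/2)) (by norm_num) (by linarith)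
  set g : ℝ → ℝ := fun t => (harmonic ⌊t⌋₊ : ℝ) - Real.log t - Real.eulerMascheroniConstant with hg
  have hgm : Measurable g := by
    refine Measurable.sub_const (Measurable.sub ?_ Real.measurable_log) _
    exact (measurable_from_nat (f := fun n => (harmonic n : ℝ))).comp Nat.measurable_floor
  have hb : ∀ u ∈ Ioi (0:ℝ), ‖f u * (g (u/ε) : ℂ)‖ ≤
      3 * ε ^ (1/2 : ℝ) * (‖f u‖ * u ^ (-(1/2) : ℝ)) := by
    intro u hu
    have hu : 0 < u := hu
    rw [norm_mul, Complex.norm_real, Real.norm_eq_abs]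
    refine (mul_le_mul_of_nonneg_left (harm_bound (div_pos hu hε)) (norm_nonneg _)).trans_eq ?_
    rw [Real.div_rpow hu.le hε.le, Real.rpow_neg hε.le, div_inv_eq_mul]
    ring
  have hgi : IntegrableOn (fun u => f u * (g (u/ε) : ℂ)) (Ioi 0) := by
    refine Integrable.mono' (h1.const_mul (3 * ε ^ (1/2 : ℝ))) ?_ ?_
    · refine AEStronglyMeasurable.mul hfi.1 ?_
      exact (Complex.measurable_ofReal.comp
        (hgm.comp (measurable_id.div_const ε))).aestronglyMeasurable
    · exact (ae_restrict_mem measurableSet_Ioi).mono hb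
  have e : ∫ u in Ioi (0:ℝ), f u * ((harmonic ⌊u/ε⌋₊ : ℝ) : ℂ) =
      ∫ u in Ioi (0:ℝ), ((f u * (g (u/ε) : ℂ) + f u * (Real.log u : ℂ)) +
        f u * ((Real.eulerMascheroniConstant - Real.log ε : ℝ) : ℂ)) := by
    refine setIntegral_congr_fun measurableSet_Ioi fun u hu => ?_
    have hu : 0 < u := hu
    simp only [hg, Real.log_div hu.ne' hε.ne']
    push_cast
    ring
  have hgl : IntegrableOn (fun u => f u * (g (u/ε) : ℂ) + f u * (Real.log u : ℂ)) (Ioi 0) :=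
    hgi.add hl
  rw [theta_int hα hc hC hε, e, integral_add hgl (hfi.mul_const _), integral_add hgi hl,
    integral_mul_const, h0, zero_mul, add_zero, add_sub_cancel_right, ← integral_const_mul]
  exact norm_integral_le_of_norm_le (h1.const_mul _)
    ((ae_restrict_mem measurableSet_Ioi).mono hb)

lemma int_muntz {α : ℝ} (hα : 1 < α) {f : ℝ → ℂ}
    (hf : MuntzClass α f) (hPf : MuntzClass α (muntzOp f)) :
    ∫ y in Ioi (0:ℝ), muntzOp f y = ∫ u in Ioi (0:ℝ), f u * (Real.log u : ℂ) := by
  obtain ⟨C, hC0, hC⟩ := mc_bound hα hf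
  obtain ⟨D, hD0, hD⟩ := mc_bound hα hPf
  have h0 := int_zero hα hf hPf
  have hmt : muntzOp f = thetaOp f := by
    funext x; simp [muntzOp, h0]
  have hPi := int_f hα (mc_cont hPf) hD
  have ha : Tendsto (fun k : ℕ => 1 / ((k:ℝ) + 1)) atTop (𝓝 0) :=
    tendsto_one_div_add_atTop_nhds_zero_nat
  have hl1 := (aecover_Ioi_of_Ioi (μ := volume) ha).integral_tendsto_of_countably_generated hPi
  have hl2 : Tendsto (fun k : ℕ => ∫ y in Ioi (1 / ((k:ℝ) + 1)), thetaOp f y) atTop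
      (𝓝 (∫ u in Ioi (0:ℝ), f u * (Real.log u : ℂ))) := by
    rw [tendsto_iff_norm_sub_tendsto_zero]
    refine squeeze_zero (fun _ => norm_nonneg _)
      (fun k => theta_int_bound hα (mc_cont hf) hC h0 (by positivity)) ?_
    have := ((Real.continuous_rpow_const (q := 1/2) (by norm_num)).tendsto 0).comp ha
    rw [Real.zero_rpow (by norm_num)] at this
    simpa using (this.const_mul 3).mul_const (∫ u in Ioi (0:ℝ), ‖f u‖ * u ^ (-(1/2) : ℝ))
  refine tendsto_nhds_unique hl1 (hl2.congr fun k => ?_)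
  rw [Measure.restrict_restrict measurableSet_Ioi, hmt, inter_eq_left.2
    (Ioi_subset_Ioi (by positivity))]

lemma double_sum {α : ℝ} (hα : 1 < α) {f : ℝ → ℂ} {C : ℝ}
    (hC : ∀ u : ℝ, 0 < u → ‖f u‖ ≤ C * u ^ (-α)) {x : ℝ} (hx : 0 < x) :
    ∑' n : ℕ, ((n + 1 : ℕ).divisors.card : ℂ) * f ((n + 1 : ℝ) * x) =
      thetaOp (thetaOp f) x := by
  set G : ℕ+ × ℕ+ → ℂ := fun p => f ((p.1:ℝ) * (p.2:ℝ) * x) with hG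
  have hb : Summable (fun n : ℕ+ => ((n:ℕ):ℝ) ^ (-α)) := by
    rw [summable_pnat_iff_summable_succ (f := fun n : ℕ => (n:ℝ) ^ (-α))]
    simpa using summ_base hα
  have hGs : Summable G := by
    refine Summable.of_norm_bounded
      (((hb.mul_of_nonneg hb (fun n => by positivity) (fun n => by positivity)).mul_left C).mul_right
        (x ^ (-α))) fun p => ?_
    have h1 : (0:ℝ) < (p.1:ℕ) := by exact_mod_cast p.1.pos
    have h2 : (0:ℝ) < (p.2:ℕ) := by exact_mod_cast p.2.pos
    refine (hC _ (by positivity)).trans_eq ?_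
    rw [Real.mul_rpow (by positivity) hx.le, Real.mul_rpow h1.le h2.le]
    ring
  have hA : ∑' p, G p = thetaOp (thetaOp f) x := by
    rw [hGs.tsum_prod]
    simp only [thetaOp, hG]
    rw [tsum_pnat_eq_tsum_succ (f := fun a : ℕ => ∑' b : ℕ+, f ((a:ℝ) * (b:ℝ) * x))]
    refine tsum_congr fun a => ?_
    rw [tsum_pnat_eq_tsum_succ (f := fun b : ℕ => f (((a+1:ℕ):ℝ) * (b:ℝ) * x))]
    refine tsum_congr fun b => ?_
    push_cast
    congr 1
    ring
  have hB := (sigmaAntidiagonalEquivProd.summable_iff.2 hGs).tsum_sigma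
  rw [← hA, ← sigmaAntidiagonalEquivProd.tsum_eq]
  refine Eq.trans ?_ hB.symm
  have hN := tsum_pnat_eq_tsum_succ (f := fun n : ℕ => (n.divisors.card : ℂ) * f ((n:ℝ) * x))
  push_cast at hN
  rw [← hN]
  refine tsum_congr fun n => ?_
  have : ∀ c : Nat.divisorsAntidiagonal n,
      (G ∘ sigmaAntidiagonalEquivProd) ⟨n, c⟩ = f ((n:ℝ) * x) := by
    rintro ⟨⟨a, b⟩, h⟩
    have h' := (Nat.mem_divisorsAntidiagonal.1 h).1
    simp only [hG, Function.comp, sigmaAntidiagonalEquivProd, divisorsAntidiagonalFactors,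
      Equiv.coe_fn_mk, PNat.mk_coe]
    rw [← h']
    push_cast
    rfl
  rw [tsum_congr this, tsum_fintype]
  have hcard : (n:ℕ).divisorsAntidiagonal.card = (n:ℕ).divisors.card := by
    rw [← Nat.map_div_right_divisors, Finset.card_map]
  simp [hcard]

lemma log_int {f : ℝ → ℂ} {α : ℝ} (hα : 1 < α) (hc : ContinuousOn f (Ici 0)) {C : ℝ}
    (hC : ∀ u : ℝ, 0 < u → ‖f u‖ ≤ C * u ^ (-α)) (h0 : ∫ y in Ioi (0:ℝ), f y = 0)
    {x : ℝ} (hx : 0 < x) (c : ℝ) :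
    ∫ y in Ioi (0:ℝ), f (x * y) * ((Real.log y + c : ℝ) : ℂ) =
      (x:ℂ)⁻¹ * ∫ u in Ioi (0:ℝ), f u * (Real.log u : ℂ) := by
  have hfi := int_f hα hc hC
  have hl := int_flog hα hc hC
  have e : ∫ y in Ioi (0:ℝ), f (x * y) * ((Real.log y + c : ℝ) : ℂ) =
      ∫ y in Ioi (0:ℝ), (fun u => f u * (Real.log u : ℂ) + f u * ((c - Real.log x : ℝ) : ℂ))
        (x * y) := by
    refine setIntegral_congr_fun measurableSet_Ioi fun y hy => ?_
    have hy : 0 < y := hy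
    simp only [Real.log_mul hx.ne' hy.ne']
    push_cast
    ring
  rw [e, integral_comp_mul_left_Ioi
    (fun u => f u * (Real.log u : ℂ) + f u * ((c - Real.log x : ℝ) : ℂ)) _ hx, mul_zero, integral_add hl (hfi.mul_const _),
    integral_mul_const, h0, zero_mul, add_zero, Complex.real_smul]
  push_cast
  rfl

/-- the Voronoi operator equals the iterated Müntz operator. -/
theorem voronoi_eq_iterated_muntz (α : ℝ) (hα : 1 < α) (f : ℝ → ℂ)
    (hf : MuntzClass α f) (hPf : MuntzClass α (muntzOp f)) :
    ∀ x : ℝ, 0 < x → voronoiOp f x = muntzOp (muntzOp f) x := by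

  intro x hx
  obtain ⟨C, hC0, hC⟩ := mc_bound hα hf
  have h0 := int_zero hα hf hPf
  have hmt : muntzOp f = thetaOp f := by
    funext x; simp [muntzOp, h0]
  rw [voronoiOp, double_sum hα hC hx, log_int hα (mc_cont hf) hC h0 hx,
    ← int_muntz hα hf hPf, muntzOp.eq_def (muntzOp f)]
  rw [hmt]
end
end

section
/- Let α > 1 and let f belong to the Müntz class M_α. Then for every s = σ + it with 0 < σ < 1 the Müntz type formula for the Voronoi operator holds: ζ(s)² f*(s) = ∫₀^∞ x^{s−1} [ Σ_{n=1}^∞ d(n) f(nx) − ∫₀^∞ f(xy)(log y + 2γ) dy ] dx. -/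
open MeasureTheory Filter Asymptotics Set Complex

noncomputable section

lemma fract_meas : Measurable (fun t : ℝ => ((Int.fract t : ℝ) : ℂ)) :=
  Complex.measurable_ofReal.comp measurable_fract

lemma cpow_cont (s : ℂ) : ContinuousOn (fun t : ℝ => (t : ℂ) ^ s) (Ioi 0) := fun _ ht =>
  (continuousAt_ofReal_cpow_const _ _ (Or.inr (ne_of_gt ht))).continuousWithinAt

lemma fract_norm_le (t : ℝ) : ‖((Int.fract t : ℝ) : ℂ)‖ ≤ 1 := by
  rw [norm_real, Real.norm_of_nonneg (Int.fract_nonneg t)]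
  exact (Int.fract_lt_one t).le

lemma J_integrable {s : ℂ} (hs : 0 < s.re) :
    IntegrableOn (fun t : ℝ => ((Int.fract t : ℝ) : ℂ) * (t : ℂ) ^ (-(s + 1))) (Ioi 1) := by
  have h : IntegrableOn (fun t : ℝ => (t : ℂ) ^ (-(s + 1))) (Ioi 1) := by
    apply integrableOn_Ioi_cpow_of_lt _ one_pos
    simp; linarith
  refine Integrable.bdd_mul (c := 1) h fract_meas.aestronglyMeasurable ?_
  exact Eventually.of_forall fract_norm_le

lemma zeta_of_one_lt {s : ℂ} (hs : 1 < s.re) :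
    riemannZeta s = s / (s - 1) -
      s * ∫ t in Ioi (1:ℝ), ((Int.fract t : ℝ) : ℂ) * (t : ℂ) ^ (-(s + 1)) := by
  have h1 : s - 1 ≠ 0 := by
    intro h; rw [sub_eq_zero] at h; rw [h] at hs; simp at hs
  have h := LSeries_eq_mul_integral_of_nonneg (fun _ => 1) zero_le_one hs
    (by simpa using isBigO_refl _ _) (fun _ => zero_le_one)
  have hL : LSeries (fun n => ((1:ℝ):ℂ)) s = riemannZeta s := by
    have := LSeries_one_eq_riemannZeta hs
    rw [← this]; congr 1
  rw [hL] at h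
  rw [h]
  have h2 : IntegrableOn (fun t : ℝ => (t : ℂ) ^ (-s)) (Ioi 1) := by
    apply integrableOn_Ioi_cpow_of_lt _ one_pos
    simp; linarith
  have h3 : ∫ t in Ioi (1:ℝ), (t : ℂ) ^ (-s) = 1 / (s - 1) := by
    rw [integral_Ioi_cpow_of_lt (by simp; linarith) one_pos]
    simp only [ofReal_one, one_cpow]
    have : -s + 1 ≠ 0 := by intro h; apply h1; linear_combination -h
    field_simp; ring
  have h4 : ∫ t in Ioi (1:ℝ), (∑ k ∈ Finset.Icc 1 ⌊t⌋₊, (((1:ℝ)) : ℂ)) * (t:ℂ) ^ (-(s + 1))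
      = ∫ t in Ioi (1:ℝ), ((t : ℂ) ^ (-s) - ((Int.fract t : ℝ) : ℂ) * (t : ℂ) ^ (-(s + 1))) := by
    refine setIntegral_congr_fun measurableSet_Ioi ?_
    intro t ht
    have ht0 : (0:ℝ) < t := lt_trans one_pos ht
    have e1 : (t : ℂ) ^ (-s) = t * (t:ℂ) ^ (-(s+1)) := by
      rw [show -s = 1 + -(s+1) by ring, cpow_add _ _ (by exact_mod_cast ht0.ne'), cpow_one]
    have e2 : ((Int.fract t : ℝ) : ℂ) = t - (⌊t⌋₊ : ℂ) := by
      rw [Int.fract, ← natCast_floor_eq_intCast_floor ht0.le]; push_cast; rfl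
    simp only [e1, e2]; simp; ring
  rw [h4, integral_sub h2 (J_integrable (by linarith)), h3]
  ring

lemma J_eq_mellin (s : ℂ) :
    ∫ t in Ioi (1:ℝ), ((Int.fract t : ℝ) : ℂ) * (t : ℂ) ^ (-(s + 1)) =
      mellin ((Ioi (1:ℝ)).indicator (fun t : ℝ => ((Int.fract t : ℝ) : ℂ))) (-s) := by
  rw [mellin]
  have : ∀ t : ℝ, (t:ℂ) ^ (-s - 1) • (Ioi (1:ℝ)).indicator (fun t : ℝ => ((Int.fract t : ℝ) : ℂ)) t
     = (Ioi (1:ℝ)).indicator (fun t : ℝ => ((Int.fract t : ℝ) : ℂ) * (t : ℂ) ^ (-(s + 1))) t := by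
    intro t
    by_cases h : t ∈ Ioi (1:ℝ)
    · simp only [indicator_of_mem h, smul_eq_mul]
      rw [show -s - 1 = -(s+1) by ring]; ring
    · simp only [indicator_of_notMem h, smul_zero]
  simp_rw [this]
  rw [setIntegral_indicator measurableSet_Ioi]
  congr 2
  ext x; simp

lemma J_diff {s : ℂ} (hs : 0 < s.re) : DifferentiableAt ℂ (fun s : ℂ =>
    ∫ t in Ioi (1:ℝ), ((Int.fract t : ℝ) : ℂ) * (t : ℂ) ^ (-(s + 1))) s := by
  simp_rw [J_eq_mellin]
  have hb : ∀ t, ‖(Ioi (1:ℝ)).indicator (fun t : ℝ => ((Int.fract t : ℝ) : ℂ)) t‖ ≤ 1 := by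
    intro t
    by_cases h : t ∈ Ioi (1:ℝ)
    · rw [indicator_of_mem h]; exact fract_norm_le t
    · rw [indicator_of_notMem h]; simp
  have hd : DifferentiableAt ℂ
      (mellin ((Ioi (1:ℝ)).indicator (fun t : ℝ => ((Int.fract t : ℝ) : ℂ)))) (-s) := by
    refine mellin_differentiableAt_of_isBigO_rpow (a := 0) (b := -s.re - 1) ?_ ?_ ?_ ?_ ?_
    · apply LocallyIntegrable.locallyIntegrableOn
      have : LocallyIntegrable (fun _ : ℝ => (1:ℝ)) := continuous_const.locallyIntegrable
      refine this.mono (fract_meas.indicator measurableSet_Ioi).aestronglyMeasurable ?_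
      exact Eventually.of_forall (fun t => by simpa using hb t)
    · refine IsBigO.of_bound 1 (Eventually.of_forall fun t => ?_)
      simpa using hb t
    · simpa using hs
    · refine IsBigO.of_bound 1 ?_
      filter_upwards [mem_nhdsWithin_of_mem_nhds (Iio_mem_nhds (one_pos : (0:ℝ) < 1))] with t ht
      rw [indicator_of_notMem]
      · simp
      · simpa using (mem_Iio.mp ht).le
    · simp
  exact hd.comp s (differentiableAt_id.neg)

/-- `ζ(s) = s/(s-1) - s ∫_1^∞ {t} t^{-s-1} dt` for `Re s > 0`. -/
lemma zeta_of_pos {s : ℂ} (hs : 0 < s.re) (hs1 : s ≠ 1) :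
    riemannZeta s = s / (s - 1) -
      s * ∫ t in Ioi (1:ℝ), ((Int.fract t : ℝ) : ℂ) * (t : ℂ) ^ (-(s + 1)) := by
  have hU : IsOpen ({s : ℂ | 0 < s.re} \ {1}) :=
    (isOpen_lt continuous_const continuous_re).sdiff isClosed_singleton
  have hconn : IsPreconnected ({s : ℂ | 0 < s.re} \ {1}) := by
    have c1 : Convex ℝ {s : ℂ | 0 < s.re} := convex_halfSpace_re_gt 0
    have c2 : Convex ℝ {s : ℂ | 1 < s.re} := convex_halfSpace_re_gt 1
    have c3 : Convex ℝ {s : ℂ | s.re < 1} := convex_halfSpace_re_lt 1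
    have c4 : Convex ℝ {s : ℂ | 0 < s.im} := convex_halfSpace_im_gt 0
    have c5 : Convex ℝ {s : ℂ | s.im < 0} := convex_halfSpace_im_lt 0
    have u1 := IsPreconnected.union (2 + I) (by simp) (by simp)
      c2.isPreconnected (c1.inter c4).isPreconnected
    have u2 := IsPreconnected.union (2 - I) (by simp) (by simp)
      u1 (c1.inter c5).isPreconnected
    have u3 := IsPreconnected.union (1 / 2 + I) (by simp) (by norm_num)
      u2 (c1.inter c3).isPreconnected
    convert u3 using 1
    ext z
    simp only [Set.mem_sdiff, mem_ofPred_eq, mem_singleton_iff, mem_union, mem_inter_iff]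
    constructor
    · rintro ⟨h1, h2⟩
      by_contra hcon
      push Not at hcon
      obtain ⟨⟨⟨h3, h4⟩, h5⟩, h6⟩ := hcon
      exact h2 (Complex.ext (by simpa using le_antisymm h3 (h6 h1))
        (by simpa using le_antisymm (h4 h1) (h5 h1)))
    · rintro (((h | h) | h) | h)
      · exact ⟨by linarith, by rintro rfl; simp at h⟩
      · exact ⟨h.1, by rintro rfl; simp at h⟩
      · exact ⟨h.1, by rintro rfl; simp at h⟩
      · exact ⟨h.1, by rintro rfl; simp at h⟩
  have hA : AnalyticOnNhd ℂ riemannZeta ({s : ℂ | 0 < s.re} \ {1}) := by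
    apply DifferentiableOn.analyticOnNhd _ hU
    intro z hz
    exact (differentiableAt_riemannZeta (by simpa using hz.2)).differentiableWithinAt
  have hB : AnalyticOnNhd ℂ (fun s => s / (s - 1) -
      s * ∫ t in Ioi (1:ℝ), ((Int.fract t : ℝ) : ℂ) * (t : ℂ) ^ (-(s + 1)))
      ({s : ℂ | 0 < s.re} \ {1}) := by
    apply DifferentiableOn.analyticOnNhd _ hU
    intro z hz
    apply DifferentiableAt.differentiableWithinAt
    have h1 : z - 1 ≠ 0 := sub_ne_zero.mpr (by simpa using hz.2)
    have d1 : DifferentiableAt ℂ (fun s : ℂ => s / (s - 1)) z :=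
      differentiableAt_fun_id.div (differentiableAt_fun_id.sub_const 1) h1
    exact d1.sub (differentiableAt_fun_id.mul (J_diff hz.1))
  have := hA.eqOn_of_preconnected_of_eventuallyEq hB hconn (z₀ := 2) (by simp) ?_
  · exact this ⟨hs, by simpa using hs1⟩
  · filter_upwards [(isOpen_lt continuous_const continuous_re).mem_nhds
      (show (2:ℂ) ∈ {s : ℂ | 1 < s.re} by simp)] with z hz
    exact zeta_of_one_lt hz

lemma fract_eq_small : EqOn (fun t : ℝ => ((Int.fract t : ℝ) : ℂ)) (fun t => (t : ℂ)) (Ioo 0 1) := by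
  intro t ht
  simp only [Int.fract_eq_self.mpr ⟨ht.1.le, ht.2⟩]

lemma small_integrable {s : ℂ} (hs1 : s.re < 1) :
    IntegrableOn (fun t : ℝ => ((Int.fract t : ℝ) : ℂ) * (t : ℂ) ^ (-(s + 1))) (Ioc 0 1) ∧
    ∫ t in Ioc (0:ℝ) 1, ((Int.fract t : ℝ) : ℂ) * (t : ℂ) ^ (-(s + 1)) = 1 / (1 - s) := by
  have hI : IntervalIntegrable (fun t : ℝ => (t : ℂ) ^ (-s)) volume 0 1 :=
    intervalIntegral.intervalIntegrable_cpow' (by simpa using hs1)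
  have heq : EqOn (fun t : ℝ => ((Int.fract t : ℝ) : ℂ) * (t : ℂ) ^ (-(s + 1)))
      (fun t => (t : ℂ) ^ (-s)) (Ioo 0 1) := by
    intro t ht
    have h1 := fract_eq_small ht
    simp only at h1 ⊢
    rw [h1, show -s = 1 + -(s+1) by ring, cpow_add _ _ (by exact_mod_cast ht.1.ne'), cpow_one]
  constructor
  · rw [integrableOn_Ioc_iff_integrableOn_Ioo]
    rw [intervalIntegrable_iff_integrableOn_Ioo_of_le zero_le_one] at hI
    exact hI.congr_fun heq.symm measurableSet_Ioo
  · rw [integral_Ioc_eq_integral_Ioo, setIntegral_congr_fun measurableSet_Ioo heq,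
      ← integral_Ioc_eq_integral_Ioo, ← intervalIntegral.integral_of_le zero_le_one,
      integral_cpow (Or.inl (by simpa using hs1))]
    have : -s + 1 ≠ 0 := by
      intro h
      have : s = 1 := by linear_combination -h
      rw [this] at hs1; simp at hs1
    rw [ofReal_zero, zero_cpow this, ofReal_one, one_cpow, sub_zero]
    congr 1; ring

lemma zeta_strip {s : ℂ} (hs : 0 < s.re) (hs1 : s.re < 1) :
    IntegrableOn (fun t : ℝ => ((Int.fract t : ℝ) : ℂ) * (t : ℂ) ^ (-(s + 1))) (Ioi 0) ∧
    riemannZeta s = -s * ∫ t in Ioi (0:ℝ), ((Int.fract t : ℝ) : ℂ) * (t : ℂ) ^ (-(s + 1)) := by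
  have h1 : s ≠ 1 := by rintro rfl; simp at hs1
  have hU : Ioi (0:ℝ) = Ioc 0 1 ∪ Ioi 1 := (Ioc_union_Ioi_eq_Ioi zero_le_one).symm
  constructor
  · rw [hU]; exact (small_integrable hs1).1.union (J_integrable hs)
  · rw [hU, setIntegral_union (Ioc_disjoint_Ioi le_rfl) measurableSet_Ioi
      (small_integrable hs1).1 (J_integrable hs), (small_integrable hs1).2, zeta_of_pos hs h1]
    have a : s - 1 ≠ 0 := sub_ne_zero.mpr h1
    have b : 1 - s ≠ 0 := sub_ne_zero.mpr h1.symm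
    have : s / (s - 1) = - (s * (1 / (1 - s))) := by
      field_simp; ring
    rw [this]; ring

/-- The class of functions to which the Müntz-type argument applies. -/
def Adm (g : ℝ → ℂ) : Prop :=
  (∀ x : ℝ, 0 < x → DifferentiableAt ℝ g x) ∧
  ∃ C : ℝ, 0 ≤ C ∧ ∀ x : ℝ, 0 < x → ‖g x‖ ≤ C ∧ ‖g x‖ * x ≤ C ∧ ‖deriv g x‖ * x ≤ C ∧
    ‖deriv g x‖ * x ^ 2 ≤ C

/-- `Q g (x) = ∫ {y} x g'(xy) dy`. -/
def Qop (g : ℝ → ℂ) (x : ℝ) : ℂ :=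
  ∫ y in Ioi (0:ℝ), ((Int.fract y : ℝ) : ℂ) * ((x : ℂ) * deriv g (x * y))

lemma Adm.scale {g : ℝ → ℂ} (hg : Adm g) {x : ℝ} (hx : 0 < x) : Adm (fun y => g (x * y)) := by
  obtain ⟨hd, C, hC, hb⟩ := hg
  refine ⟨fun y hy => (hd (x * y) (by positivity)).comp y (by fun_prop), C + C / x, by positivity, ?_⟩
  intro y hy
  have hxy : 0 < x * y := by positivity
  obtain ⟨b1, b2, b3, b4⟩ := hb (x * y) hxy
  have e : deriv (fun y => g (x * y)) y = x • deriv g (x * y) := deriv_comp_mul_left x g y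
  rw [e, norm_smul, Real.norm_of_nonneg hx.le]
  have hCx : 0 ≤ C / x := by positivity
  refine ⟨by linarith, ?_, by nlinarith, ?_⟩
  · have : ‖g (x * y)‖ * y ≤ C / x := by rw [le_div_iff₀ hx]; linarith
    linarith
  · have : x * ‖deriv g (x * y)‖ * y ^ 2 ≤ C / x := by rw [le_div_iff₀ hx]; nlinarith
    linarith

/-- dominated integrability on `(0,∞)`. -/
lemma mellin_int {φ : ℝ → ℂ} (hm : AEStronglyMeasurable φ (volume.restrict (Ioi 0))) {C : ℝ}
    (hb : ∀ x : ℝ, 0 < x → ‖φ x‖ ≤ C ∧ ‖φ x‖ * x ≤ C) {s : ℂ} (hs : 0 < s.re) (hs1 : s.re < 1) :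
    IntegrableOn (fun x : ℝ => (x : ℂ) ^ (s - 1) * φ x) (Ioi 0) := by
  have hmm : AEStronglyMeasurable (fun x : ℝ => (x : ℂ) ^ (s - 1) * φ x)
      (volume.restrict (Ioi 0)) :=
    ((cpow_cont (s - 1)).aestronglyMeasurable measurableSet_Ioi).mul hm
  rw [← Ioc_union_Ioi_eq_Ioi (zero_le_one : (0:ℝ) ≤ 1)]
  refine IntegrableOn.union ?_ ?_
  · have h : IntegrableOn (fun x : ℝ => C * x ^ (s.re - 1)) (Ioc 0 1) := by
      have := intervalIntegral.intervalIntegrable_rpow' (a := 0) (b := 1)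
        (show -1 < s.re - 1 by linarith)
      rw [intervalIntegrable_iff_integrableOn_Ioc_of_le zero_le_one] at this
      exact this.const_mul C
    refine Integrable.mono' h (hmm.mono_measure (Measure.restrict_mono Ioc_subset_Ioi_self le_rfl)) ?_
    filter_upwards [ae_restrict_mem measurableSet_Ioc] with x hx
    rw [norm_mul, norm_cpow_eq_rpow_re_of_pos hx.1, mul_comm]
    rw [sub_re, one_re]
    exact mul_le_mul_of_nonneg_right (hb x hx.1).1 (Real.rpow_nonneg hx.1.le _)
  · have h : IntegrableOn (fun x : ℝ => C * x ^ (s.re - 2)) (Ioi 1) :=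
      (integrableOn_Ioi_rpow_of_lt (by linarith) one_pos).const_mul C
    refine Integrable.mono' h (hmm.mono_measure (Measure.restrict_mono
      (Ioi_subset_Ioi zero_le_one) le_rfl)) ?_
    filter_upwards [ae_restrict_mem measurableSet_Ioi] with x hx
    have hx0 : 0 < x := lt_trans one_pos hx
    rw [norm_mul, norm_cpow_eq_rpow_re_of_pos hx0]
    have e : x ^ ((s - 1).re) = x * x ^ (s.re - 2) := by
      rw [sub_re, one_re, show s.re - 1 = 1 + (s.re - 2) by ring, Real.rpow_add hx0, Real.rpow_one]
    rw [e]
    have := (hb x hx0).2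
    have hp : 0 ≤ x ^ (s.re - 2) := by positivity
    nlinarith

lemma Adm.cont {g : ℝ → ℂ} (hg : Adm g) : ContinuousOn g (Ioi 0) := fun x hx =>
  (hg.1 x hx).continuousAt.continuousWithinAt

lemma Adm.int_g {g : ℝ → ℂ} (hg : Adm g) {s : ℂ} (hs : 0 < s.re) (hs1 : s.re < 1) :
    IntegrableOn (fun x : ℝ => (x : ℂ) ^ (s - 1) * g x) (Ioi 0) := by
  have hc := hg.cont
  obtain ⟨hd, C, hC, hb⟩ := hg
  exact mellin_int (hc.aestronglyMeasurable measurableSet_Ioi) (C := C)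
    (fun x hx => ⟨(hb x hx).1, (hb x hx).2.1⟩) hs hs1

lemma cpow_split {x : ℝ} (hx : 0 < x) (s : ℂ) : (x : ℂ) ^ s = (x:ℂ) ^ (s - 1) * x := by
  have h0 : (x : ℂ) ≠ 0 := by exact_mod_cast hx.ne'
  rw [cpow_sub _ _ h0, cpow_one, div_mul_cancel₀ _ h0]

lemma Adm.int_dg {g : ℝ → ℂ} (hg : Adm g) {s : ℂ} (hs : 0 < s.re) (hs1 : s.re < 1) :
    IntegrableOn (fun x : ℝ => (x : ℂ) ^ s * deriv g x) (Ioi 0) := by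
  obtain ⟨hd, C, hC, hb⟩ := hg
  have := mellin_int (φ := fun x => (x : ℂ) * deriv g x) (C := C)
    (by have := measurable_deriv g; fun_prop)
    (fun x hx => ?_) hs hs1
  · refine this.congr_fun (fun x hx => ?_) measurableSet_Ioi
    simp only; rw [cpow_split hx s]; ring
  · obtain ⟨b1, b2, b3, b4⟩ := hb x hx
    rw [norm_mul, norm_real, Real.norm_of_nonneg hx.le]
    constructor <;> nlinarith

lemma Adm.parts {g : ℝ → ℂ} (hg : Adm g) {s : ℂ} (hs : 0 < s.re) (hs1 : s.re < 1) :
    ∫ x in Ioi (0:ℝ), (x : ℂ) ^ s * deriv g x = - s * ∫ x in Ioi (0:ℝ), (x : ℂ) ^ (s - 1) * g x := by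
  have hi1 := hg.int_g hs hs1
  have hi2 := hg.int_dg hs hs1
  obtain ⟨hd, C, hC, hb⟩ := hg
  have hs0 : s ≠ 0 := by rintro rfl; simp at hs
  have := integral_Ioi_mul_deriv_eq_deriv_mul (a := 0) (u := fun x : ℝ => (x : ℂ) ^ s) (v := g)
    (u' := fun x : ℝ => s * (x : ℂ) ^ (s - 1)) (v' := deriv g) (a' := 0) (b' := 0)
    (fun x hx => hasDerivAt_ofReal_cpow_const (ne_of_gt hx) hs0)
    (fun x hx => (hd x hx).hasDerivAt) hi2
    (by
      have h := Integrable.const_mul hi1 s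
      simp only [← mul_assoc] at h
      exact h) ?_ ?_
  · rw [this]
    simp only [mul_assoc]
    rw [integral_const_mul]; ring
  · rw [tendsto_zero_iff_norm_tendsto_zero]
    have h0 : Tendsto (fun x : ℝ => x ^ s.re * C) (nhdsWithin 0 (Ioi 0)) (nhds 0) := by
      have : Tendsto (fun x : ℝ => x ^ s.re * C) (nhds 0) (nhds (0 ^ s.re * C)) :=
        ((Real.continuousAt_rpow_const 0 s.re (Or.inr hs.le)).mul continuousAt_const)
      rw [Real.zero_rpow hs.ne', zero_mul] at this
      exact this.mono_left nhdsWithin_le_nhds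
    refine squeeze_zero' (Eventually.of_forall fun x => norm_nonneg _) ?_ h0
    filter_upwards [self_mem_nhdsWithin] with x hx
    simp only [Pi.mul_apply, norm_mul]
    rw [norm_cpow_eq_rpow_re_of_pos hx]
    exact mul_le_mul_of_nonneg_left (hb x hx).1 (Real.rpow_nonneg (le_of_lt hx) _)
  · rw [tendsto_zero_iff_norm_tendsto_zero]
    have h0 : Tendsto (fun x : ℝ => x ^ (-(1 - s.re)) * C) atTop (nhds 0) := by
      have := (tendsto_rpow_neg_atTop (show 0 < 1 - s.re by linarith)).mul_const C
      simpa using this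
    refine squeeze_zero' (Eventually.of_forall fun x => norm_nonneg _) ?_ h0
    filter_upwards [Ioi_mem_atTop 0] with x hx
    have hx : 0 < x := hx
    simp only [Pi.mul_apply, norm_mul]
    rw [norm_cpow_eq_rpow_re_of_pos hx, show s.re = -(1 - s.re) + 1 by ring, Real.rpow_add hx,
      Real.rpow_one]
    have := (hb x hx).2.1
    have hp : 0 ≤ x ^ (-(1 - s.re)) := by positivity
    rw [show -(1 - (-(1 - s.re) + 1)) = -(1 - s.re) by ring]
    nlinarith

/-- Müntz formula for `Q`. -/
lemma Adm.muntz {g : ℝ → ℂ} (hg : Adm g) {s : ℂ} (hs : 0 < s.re) (hs1 : s.re < 1) :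
    ∫ x in Ioi (0:ℝ), (x : ℂ) ^ (s - 1) * Qop g x =
      riemannZeta s * ∫ x in Ioi (0:ℝ), (x : ℂ) ^ (s - 1) * g x := by
  set ψ : ℝ → ℂ := fun u => (u : ℂ) ^ s * deriv g u with hψ
  have hψi : IntegrableOn ψ (Ioi 0) := hg.int_dg hs hs1
  have hψm : Measurable ψ := by
    have := measurable_deriv g
    have h2 : Measurable (fun u : ℝ => (u : ℂ) ^ s) := Complex.measurable_ofReal.pow_const s
    exact h2.mul this
  obtain ⟨zi, ze⟩ := zeta_strip hs hs1
  -- the kernel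
  set F : ℝ → ℝ → ℂ := fun x y => ((Int.fract y : ℝ) : ℂ) * (y : ℂ) ^ (-s) * ψ (y * x) with hF
  have hFm : Measurable (Function.uncurry F) := by
    have h1 : Measurable (fun p : ℝ × ℝ => ((Int.fract p.2 : ℝ) : ℂ)) :=
      fract_meas.comp measurable_snd
    have h2 : Measurable (fun p : ℝ × ℝ => (p.2 : ℂ) ^ (-s)) :=
      (Complex.measurable_ofReal.pow_const (-s)).comp measurable_snd
    exact (h1.mul h2).mul (hψm.comp (measurable_snd.mul measurable_fst))
  have hy1 : ∀ y : ℝ, 0 < y → (y : ℂ) ^ (-s) * (y : ℂ)⁻¹ = (y : ℂ) ^ (-(s + 1)) := by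
    intro y hy
    rw [show -(s+1) = -s - 1 by ring, cpow_sub _ _ (by exact_mod_cast hy.ne'), cpow_one]
    rfl
  have hFint : Integrable (Function.uncurry F)
      ((volume.restrict (Ioi 0)).prod (volume.restrict (Ioi 0))) := by
    rw [integrable_prod_iff' hFm.aestronglyMeasurable]
    constructor
    · filter_upwards [ae_restrict_mem measurableSet_Ioi] with y hy
      have : IntegrableOn (fun x => ψ (y * x)) (Ioi 0) := by
        rw [integrableOn_Ioi_comp_mul_left_iff _ _ hy]; simpa using hψi
      exact Integrable.const_mul this (((Int.fract y : ℝ) : ℂ) * (y : ℂ) ^ (-s))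
    · have hz := zi.norm.mul_const (∫ u in Ioi (0:ℝ), ‖ψ u‖)
      refine hz.congr ?_
      filter_upwards [ae_restrict_mem measurableSet_Ioi] with y hy
      have hy : 0 < y := hy
      simp only [Function.uncurry, hF, norm_mul]
      rw [integral_const_mul, integral_comp_mul_left_Ioi (fun u => ‖ψ u‖) 0 hy]
      rw [← hy1 y hy, norm_mul, mul_zero, smul_eq_mul, norm_inv, norm_real y,
        Real.norm_of_nonneg hy.le]
      ring
  have step1 : ∫ x in Ioi (0:ℝ), (x : ℂ) ^ (s - 1) * Qop g x =
      ∫ x in Ioi (0:ℝ), ∫ y in Ioi (0:ℝ), F x y := by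
    refine setIntegral_congr_fun measurableSet_Ioi fun x hx => ?_
    have hx : 0 < x := hx
    simp only [Qop]
    rw [← integral_const_mul]
    refine setIntegral_congr_fun measurableSet_Ioi fun y hy => ?_
    have hy : 0 < y := hy
    simp only [hF, hψ]
    have e : ((y * x : ℝ) : ℂ) ^ s = (y : ℂ) ^ s * (x : ℂ) ^ s := by
      rw [ofReal_mul, mul_cpow_ofReal_nonneg hy.le hx.le]
    have e2 : (y : ℂ) ^ (-s) * (y : ℂ) ^ s = 1 := by
      rw [← cpow_add _ _ (by exact_mod_cast hy.ne')]; simp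
    rw [e, cpow_split hx s, mul_comm x y]
    linear_combination (-((Int.fract y : ℝ) : ℂ) * (x:ℂ) ^ (s-1) * x * deriv g (y * x)) * e2
  rw [step1, integral_integral_swap hFint]
  have step2 : ∫ y in Ioi (0:ℝ), ∫ x in Ioi (0:ℝ), F x y =
      ∫ y in Ioi (0:ℝ), (((Int.fract y : ℝ) : ℂ) * (y : ℂ) ^ (-(s + 1))) * ∫ u in Ioi (0:ℝ), ψ u := by
    refine setIntegral_congr_fun measurableSet_Ioi fun y hy => ?_
    have hy : 0 < y := hy
    simp only [hF]
    rw [integral_const_mul, integral_comp_mul_left_Ioi ψ 0 hy, ← hy1 y hy, mul_zero, real_smul,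
      ofReal_inv]
    ring
  rw [step2, integral_mul_const, hg.parts hs hs1, ze]
  ring

lemma fract_le_self {y : ℝ} (hy : 0 ≤ y) : Int.fract y ≤ y := by
  have : (0:ℝ) ≤ ⌊y⌋ := by exact_mod_cast Int.floor_nonneg.mpr hy
  rw [Int.fract]; linarith

lemma fract_norm_le_self {y : ℝ} (hy : 0 ≤ y) : ‖((Int.fract y : ℝ) : ℂ)‖ ≤ y := by
  rw [norm_real, Real.norm_of_nonneg (Int.fract_nonneg y)]; exact fract_le_self hy

lemma Adm.fract_int {g : ℝ → ℂ} (hg : Adm g) :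
    IntegrableOn (fun y : ℝ => ((Int.fract y : ℝ) : ℂ) * deriv g y) (Ioi 0) := by
  obtain ⟨hd, C, hC, hb⟩ := hg
  have hm : Measurable (fun y : ℝ => ((Int.fract y : ℝ) : ℂ) * deriv g y) :=
    fract_meas.mul (measurable_deriv g)
  rw [← Ioc_union_Ioi_eq_Ioi (zero_le_one : (0:ℝ) ≤ 1)]
  refine IntegrableOn.union ?_ ?_
  · refine Measure.integrableOn_of_bounded (M := C) (by simp) hm.aestronglyMeasurable ?_
    filter_upwards [ae_restrict_mem measurableSet_Ioc] with y hy
    rw [norm_mul]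
    have := (hb y hy.1).2.2.1
    have h2 := fract_norm_le_self hy.1.le
    nlinarith [norm_nonneg (deriv g y)]
  · have h : IntegrableOn (fun x : ℝ => C * x ^ (-2 : ℝ)) (Ioi 1) :=
      (integrableOn_Ioi_rpow_of_lt (by norm_num) one_pos).const_mul C
    refine Integrable.mono' h hm.aestronglyMeasurable ?_
    filter_upwards [ae_restrict_mem measurableSet_Ioi] with y hy
    have hy0 : 0 < y := lt_trans one_pos hy
    rw [norm_mul, Real.rpow_neg hy0.le, Real.rpow_two, ← div_eq_mul_inv, le_div_iff₀ (by positivity)]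
    have := (hb y hy0).2.2.2
    have h2 := fract_norm_le y
    have h3 : 0 ≤ ‖deriv g y‖ * y ^ 2 := by positivity
    nlinarith

lemma Adm.ii {g : ℝ → ℂ} (hg : Adm g) {a b : ℝ} (ha : 0 ≤ a) (hab : a ≤ b) :
    IntervalIntegrable g volume a b := by
  have hc := hg.cont
  obtain ⟨hd, C, hC, hb⟩ := hg
  rw [intervalIntegrable_iff_integrableOn_Ioc_of_le hab]
  have hsub : Ioc a b ⊆ Ioi 0 := fun x hx => lt_of_le_of_lt ha hx.1
  refine Integrable.mono' (g := fun _ => C) (by simp)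
    ((hc.mono hsub).aestronglyMeasurable measurableSet_Ioc) ?_
  filter_upwards [ae_restrict_mem measurableSet_Ioc] with y hy
  exact (hb y (hsub hy)).1

lemma Adm.step {g : ℝ → ℂ} (hg : Adm g) (m : ℕ) :
    ∫ y in (m:ℝ)..((m + 1 : ℕ) : ℝ), ((Int.fract y : ℝ) : ℂ) * deriv g y =
      g (m + 1) - ∫ y in (m:ℝ)..((m + 1 : ℕ) : ℝ), g y := by
  have hlt : (m:ℝ) < ((m + 1 : ℕ) : ℝ) := by push_cast; linarith
  have hm0 : (0:ℝ) ≤ m := by positivity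
  have hg' := hg
  have hii := hg.ii hm0 hlt.le
  have hfi : IntervalIntegrable (fun y : ℝ => ((Int.fract y : ℝ) : ℂ) * deriv g y) volume
      (m:ℝ) ((m + 1 : ℕ) : ℝ) := by
    rw [intervalIntegrable_iff_integrableOn_Ioc_of_le hlt.le]
    exact hg.fract_int.mono_set (fun x hx => lt_of_le_of_lt hm0 hx.1)
  obtain ⟨hd, C, hC, hb⟩ := hg
  have heq : EqOn (fun y : ℝ => g y + ((Int.fract y : ℝ) : ℂ) * deriv g y)
    (fun y : ℝ => g y + ((y - m : ℝ) : ℂ) * deriv g y) (Ioo (m:ℝ) ((m + 1 : ℕ) : ℝ)) := by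
    intro y hy
    have : Int.fract y = y - m := by
      have : ⌊y⌋ = m := by
        rw [Int.floor_eq_iff]; push_cast
        exact ⟨hy.1.le, by have := hy.2; push_cast at this; exact this⟩
      rw [Int.fract, this]; simp
    simp only [this]
  have hint2 : IntervalIntegrable (fun y : ℝ => g y + ((y - m : ℝ) : ℂ) * deriv g y) volume
      (m:ℝ) ((m + 1 : ℕ) : ℝ) := by
    have := hii.add hfi
    rw [intervalIntegrable_iff_integrableOn_Ioo_of_le hlt.le] at this ⊢
    exact this.congr_fun heq measurableSet_Ioo
  have key := intervalIntegral.integral_eq_sub_of_hasDerivAt_of_tendsto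
    (f := fun y : ℝ => ((y - m : ℝ) : ℂ) * g y)
    (f' := fun y : ℝ => g y + ((y - m : ℝ) : ℂ) * deriv g y) (fa := 0) (fb := g (m + 1)) hlt
    ?_ hint2 ?_ ?_
  · have e1 : ∫ y in (m:ℝ)..((m + 1 : ℕ) : ℝ), (g y + ((Int.fract y : ℝ) : ℂ) * deriv g y) =
        ∫ y in (m:ℝ)..((m + 1 : ℕ) : ℝ), (g y + ((y - m : ℝ) : ℂ) * deriv g y) := by
      rw [intervalIntegral.integral_of_le hlt.le, intervalIntegral.integral_of_le hlt.le,
        integral_Ioc_eq_integral_Ioo, integral_Ioc_eq_integral_Ioo]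
      exact setIntegral_congr_fun measurableSet_Ioo heq
    rw [intervalIntegral.integral_add hii hfi] at e1
    rw [key] at e1
    linear_combination e1
  · intro y hy
    have h1 : HasDerivAt (fun y : ℝ => ((y - m : ℝ) : ℂ)) 1 y := by
      have := ((hasDerivAt_id y).sub_const (m:ℝ)).ofReal_comp
      simpa using this
    have := h1.mul (hd y (lt_of_le_of_lt hm0 hy.1)).hasDerivAt
    rw [one_mul] at this
    exact this
  · rw [tendsto_zero_iff_norm_tendsto_zero]
    have h0 : Tendsto (fun y : ℝ => |y - m| * C) (nhdsWithin m (Ioi m)) (nhds 0) := by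
      have : Tendsto (fun y : ℝ => |y - m| * C) (nhds m) (nhds (|(m:ℝ) - m| * C)) := by
        apply Continuous.tendsto; fun_prop
      simp only [sub_self, abs_zero, zero_mul] at this
      exact this.mono_left nhdsWithin_le_nhds
    refine squeeze_zero' (Eventually.of_forall fun x => norm_nonneg _) ?_ h0
    filter_upwards [self_mem_nhdsWithin] with y hy
    rw [norm_mul, norm_real, Real.norm_eq_abs]
    exact mul_le_mul_of_nonneg_left (hb y (lt_of_le_of_lt hm0 hy)).1 (abs_nonneg _)
  · have hc : ContinuousAt (fun y : ℝ => ((y - m : ℝ) : ℂ) * g y) ((m + 1 : ℕ) : ℝ) := by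
      refine ContinuousAt.mul (by fun_prop) (hd _ (by positivity)).continuousAt
    have := hc.tendsto.mono_left (nhdsWithin_le_nhds (s := Iio ((m + 1 : ℕ) : ℝ)))
    simpa using this

lemma Adm.euler {g : ℝ → ℂ} (hg : Adm g) :
    Tendsto (fun N : ℕ => ∑ m ∈ Finset.range N, g (m + 1) - ∫ y in (0:ℝ)..N, g y) atTop
      (nhds (∫ y in Ioi (0:ℝ), ((Int.fract y : ℝ) : ℂ) * deriv g y)) := by
  have h := (intervalIntegral_tendsto_integral_Ioi 0 hg.fract_int tendsto_id).comp
    (tendsto_natCast_atTop_atTop (R := ℝ))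
  refine h.congr fun N => ?_
  simp only [Function.comp, id]
  have hfi : ∀ k < N, IntervalIntegrable (fun y : ℝ => ((Int.fract y : ℝ) : ℂ) * deriv g y) volume
      ((k:ℕ):ℝ) ((k + 1 : ℕ) : ℝ) := by
    intro k _
    rw [intervalIntegrable_iff_integrableOn_Ioc_of_le (by push_cast; linarith)]
    exact hg.fract_int.mono_set (fun x hx => lt_of_le_of_lt (by positivity) hx.1)
  have hgi : ∀ k < N, IntervalIntegrable g volume ((k:ℕ):ℝ) ((k + 1 : ℕ) : ℝ) := by
    intro k _
    exact hg.ii (by positivity) (by push_cast; linarith)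
  have e1 := intervalIntegral.sum_integral_adjacent_intervals hfi
  have e2 := intervalIntegral.sum_integral_adjacent_intervals hgi
  simp only [Nat.cast_zero] at e1 e2
  rw [← e1, ← e2, ← Finset.sum_sub_distrib]
  exact Finset.sum_congr rfl fun m _ => hg.step m

lemma Qop_eq_deriv (g : ℝ → ℂ) (x : ℝ) :
    Qop g x = ∫ y in Ioi (0:ℝ), ((Int.fract y : ℝ) : ℂ) * deriv (fun z => g (x * z)) y := by
  have : ∀ y, deriv (fun z => g (x * z)) y = (x : ℂ) * deriv g (x * y) := fun y => by
    rw [deriv_comp_mul_left x g y, real_smul]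
  simp only [this, Qop]

lemma Adm.euler_scale {g : ℝ → ℂ} (hg : Adm g) {x : ℝ} (hx : 0 < x) :
    Tendsto (fun N : ℕ => ∑ m ∈ Finset.range N, g (x * (m + 1)) - ∫ y in (0:ℝ)..N, g (x * y)) atTop
      (nhds (Qop g x)) := by
  rw [Qop_eq_deriv]
  exact (hg.scale hx).euler

lemma Adm.Qop_eq {g : ℝ → ℂ} (hg : Adm g) {x : ℝ} (hx : 0 < x) (hgi : IntegrableOn g (Ioi 0))
    (hsum : Summable (fun m : ℕ => g (x * (m + 1)))) :
    Qop g x = (∑' m : ℕ, g (x * (m + 1))) - (x : ℂ)⁻¹ * ∫ y in Ioi (0:ℝ), g y := by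
  refine tendsto_nhds_unique (hg.euler_scale hx) ?_
  refine hsum.hasSum.tendsto_sum_nat.sub ?_
  have hi : IntegrableOn (fun y => g (x * y)) (Ioi 0) := by
    rw [integrableOn_Ioi_comp_mul_left_iff _ _ hx]; simpa using hgi
  have h := (intervalIntegral_tendsto_integral_Ioi 0 hi tendsto_id).comp
    (tendsto_natCast_atTop_atTop (R := ℝ))
  rw [integral_comp_mul_left_Ioi g 0 hx, mul_zero, real_smul, ofReal_inv] at h
  exact h

lemma Qop_eq_v (g : ℝ → ℂ) {x : ℝ} (hx : 0 < x) :
    Qop g x = ∫ v in Ioi (0:ℝ), ((Int.fract (v / x) : ℝ) : ℂ) * deriv g v := by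
  have := integral_comp_mul_left_Ioi (fun v => ((Int.fract (v / x) : ℝ) : ℂ) * deriv g v) 0 hx
  rw [mul_zero, real_smul, ofReal_inv] at this
  have hx0 : (x : ℂ) ≠ 0 := by exact_mod_cast hx.ne'
  rw [eq_comm, inv_mul_eq_iff_eq_mul₀ hx0] at this
  rw [this, Qop, ← integral_const_mul]
  congr 1; ext y
  rw [mul_div_cancel_left₀ _ hx.ne']; ring

lemma Qop_bound {g : ℝ → ℂ} (h1 : IntegrableOn (deriv g) (Ioi 0))
    (h2 : IntegrableOn (fun v : ℝ => (v : ℂ) * deriv g v) (Ioi 0)) :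
    ∃ C, 0 ≤ C ∧ ∀ x : ℝ, 0 < x → ‖Qop g x‖ ≤ C ∧ ‖Qop g x‖ * x ≤ C := by
  set A := ∫ v in Ioi (0:ℝ), ‖deriv g v‖ with hA
  set B := ∫ v in Ioi (0:ℝ), ‖(v : ℂ) * deriv g v‖ with hB
  have hA0 : 0 ≤ A := integral_nonneg fun _ => norm_nonneg _
  have hB0 : 0 ≤ B := integral_nonneg fun _ => norm_nonneg _
  refine ⟨A + B, by positivity, fun x hx => ?_⟩
  rw [Qop_eq_v g hx]
  constructor
  · have : ‖∫ v in Ioi (0:ℝ), ((Int.fract (v / x) : ℝ) : ℂ) * deriv g v‖ ≤ A := by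
      refine norm_integral_le_of_norm_le h1.norm (Eventually.of_forall fun v => ?_)
      rw [norm_mul]
      nlinarith [fract_norm_le (v / x), norm_nonneg (deriv g v)]
    linarith
  · have : ‖∫ v in Ioi (0:ℝ), ((Int.fract (v / x) : ℝ) : ℂ) * deriv g v‖ ≤ B / x := by
      rw [hB, ← integral_div]
      refine norm_integral_le_of_norm_le (h2.norm.div_const x) ?_
      filter_upwards [ae_restrict_mem measurableSet_Ioi] with v hv
      have hv : 0 < v := hv
      rw [norm_mul, norm_mul, norm_real v, Real.norm_of_nonneg hv.le, mul_div_right_comm]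
      exact mul_le_mul_of_nonneg_right (fract_norm_le_self (by positivity)) (norm_nonneg _)
    rw [le_div_iff₀ hx] at this
    linarith

/-- bounded with decay of order `β`. -/
def Dec (β : ℝ) (φ : ℝ → ℂ) : Prop :=
  ∃ C : ℝ, 0 ≤ C ∧ ∀ x : ℝ, 0 < x → ‖φ x‖ ≤ C ∧ ‖φ x‖ * x ^ β ≤ C

lemma Dec.of_bigO {β : ℝ} {φ : ℝ → ℂ} (hc : ContinuousOn φ (Ici 0))
    (hO : φ =O[atTop] fun x : ℝ => x ^ (-β)) (hβ : 0 ≤ β) : Dec β φ := by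
  obtain ⟨c, hc0, hcb⟩ := hO.exists_pos
  rw [IsBigOWith, eventually_atTop] at hcb
  obtain ⟨R, hR⟩ := hcb
  set R' := max R 1 with hR'
  have hR1 : 1 ≤ R' := le_max_right _ _
  obtain ⟨M, hM⟩ := (isCompact_Icc (a := (0:ℝ)) (b := R')).exists_bound_of_continuousOn
    (hc.mono (fun x hx => hx.1))
  have hM0 : 0 ≤ M := le_trans (norm_nonneg _) (hM 0 ⟨le_rfl, by linarith⟩)
  have hp : 0 ≤ R' ^ β := by positivity
  have hp1 : 1 ≤ R' ^ β := Real.one_le_rpow hR1 hβ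
  refine ⟨M * R' ^ β + c, by positivity, fun x hx => ?_⟩
  rcases le_or_gt x R' with h | h
  · have hx' := hM x ⟨hx.le, h⟩
    have h2 : x ^ β ≤ R' ^ β := Real.rpow_le_rpow hx.le h hβ
    have h3 : 0 ≤ x ^ β := by positivity
    constructor
    · nlinarith
    · have : ‖φ x‖ * x ^ β ≤ M * R' ^ β := mul_le_mul hx' h2 h3 hM0
      linarith
  · have hx' := hR x (le_trans (le_max_left _ _) h.le)
    have h3 : 0 < x ^ β := by positivity
    have h1 : 1 ≤ x ^ β := Real.one_le_rpow (by linarith) hβ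
    have h4 : ‖φ x‖ * x ^ β ≤ c := by
      rw [Real.norm_of_nonneg (by positivity), Real.rpow_neg hx.le, ← div_eq_mul_inv,
        le_div_iff₀ h3] at hx'
      exact hx'
    have h5 : 0 ≤ M * R' ^ β := by positivity
    constructor
    · nlinarith [norm_nonneg (φ x)]
    · linarith

lemma Dec.pow {β : ℝ} {φ : ℝ → ℂ} (h : Dec β φ) {γ : ℝ} (h0 : 0 ≤ γ) (hγ : γ ≤ β) : Dec γ φ := by
  obtain ⟨C, hC, hb⟩ := h
  refine ⟨2 * C, by positivity, fun x hx => ⟨by linarith [(hb x hx).1], ?_⟩⟩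
  have : x ^ γ ≤ 1 + x ^ β := by
    rcases le_or_gt x 1 with h | h
    · have := Real.rpow_le_one hx.le h h0
      have : 0 ≤ x ^ β := by positivity
      linarith
    · have := Real.rpow_le_rpow_of_exponent_le h.le hγ
      linarith
  nlinarith [hb x hx, norm_nonneg (φ x)]

lemma Dec.mulx {β : ℝ} {φ : ℝ → ℂ} (h : Dec (β + 1) φ) (h0 : 0 ≤ β) :
    Dec β (fun x => (x : ℂ) * φ x) := by
  obtain ⟨C, hC, hb⟩ := h
  obtain ⟨C', hC', hb'⟩ := Dec.pow ⟨C, hC, hb⟩ zero_le_one (by linarith : (1:ℝ) ≤ β + 1)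
  refine ⟨C + C', by positivity, fun x hx => ?_⟩
  rw [norm_mul, norm_real, Real.norm_of_nonneg hx.le]
  have h1 := (hb x hx).2
  have h2 := (hb' x hx).2
  rw [Real.rpow_add hx, Real.rpow_one] at h1
  rw [Real.rpow_one] at h2
  constructor <;> nlinarith

lemma Dec.add {β : ℝ} {φ ψ : ℝ → ℂ} (h : Dec β φ) (h' : Dec β ψ) :
    Dec β (fun x => φ x + ψ x) := by
  obtain ⟨C, hC, hb⟩ := h
  obtain ⟨C', hC', hb'⟩ := h'
  refine ⟨C + C', by positivity, fun x hx => ?_⟩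
  have h1 := norm_add_le (φ x) (ψ x)
  have h3 : 0 ≤ x ^ β := by positivity
  constructor
  · linarith [(hb x hx).1, (hb' x hx).1]
  · nlinarith [(hb x hx).2, (hb' x hx).2]

lemma Dec.le_rpow {β : ℝ} {φ : ℝ → ℂ} (h : Dec β φ) :
    ∃ C, 0 ≤ C ∧ ∀ x : ℝ, 0 < x → ‖φ x‖ ≤ C * x ^ (-β) := by
  obtain ⟨C, hC, hb⟩ := h
  refine ⟨C, hC, fun x hx => ?_⟩
  rw [Real.rpow_neg hx.le, ← div_eq_mul_inv, le_div_iff₀ (by positivity)]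
  exact (hb x hx).2

lemma Dec.int_log {β : ℝ} {φ : ℝ → ℂ} (h : Dec β φ) (hβ : 1 < β)
    (hm : AEStronglyMeasurable φ (volume.restrict (Ioi 0))) (c : ℝ) :
    IntegrableOn (fun x => ((Real.log x + c : ℝ) : ℂ) * φ x) (Ioi 0) := by
  obtain ⟨C, hC, hb⟩ := h
  have hmm : AEStronglyMeasurable (fun x : ℝ => ((Real.log x + c : ℝ) : ℂ) * φ x)
      (volume.restrict (Ioi 0)) := by
    have h1 : Measurable (fun x : ℝ => ((Real.log x + c : ℝ) : ℂ)) :=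
      Complex.measurable_ofReal.comp (Real.measurable_log.add_const c)
    exact h1.aestronglyMeasurable.mul hm
  set ε := (β - 1) / 2 with hε
  have hε0 : 0 < ε := by rw [hε]; linarith
  rw [← Ioc_union_Ioi_eq_Ioi (zero_le_one : (0:ℝ) ≤ 1)]
  refine IntegrableOn.union ?_ ?_
  · have h : IntegrableOn (fun x : ℝ => C * (|Real.log x| + |c|)) (Ioc 0 1) := by
      have := (intervalIntegral.intervalIntegrable_log' (a := 0) (b := 1)).abs
      rw [intervalIntegrable_iff_integrableOn_Ioc_of_le zero_le_one] at this
      exact (this.add (by simp)).const_mul C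
    refine Integrable.mono' h (hmm.mono_measure (Measure.restrict_mono Ioc_subset_Ioi_self le_rfl)) ?_
    filter_upwards [ae_restrict_mem measurableSet_Ioc] with x hx
    rw [norm_mul, mul_comm, norm_real, Real.norm_eq_abs]
    exact mul_le_mul (hb x hx.1).1 (abs_add_le _ _) (abs_nonneg _) hC
  · have h : IntegrableOn (fun x : ℝ => C * (1 / ε + |c|) * x ^ (ε - β)) (Ioi 1) :=
      (integrableOn_Ioi_rpow_of_lt (by rw [hε]; linarith) one_pos).const_mul _
    refine Integrable.mono' h (hmm.mono_measure (Measure.restrict_mono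
      (Ioi_subset_Ioi zero_le_one) le_rfl)) ?_
    filter_upwards [ae_restrict_mem measurableSet_Ioi] with x hx
    have hx1 : 1 < x := hx
    have hx0 : 0 < x := lt_trans one_pos hx
    rw [norm_mul, norm_real, Real.norm_eq_abs]
    have h1 : |Real.log x + c| ≤ (1 / ε + |c|) * x ^ ε := by
      have a1 := Real.log_le_rpow_div hx0.le hε0
      have a2 : 1 ≤ x ^ ε := Real.one_le_rpow hx1.le hε0.le
      have a3 := abs_add_le (Real.log x) c
      rw [abs_of_nonneg (Real.log_nonneg hx1.le)] at a3
      have a4 : x ^ ε / ε = 1 / ε * x ^ ε := by ring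
      nlinarith [abs_nonneg c]
    have h2 : ‖φ x‖ ≤ C * x ^ (-β) := by
      rw [Real.rpow_neg hx0.le, ← div_eq_mul_inv, le_div_iff₀ (by positivity)]
      exact (hb x hx0).2
    calc _ ≤ ((1 / ε + |c|) * x ^ ε) * (C * x ^ (-β)) :=
          mul_le_mul h1 h2 (norm_nonneg _) (by positivity)
      _ = _ := by rw [sub_eq_add_neg, Real.rpow_add hx0]; ring

lemma Dec.int {β : ℝ} {φ : ℝ → ℂ} (h : Dec β φ) (hβ : 1 < β)
    (hm : AEStronglyMeasurable φ (volume.restrict (Ioi 0))) : IntegrableOn φ (Ioi 0) := by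
  have := Integrable.sub (h.int_log hβ hm 1) (h.int_log hβ hm 0)
  refine this.congr (Eventually.of_forall fun x => ?_)
  simp only [Pi.sub_apply]; push_cast; ring

lemma Dec.summable {β : ℝ} {φ : ℝ → ℂ} (h : Dec β φ) (hβ : 1 < β) {x : ℝ} (hx : 0 < x) :
    Summable (fun m : ℕ => φ (x * (m + 1))) := by
  obtain ⟨C, hC, hb⟩ := h.le_rpow
  have hs : Summable (fun m : ℕ => C * x ^ (-β) * ((m + 1 : ℕ) : ℝ) ^ (-β)) :=
    ((summable_nat_add_iff 1).mpr (Real.summable_nat_rpow.mpr (by linarith : -β < -1))).mul_left _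
  refine Summable.of_norm_bounded hs fun m => ?_
  refine (hb _ (by positivity)).trans (le_of_eq ?_)
  rw [Real.mul_rpow hx.le (by positivity)]; push_cast; ring

lemma Dec.summable_prod {β : ℝ} {φ : ℝ → ℂ} (h : Dec β φ) (hβ : 1 < β) {x : ℝ} (hx : 0 < x) :
    Summable (fun p : ℕ × ℕ => φ (x * (p.1 + 1) * (p.2 + 1))) := by
  obtain ⟨C, hC, hb⟩ := h.le_rpow
  have hs1 : Summable (fun m : ℕ => ((m + 1 : ℕ) : ℝ) ^ (-β)) :=
    ((summable_nat_add_iff 1).mpr (Real.summable_nat_rpow.mpr (by linarith : -β < -1)))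
  have hs := (hs1.mul_of_nonneg hs1 (fun _ => by positivity) (fun _ => by positivity)).mul_left
    (C * x ^ (-β))
  refine Summable.of_norm_bounded hs fun p => ?_
  refine (hb _ (by positivity)).trans (le_of_eq ?_)
  rw [Real.mul_rpow (by positivity) (by positivity), Real.mul_rpow hx.le (by positivity)]
  push_cast; ring

lemma divisor_sum {F : ℕ → ℂ} (h : Summable (fun p : ℕ × ℕ => F ((p.1 + 1) * (p.2 + 1)))) :
    ∑' m : ℕ, ∑' n : ℕ, F ((m + 1) * (n + 1)) =
      ∑' k : ℕ, ((k + 1 : ℕ).divisors.card : ℂ) * F (k + 1) := by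
  rw [← h.tsum_prod]
  let e : ℕ+ × ℕ+ ≃ ℕ × ℕ := Equiv.prodCongr Equiv.pnatEquivNat Equiv.pnatEquivNat
  have he : ∀ p : ℕ+ × ℕ+, F (((e p).1 + 1) * ((e p).2 + 1)) = F (p.1 * p.2) := by
    intro p
    congr 1
    simp [e, Equiv.pnatEquivNat, PNat.natPred_add_one]
  have h2 : Summable (fun p : ℕ+ × ℕ+ => F (p.1 * p.2)) := by
    have := (e.summable_iff).mpr h
    exact this.congr he
  rw [← e.tsum_eq, tsum_congr he, ← sigmaAntidiagonalEquivProd.tsum_eq]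
  have h3 : Summable (fun c : (Σ n : ℕ+, Nat.divisorsAntidiagonal n) =>
      F ((sigmaAntidiagonalEquivProd c).1 * (sigmaAntidiagonalEquivProd c).2)) :=
    (sigmaAntidiagonalEquivProd.summable_iff).mpr h2
  rw [h3.tsum_sigma, ← Equiv.pnatEquivNat.symm.tsum_eq]
  refine tsum_congr fun k => ?_
  have h4 : ∀ c : Nat.divisorsAntidiagonal (Equiv.pnatEquivNat.symm k : ℕ+),
    F ((sigmaAntidiagonalEquivProd ⟨Equiv.pnatEquivNat.symm k, c⟩).1 *
      (sigmaAntidiagonalEquivProd ⟨Equiv.pnatEquivNat.symm k, c⟩).2) = F (k + 1) := by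
    intro c
    have := (Nat.mem_divisorsAntidiagonal.mp c.2).1
    congr 1
  rw [tsum_congr h4, tsum_fintype]
  simp only [Finset.sum_const, Finset.card_univ, Fintype.card_coe, nsmul_eq_mul]
  congr 2
  rw [← Nat.map_div_right_divisors, Finset.card_map]
  rfl

/-- Working form of the Müntz class. -/
structure FD (α : ℝ) (f f1 f2 : ℝ → ℂ) : Prop where
  hα : 1 < α
  d1 : ∀ x : ℝ, 0 < x → HasDerivAt f (f1 x) x
  d2 : ∀ x : ℝ, 0 < x → HasDerivAt f1 (f2 x) x
  b0 : Dec α f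
  b1 : Dec (α + 1) f1
  b2 : Dec (α + 2) f2

namespace FD
variable {α : ℝ} {f f1 f2 : ℝ → ℂ}

lemma df (H : FD α f f1 f2) {x : ℝ} (hx : 0 < x) : deriv f x = f1 x := (H.d1 x hx).deriv

lemma mf (H : FD α f f1 f2) : AEStronglyMeasurable f (volume.restrict (Ioi 0)) :=
  ContinuousOn.aestronglyMeasurable
    (fun x hx => (H.d1 x hx).continuousAt.continuousWithinAt) measurableSet_Ioi

lemma mf1 (H : FD α f f1 f2) : AEStronglyMeasurable f1 (volume.restrict (Ioi 0)) :=
  ContinuousOn.aestronglyMeasurable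
    (fun x hx => (H.d2 x hx).continuousAt.continuousWithinAt) measurableSet_Ioi

lemma intf (H : FD α f f1 f2) : IntegrableOn f (Ioi 0) := H.b0.int H.hα H.mf

lemma adm (H : FD α f f1 f2) : Adm f := by
  have hα := H.hα
  obtain ⟨C0, p0, h0⟩ := H.b0.pow zero_le_one hα.le
  obtain ⟨C1, p1, h1⟩ := H.b1.pow zero_le_one (by linarith)
  obtain ⟨C2, p2, h2⟩ := H.b1.pow zero_le_two (by linarith)
  refine ⟨fun x hx => (H.d1 x hx).differentiableAt, C0 + C1 + C2, by positivity, fun x hx => ?_⟩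
  rw [H.df hx]
  have a0 := h0 x hx
  have a1 := h1 x hx
  have a2 := h2 x hx
  rw [Real.rpow_one] at a0 a1
  rw [Real.rpow_two] at a2
  refine ⟨?_, ?_, ?_, ?_⟩ <;> linarith [a0.1, a0.2, a1.2, a2.2]

lemma dh (H : FD α f f1 f2) {x : ℝ} (hx : 0 < x) :
    HasDerivAt (fun x : ℝ => (x : ℂ) * f1 x) (f1 x + x * f2 x) x := by
  have h1 : HasDerivAt (fun y : ℝ => (y : ℂ)) 1 x := by
    simpa using (hasDerivAt_id x).ofReal_comp
  have := h1.mul (H.d2 x hx)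
  rw [one_mul] at this
  exact this

lemma bh (H : FD α f f1 f2) : Dec α (fun x : ℝ => (x : ℂ) * f1 x) :=
  H.b1.mulx (by linarith [H.hα])

lemma bh' (H : FD α f f1 f2) : Dec (α + 1) (fun x : ℝ => f1 x + (x : ℂ) * f2 x) := by
  refine H.b1.add (Dec.mulx ?_ (by linarith [H.hα]))
  have := H.b2
  rwa [show α + 1 + 1 = α + 2 by ring]

lemma dech (H : FD α f f1 f2) : Dec (α + 1) (deriv (fun x : ℝ => (x : ℂ) * f1 x)) := by
  obtain ⟨C, hC, hb⟩ := H.bh'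
  refine ⟨C, hC, fun x hx => ?_⟩
  rw [(H.dh hx).deriv]
  exact hb x hx

lemma admh (H : FD α f f1 f2) : Adm (fun x : ℝ => (x : ℂ) * f1 x) := by
  have hα := H.hα
  obtain ⟨C0, p0, h0⟩ := H.bh.pow zero_le_one hα.le
  obtain ⟨C1, p1, h1⟩ := H.dech.pow zero_le_one (by linarith)
  obtain ⟨C2, p2, h2⟩ := H.dech.pow zero_le_two (by linarith)
  refine ⟨fun x hx => (H.dh hx).differentiableAt, C0 + C1 + C2, by positivity, fun x hx => ?_⟩
  have a0 := h0 x hx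
  have a1 := h1 x hx
  have a2 := h2 x hx
  rw [Real.rpow_one] at a0 a1
  rw [Real.rpow_two] at a2
  refine ⟨?_, ?_, ?_, ?_⟩ <;> linarith [a0.1, a0.2, a1.2, a2.2]

lemma mh (H : FD α f f1 f2) :
    AEStronglyMeasurable (fun x : ℝ => (x : ℂ) * f1 x) (volume.restrict (Ioi 0)) :=
  Complex.measurable_ofReal.aestronglyMeasurable.mul H.mf1

lemma inth (H : FD α f f1 f2) : IntegrableOn (fun x : ℝ => (x : ℂ) * f1 x) (Ioi 0) :=
  H.bh.int H.hα H.mh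

lemma tend_inf (H : FD α f f1 f2) :
    Tendsto (fun v : ℝ => (v : ℂ) * f v) atTop (nhds 0) ∧
    Tendsto (fun v : ℝ => ((v * Real.log v : ℝ) : ℂ) * f v) atTop (nhds 0) := by
  have hα := H.hα
  obtain ⟨C, hC, hb⟩ := H.b0.le_rpow
  set ε := (α - 1) / 2 with hε
  have hε0 : 0 < ε := by rw [hε]; linarith
  have h0 : Tendsto (fun x : ℝ => C * (1 + 1 / ε) * x ^ (-ε)) atTop (nhds 0) := by
    simpa using (tendsto_rpow_neg_atTop hε0).const_mul (C * (1 + 1 / ε))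
  have hk : ∀ v : ℝ, 1 < v → v * v ^ ε * (C * v ^ (-α)) = C * v ^ (-ε) := by
    intro v hv
    have hv0 : 0 < v := by linarith
    have : v * v ^ ε * v ^ (-α) = v ^ (-ε) := by
      nth_rewrite 1 [← Real.rpow_one v]
      rw [← Real.rpow_add hv0, ← Real.rpow_add hv0]
      congr 1; rw [hε]; ring
    linear_combination C * this
  constructor
  · rw [tendsto_zero_iff_norm_tendsto_zero]
    refine squeeze_zero' (Eventually.of_forall fun x => norm_nonneg _) ?_ h0
    filter_upwards [Ioi_mem_atTop 1] with v hv
    have hv1 : 1 < v := hv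
    have hv0 : 0 < v := by linarith
    rw [norm_mul, norm_real, Real.norm_of_nonneg hv0.le]
    have a2 : 1 ≤ v ^ ε := Real.one_le_rpow hv1.le hε0.le
    have hp : 0 ≤ C * v ^ (-ε) := by positivity
    have hq : 0 ≤ 1 / ε := by positivity
    calc v * ‖f v‖ ≤ (v * v ^ ε) * (C * v ^ (-α)) :=
          mul_le_mul (by nlinarith) (hb v hv0) (norm_nonneg _) (by positivity)
      _ = C * v ^ (-ε) := hk v hv1
      _ ≤ _ := by nlinarith
  · rw [tendsto_zero_iff_norm_tendsto_zero]
    refine squeeze_zero' (Eventually.of_forall fun x => norm_nonneg _) ?_ h0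
    filter_upwards [Ioi_mem_atTop 1] with v hv
    have hv1 : 1 < v := hv
    have hv0 : 0 < v := by linarith
    rw [norm_mul, norm_real, Real.norm_of_nonneg (mul_nonneg hv0.le (Real.log_nonneg hv1.le))]
    have a1 := Real.log_le_rpow_div hv0.le hε0
    have hp : 0 ≤ C * v ^ (-ε) := by positivity
    calc v * Real.log v * ‖f v‖ ≤ (v * (v ^ ε / ε)) * (C * v ^ (-α)) :=
          mul_le_mul (by gcongr) (hb v hv0) (norm_nonneg _) (by positivity)
      _ = 1 / ε * (v * v ^ ε * (C * v ^ (-α))) := by ring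
      _ = 1 / ε * (C * v ^ (-ε)) := by rw [hk v hv1]
      _ ≤ _ := by nlinarith

lemma tend_zero (H : FD α f f1 f2) {w : ℝ → ℝ} (hw : Continuous w) (hw0 : w 0 = 0) :
    Tendsto (fun v : ℝ => ((w v : ℝ) : ℂ) * f v) (nhdsWithin 0 (Ioi 0)) (nhds 0) := by
  obtain ⟨C, hC, hb⟩ := H.b0
  rw [tendsto_zero_iff_norm_tendsto_zero]
  have h0 : Tendsto (fun y : ℝ => |w y| * C) (nhdsWithin 0 (Ioi 0)) (nhds 0) := by
    have : Tendsto (fun y : ℝ => |w y| * C) (nhds 0) (nhds (|w 0| * C)) := by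
      apply Continuous.tendsto; fun_prop
    rw [hw0, abs_zero, zero_mul] at this
    exact this.mono_left nhdsWithin_le_nhds
  refine squeeze_zero' (Eventually.of_forall fun x => norm_nonneg _) ?_ h0
  filter_upwards [self_mem_nhdsWithin] with y hy
  rw [norm_mul, norm_real, Real.norm_eq_abs]
  exact mul_le_mul_of_nonneg_left (hb y hy).1 (abs_nonneg _)

lemma integral_h (H : FD α f f1 f2) :
    ∫ v in Ioi (0:ℝ), (v : ℂ) * f1 v = - ∫ v in Ioi (0:ℝ), f v := by
  have := integral_Ioi_mul_deriv_eq_deriv_mul (a := 0) (u := fun x : ℝ => (x : ℂ)) (v := f)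
    (u' := fun x : ℝ => 1) (v' := f1) (a' := 0) (b' := 0)
    (fun x hx => by simpa using (hasDerivAt_id x).ofReal_comp)
    (fun x hx => H.d1 x hx) H.inth
    (by have := H.intf; simpa [Pi.mul_def] using this)
    (H.tend_zero continuous_id rfl) H.tend_inf.1
  rw [this]; simp

lemma int_vlog (H : FD α f f1 f2) (c : ℝ) :
    IntegrableOn (fun v : ℝ => ((v * (Real.log v + c) : ℝ) : ℂ) * f1 v) (Ioi 0) := by
  refine (H.bh.int_log H.hα H.mh c).congr_fun (fun v _ => ?_) measurableSet_Ioi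
  push_cast; ring

lemma integral_vlog (H : FD α f f1 f2) :
    ∫ v in Ioi (0:ℝ), ((v * Real.log v : ℝ) : ℂ) * f1 v =
      - (∫ v in Ioi (0:ℝ), ((Real.log v : ℝ) : ℂ) * f v) - ∫ v in Ioi (0:ℝ), f v := by
  have hl0 : IntegrableOn (fun x => ((Real.log x : ℝ) : ℂ) * f x) (Ioi 0) := by
    simpa using H.b0.int_log H.hα H.mf 0
  have := integral_Ioi_mul_deriv_eq_deriv_mul (a := 0)
    (u := fun x : ℝ => ((x * Real.log x : ℝ) : ℂ)) (v := f)
    (u' := fun x : ℝ => ((Real.log x + 1 : ℝ) : ℂ)) (v' := f1) (a' := 0) (b' := 0)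
    (fun x hx => (Real.hasDerivAt_mul_log (ne_of_gt hx)).ofReal_comp)
    (fun x hx => H.d1 x hx) (by have := H.int_vlog 0; simp only [add_zero] at this; exact this)
    (H.b0.int_log H.hα H.mf 1)
    (H.tend_zero Real.continuous_mul_log (by simp)) H.tend_inf.2
  rw [this, sub_zero, zero_sub, ← neg_add', ← integral_add hl0 H.intf]
  congr 2; ext v; push_cast; ring

lemma Qf (H : FD α f f1 f2) {x : ℝ} (hx : 0 < x) :
    Qop f x = (∑' m : ℕ, f (x * (m + 1))) - (x : ℂ)⁻¹ * ∫ y in Ioi (0:ℝ), f y :=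
  H.adm.Qop_eq hx H.intf (H.b0.summable H.hα hx)

lemma Qh (H : FD α f f1 f2) {x : ℝ} (hx : 0 < x) :
    Qop (fun x : ℝ => (x : ℂ) * f1 x) x =
      (∑' m : ℕ, ((x * (m + 1) : ℝ) : ℂ) * f1 (x * (m + 1))) +
        (x : ℂ)⁻¹ * ∫ y in Ioi (0:ℝ), f y := by
  rw [H.admh.Qop_eq hx H.inth (H.bh.summable H.hα hx), H.integral_h]
  ring

lemma theta_deriv (H : FD α f f1 f2) {x : ℝ} (hx : 0 < x) :
    HasDerivAt (fun x : ℝ => ∑' m : ℕ, f (x * (m + 1)))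
      (∑' m : ℕ, ((m + 1 : ℝ) : ℂ) * f1 (x * (m + 1))) x := by
  obtain ⟨C, hC, hb⟩ := H.bh.le_rpow
  have hα := H.hα
  have hs1 : Summable (fun m : ℕ => (C * (x / 2) ^ (-α) / (x / 2)) * ((m + 1 : ℕ) : ℝ) ^ (-α)) :=
    ((summable_nat_add_iff 1).mpr (Real.summable_nat_rpow.mpr (by linarith : -α < -1))).mul_left _
  refine hasDerivAt_tsum_of_isPreconnected (t := Ioi (x / 2)) hs1 isOpen_Ioi isPreconnected_Ioi
    (g := fun (m : ℕ) y => f (y * (m + 1)))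
    (g' := fun (m : ℕ) y => ((m + 1 : ℝ) : ℂ) * f1 (y * (m + 1)))
    (y₀ := x) ?_ ?_ (by simpa using hx) (H.b0.summable hα hx) (by simpa using hx)
  · intro m y hy
    have hy0 : 0 < y := lt_trans (by positivity) hy
    have h1 : HasDerivAt (fun y : ℝ => y * ((m : ℝ) + 1)) ((m : ℝ) + 1) y := by
      simpa using (hasDerivAt_id y).mul_const ((m : ℝ) + 1)
    have := (H.d1 (y * (m + 1)) (by positivity)).scomp y h1
    rw [real_smul] at this
    exact this
  · intro m y hy
    have hy' : x / 2 < y := hy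
    have hx2 : 0 < x / 2 := by positivity
    have hy0 : 0 < y := lt_trans (by positivity) hy
    have hm0 : (0:ℝ) < (m:ℝ) + 1 := by positivity
    have := hb (y * (m + 1)) (by positivity)
    rw [norm_mul, norm_real, Real.norm_of_nonneg (by positivity)] at this
    rw [norm_mul, norm_real, Real.norm_of_nonneg (by positivity)]
    have e : ((m:ℝ) + 1) * ‖f1 (y * (m + 1))‖ ≤ C * (y * (m + 1)) ^ (-α) / y := by
      rw [le_div_iff₀ hy0]; linarith
    refine e.trans ?_
    rw [Real.mul_rpow hy0.le hm0.le]
    have e2 : y ^ (-α) ≤ (x / 2) ^ (-α) :=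
      Real.rpow_le_rpow_of_nonpos hx2 hy'.le (by linarith)
    push_cast
    calc C * (y ^ (-α) * ((m:ℝ) + 1) ^ (-α)) / y
        ≤ C * ((x / 2) ^ (-α) * ((m:ℝ) + 1) ^ (-α)) / (x / 2) := by gcongr
      _ = _ := by ring

lemma dQf (H : FD α f f1 f2) {x : ℝ} (hx : 0 < x) :
    HasDerivAt (Qop f) ((x : ℂ)⁻¹ * Qop (fun x : ℝ => (x : ℂ) * f1 x) x) x := by
  have hx0 : (x : ℂ) ≠ 0 := by exact_mod_cast hx.ne'
  have h1 : HasDerivAt (fun y : ℝ => (y : ℂ)) 1 x := by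
    simpa using (hasDerivAt_id x).ofReal_comp
  have h2 := (h1.inv hx0).mul_const (∫ y in Ioi (0:ℝ), f y)
  have h3 := (H.theta_deriv hx).sub h2
  have h4 : Qop f =ᶠ[nhds x] fun x : ℝ => (∑' m : ℕ, f (x * (m + 1))) -
      (x : ℂ)⁻¹ * ∫ y in Ioi (0:ℝ), f y := by
    filter_upwards [Ioi_mem_nhds hx] with y hy using H.Qf hy
  refine (h3.congr_of_eventuallyEq h4).congr_deriv ?_
  rw [H.Qh hx, mul_add, ← tsum_mul_left]
  have : ∀ m : ℕ, (x : ℂ)⁻¹ * (((x * (m + 1) : ℝ) : ℂ) * f1 (x * (m + 1))) =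
      ((m + 1 : ℝ) : ℂ) * f1 (x * (m + 1)) := by
    intro m; push_cast; field_simp
  simp only [this]
  generalize (∑' m : ℕ, ((m + 1 : ℝ) : ℂ) * f1 (x * (m + 1))) = Z
  generalize (∫ y in Ioi (0:ℝ), f y) = W
  field_simp
  ring

lemma admQ (H : FD α f f1 f2) : Adm (Qop f) := by
  have hα := H.hα
  have hi1 : IntegrableOn (deriv f) (Ioi 0) :=
    (H.b1.int (by linarith) H.mf1).congr_fun (fun x hx => (H.df hx).symm) measurableSet_Ioi
  have hi2 : IntegrableOn (fun v : ℝ => (v : ℂ) * deriv f v) (Ioi 0) :=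
    H.inth.congr_fun (fun x hx => by simp only [H.df hx]) measurableSet_Ioi
  have hmd := (measurable_deriv (fun x : ℝ => (x : ℂ) * f1 x))
  have hi3 := H.dech.int (by linarith) hmd.aestronglyMeasurable
  have hi4 := (H.dech.mulx (by linarith)).int hα
    (Complex.measurable_ofReal.mul hmd).aestronglyMeasurable
  obtain ⟨C, hC, hb⟩ := Qop_bound hi1 hi2
  obtain ⟨C', hC', hb'⟩ := Qop_bound hi3 hi4
  refine ⟨fun x hx => (H.dQf hx).differentiableAt, C + C', by positivity, fun x hx => ?_⟩
  rw [(H.dQf hx).deriv, norm_mul, norm_inv, norm_real, Real.norm_of_nonneg hx.le]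
  obtain ⟨a1, a2⟩ := hb x hx
  obtain ⟨a3, a4⟩ := hb' x hx
  refine ⟨by linarith, by linarith, ?_, ?_⟩
  · have : x⁻¹ * ‖Qop (fun x : ℝ => (x : ℂ) * f1 x) x‖ * x =
      ‖Qop (fun x : ℝ => (x : ℂ) * f1 x) x‖ := by field_simp
    rw [this]; linarith
  · have : x⁻¹ * ‖Qop (fun x : ℝ => (x : ℂ) * f1 x) x‖ * x ^ 2 =
      ‖Qop (fun x : ℝ => (x : ℂ) * f1 x) x‖ * x := by field_simp
    rw [this]; linarith

end FD

lemma fract_div_meas (v : ℝ) : Measurable (fun u : ℝ => Int.fract (v / u)) :=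
  measurable_fract.comp (measurable_const.div measurable_id)

lemma fract_div_ii (v a b : ℝ) :
    IntervalIntegrable (fun u : ℝ => Int.fract (v / u)) volume a b := by
  refine (intervalIntegrable_const (c := (1:ℝ))).mono_fun (fract_div_meas v).aestronglyMeasurable ?_
  refine Eventually.of_forall fun u => ?_
  simp only [Real.norm_eq_abs]
  rw [abs_of_nonneg (Int.fract_nonneg _), abs_one]
  exact (Int.fract_lt_one _).le

lemma fract_piece (n : ℕ) :
    ∫ u in (1 / ((n : ℝ) + 1))..(1 / (((n + 1 : ℕ) : ℝ) + 1)), Int.fract (1 / u) =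
      - ZetaAsymptotics.term (n + 1) 1 := by
  have hn : (0:ℝ) < n + 1 := by positivity
  have hn2 : (0:ℝ) < ((n + 1 : ℕ) : ℝ) + 1 := by positivity
  have hle : (1 / (((n + 1 : ℕ) : ℝ) + 1)) ≤ 1 / ((n : ℝ) + 1) := by
    apply one_div_le_one_div_of_le hn; push_cast; linarith
  rw [intervalIntegral.integral_symm, ZetaAsymptotics.term_one (Nat.succ_pos n), neg_inj]
  have h1 : ∫ u in (1 / (((n + 1 : ℕ) : ℝ) + 1))..(1 / ((n : ℝ) + 1)), Int.fract (1 / u) =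
      ∫ u in (1 / (((n + 1 : ℕ) : ℝ) + 1))..(1 / ((n : ℝ) + 1)), (1 / u - (n + 1)) := by
    rw [intervalIntegral.integral_of_le hle, intervalIntegral.integral_of_le hle,
      integral_Ioc_eq_integral_Ioo, integral_Ioc_eq_integral_Ioo]
    refine setIntegral_congr_fun measurableSet_Ioo fun u hu => ?_
    have hu0 : 0 < u := lt_trans (by positivity) hu.1
    have a1 : (n : ℝ) + 1 < 1 / u := (lt_one_div hn hu0).2 hu.2
    have a2 : 1 / u < ((n + 1 : ℕ) : ℝ) + 1 := (one_div_lt hu0 hn2).2 hu.1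
    have : ⌊1 / u⌋ = (n : ℤ) + 1 := by
      rw [Int.floor_eq_iff]; push_cast at a2 ⊢; exact ⟨a1.le, a2⟩
    simp only [Int.fract, this]; push_cast; ring
  have hnz : (0:ℝ) ∉ uIcc (1 / (((n + 1 : ℕ) : ℝ) + 1)) (1 / ((n : ℝ) + 1)) := by
    rw [uIcc_of_le hle]; intro h; have := h.1; have : 0 < (1 / (((n + 1 : ℕ) : ℝ) + 1)) := by positivity
    linarith [h.1]
  rw [h1, intervalIntegral.integral_sub, integral_one_div hnz, intervalIntegral.integral_const,
    Real.log_div (one_div_pos.2 hn).ne' (one_div_pos.2 hn2).ne', one_div, one_div, Real.log_inv,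
    Real.log_inv]
  · push_cast
    rw [smul_eq_mul]
    have : (n : ℝ) + 1 + 1 ≠ 0 := by positivity
    have h' := hn.ne'
    field_simp
    ring
  · refine intervalIntegral.intervalIntegrable_one_div (fun x hx => ?_) continuousOn_id
    rintro rfl; exact hnz hx
  · exact intervalIntegrable_const

lemma fract_int_one : ∫ u in (0:ℝ)..1, Int.fract (1 / u) = 1 - Real.eulerMascheroniConstant := by
  have h1 : ∀ N : ℕ, ∫ u in (1 / (((N : ℕ) : ℝ) + 1))..1, Int.fract (1 / u) =
      ∑ n ∈ Finset.range N, ZetaAsymptotics.term (n + 1) 1 := by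
    intro N
    have := intervalIntegral.sum_integral_adjacent_intervals (f := fun u : ℝ => Int.fract (1 / u))
      (μ := volume) (a := fun n : ℕ => 1 / ((n : ℝ) + 1)) (n := N)
      (fun k _ => fract_div_ii 1 _ _)
    simp only [fract_piece, Finset.sum_neg_distrib] at this
    rw [intervalIntegral.integral_symm] at this
    simp only [Nat.cast_zero, zero_add, div_one] at this
    linarith
  have h2 := ZetaAsymptotics.term_tsum_one.tendsto_sum_nat
  simp only [← h1] at h2
  have hc := intervalIntegral.continuous_primitive (f := fun u : ℝ => Int.fract (1 / u))
    (μ := volume) (fun a b => fract_div_ii 1 a b) 1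
  have h3 := (hc.tendsto 0).comp (tendsto_one_div_add_atTop_nhds_zero_nat (𝕜 := ℝ))
  have h4 := h3.neg
  rw [← intervalIntegral.integral_symm] at h4
  refine tendsto_nhds_unique h4 (h2.congr fun N => ?_)
  rw [Function.comp, ← intervalIntegral.integral_symm]

/-- The inner integral in the Fubini argument. -/
def Phi (v T : ℝ) : ℝ := ∫ u in (0:ℝ)..T, Int.fract (v / u)

lemma Phi_nonneg (v : ℝ) {T : ℝ} (hT : 0 ≤ T) : 0 ≤ Phi v T :=
  intervalIntegral.integral_nonneg hT fun u _ => Int.fract_nonneg _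

lemma Phi_le (v : ℝ) {T : ℝ} (hT : 0 ≤ T) : Phi v T ≤ T := by
  have := intervalIntegral.integral_mono_on hT (fract_div_ii v 0 T)
    (intervalIntegrable_const (c := (1:ℝ))) (fun u _ => (Int.fract_lt_one (v / u)).le)
  simpa [Phi] using this

lemma Phi_eq {v T : ℝ} (hv : 0 < v) (hT : v ≤ T) :
    Phi v T = v * (1 - Real.eulerMascheroniConstant + Real.log T - Real.log v) := by
  have hT0 : 0 < T := hv.trans_le hT
  rw [Phi, ← intervalIntegral.integral_add_adjacent_intervals (fract_div_ii v 0 v)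
    (fract_div_ii v v T)]
  have h1 : ∫ u in (0:ℝ)..v, Int.fract (v / u) = v * (1 - Real.eulerMascheroniConstant) := by
    have := intervalIntegral.mul_integral_comp_mul_left (f := fun u => Int.fract (v / u))
      (a := 0) (b := 1) v
    rw [mul_zero, mul_one] at this
    rw [← this, ← fract_int_one]
    congr 2; ext w; rw [← div_div, div_self hv.ne']
  have h2 : ∫ u in v..T, Int.fract (v / u) = v * (Real.log T - Real.log v) := by
    have : ∫ u in v..T, Int.fract (v / u) = ∫ u in v..T, v * (1 / u) := by
      rw [intervalIntegral.integral_of_le hT, intervalIntegral.integral_of_le hT]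
      refine setIntegral_congr_fun measurableSet_Ioc fun u hu => ?_
      have hu0 : 0 < u := hv.trans hu.1
      rw [Int.fract_eq_self.2 ⟨by positivity, (div_lt_one hu0).2 hu.1⟩]; ring
    rw [this, intervalIntegral.integral_const_mul, integral_one_div_of_pos hv hT0,
      Real.log_div hT0.ne' hv.ne']
  rw [h1, h2]; ring

namespace FD
variable {α : ℝ} {f f1 f2 : ℝ → ℂ}

lemma Q_fubini (H : FD α f f1 f2) {T : ℝ} (hT : 0 < T) :
    ∫ u in (0:ℝ)..T, Qop f u = ∫ v in Ioi (0:ℝ), ((Phi v T : ℝ) : ℂ) * f1 v := by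
  have hα := H.hα
  have hi1 : IntegrableOn f1 (Ioi 0) := H.b1.int (by linarith) H.mf1
  rw [intervalIntegral.integral_of_le hT.le]
  have h1 : ∫ u in Ioc 0 T, Qop f u =
      ∫ u in Ioc 0 T, ∫ v in Ioi (0:ℝ), ((Int.fract (v / u) : ℝ) : ℂ) * f1 v := by
    refine setIntegral_congr_fun measurableSet_Ioc fun u hu => ?_
    rw [Qop_eq_v f hu.1]
    refine setIntegral_congr_fun measurableSet_Ioi fun v hv => ?_
    simp only [H.df hv]
  rw [h1]
  have : IsFiniteMeasure (volume.restrict (Ioc (0:ℝ) T)) := ⟨by simp⟩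
  rw [integral_integral_swap]
  · refine setIntegral_congr_fun measurableSet_Ioi fun v hv => ?_
    rw [integral_mul_const, integral_complex_ofReal, Phi, intervalIntegral.integral_of_le hT.le]
  · have hp : Integrable (fun p : ℝ × ℝ => (1:ℂ) * f1 p.2)
        ((volume.restrict (Ioc (0:ℝ) T)).prod (volume.restrict (Ioi (0:ℝ)))) :=
      Integrable.mul_prod (integrable_const (1:ℂ)) hi1
    have hm : Measurable (fun p : ℝ × ℝ => ((Int.fract (p.2 / p.1) : ℝ) : ℂ)) :=
      fract_meas.comp (measurable_snd.div measurable_fst)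
    have := hp.bdd_mul (c := 1) hm.aestronglyMeasurable
      (Eventually.of_forall fun p => fract_norm_le _)
    simpa [Function.uncurry_def] using this

lemma Q_tendsto (H : FD α f f1 f2) :
    Tendsto (fun T : ℝ => (∫ u in (0:ℝ)..T, Qop f u) +
        ((Real.log T : ℝ) : ℂ) * ∫ v in Ioi (0:ℝ), f v) atTop
      (nhds ((∫ v in Ioi (0:ℝ), ((Real.log v : ℝ) : ℂ) * f v) +
        (Real.eulerMascheroniConstant : ℂ) * ∫ v in Ioi (0:ℝ), f v)) := by
  set c : ℝ := 1 - Real.eulerMascheroniConstant with hc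
  have hv0 := H.int_vlog 0
  simp only [add_zero] at hv0
  have hi1 : IntegrableOn f1 (Ioi 0) := H.b1.int (by linarith [H.hα]) H.mf1
  have hlim : (∫ v in Ioi (0:ℝ), ((v * (c - Real.log v) : ℝ) : ℂ) * f1 v) =
      (∫ v in Ioi (0:ℝ), ((Real.log v : ℝ) : ℂ) * f v) +
        (Real.eulerMascheroniConstant : ℂ) * ∫ v in Ioi (0:ℝ), f v := by
    have : ∀ v : ℝ, ((v * (c - Real.log v) : ℝ) : ℂ) * f1 v =
        (c : ℂ) * ((v : ℂ) * f1 v) - ((v * Real.log v : ℝ) : ℂ) * f1 v := by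
      intro v; push_cast; ring
    simp only [this]
    rw [integral_sub (H.inth.const_mul _) hv0, integral_const_mul, H.integral_h, H.integral_vlog,
      hc]
    push_cast; ring
  have hpm : ∀ T : ℝ, AEStronglyMeasurable (fun v : ℝ => ((Phi v T : ℝ) : ℂ))
      (volume.restrict (Ioi 0)) := by
    intro T
    have hm : ∀ a b : ℝ, Measurable fun v : ℝ => ∫ u in Ioc a b, Int.fract (v / u) := by
      intro a b
      have h0 : Measurable (Function.uncurry fun v u : ℝ => Int.fract (v / u)) :=
        measurable_fract.comp (measurable_fst.div measurable_snd)
      exact (h0.stronglyMeasurable.integral_prod_right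
        (ν := volume.restrict (Ioc a b))).measurable
    exact (Complex.measurable_ofReal.comp ((hm 0 T).sub (hm T 0))).aestronglyMeasurable
  rw [← hlim]
  have hT : ∀ᶠ T : ℝ in atTop, (∫ v in Ioi (0:ℝ), ((Phi v T - v * Real.log T : ℝ) : ℂ) * f1 v) =
      (∫ u in (0:ℝ)..T, Qop f u) + ((Real.log T : ℝ) : ℂ) * ∫ v in Ioi (0:ℝ), f v := by
    filter_upwards [eventually_gt_atTop 0] with T hT
    have : ∀ v : ℝ, ((Phi v T - v * Real.log T : ℝ) : ℂ) * f1 v =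
        ((Phi v T : ℝ) : ℂ) * f1 v - ((Real.log T : ℝ) : ℂ) * ((v : ℂ) * f1 v) := by
      intro v; push_cast; ring
    simp only [this]
    rw [integral_sub _ (H.inth.const_mul _), integral_const_mul, H.integral_h, H.Q_fubini hT]
    · ring
    · refine hi1.bdd_mul (c := T) (hpm T) (Eventually.of_forall fun v => ?_)
      rw [norm_real, Real.norm_of_nonneg (Phi_nonneg v hT.le)]
      exact Phi_le v hT.le
  refine Tendsto.congr' hT ?_
  refine tendsto_integral_filter_of_dominated_convergence
    (fun v => (1 + |c|) * ‖(v : ℂ) * f1 v‖ + ‖((v * Real.log v : ℝ) : ℂ) * f1 v‖) ?_ ?_ ?_ ?_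
  · refine Eventually.of_forall fun T => ?_
    have : ∀ v : ℝ, ((Phi v T - v * Real.log T : ℝ) : ℂ) * f1 v =
        ((Phi v T : ℝ) : ℂ) * f1 v - ((Real.log T : ℝ) : ℂ) * ((v : ℂ) * f1 v) := by
      intro v; push_cast; ring
    simp only [this]
    exact ((hpm T).mul H.mf1).sub (H.inth.const_mul _).aestronglyMeasurable
  · filter_upwards [eventually_ge_atTop 1] with T hT
    refine (ae_restrict_iff' measurableSet_Ioi).2 (Eventually.of_forall fun v hv => ?_)
    have hv' : 0 < v := hv
    simp only [norm_mul, norm_real]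
    rw [← mul_assoc, ← add_mul]
    refine mul_le_mul_of_nonneg_right ?_ (norm_nonneg _)
    simp only [Real.norm_eq_abs]
    rw [abs_of_pos hv']
    have hlT := Real.log_nonneg hT
    have hc0 := abs_nonneg c
    rcases le_or_gt v T with h | h
    · rw [Phi_eq hv' h, ← hc]
      have : v * (c + Real.log T - Real.log v) - v * Real.log T = v * (c - Real.log v) := by ring
      rw [this, abs_mul, abs_of_pos hv']
      have := abs_sub c (Real.log v)
      nlinarith
    · have h1 := Phi_nonneg v (zero_le_one.trans hT)
      have h2 := Phi_le v (zero_le_one.trans hT)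
      have h3 : Real.log T ≤ Real.log v := Real.log_le_log (by linarith) h.le
      have h4 := le_abs_self (Real.log v)
      have h5 : v * Real.log T ≤ v * |Real.log v| := by gcongr; linarith
      have h6 : 0 ≤ v * Real.log T := by positivity
      have h7 : 0 ≤ |c| * v := by positivity
      rw [abs_le]; constructor <;> nlinarith
  · exact (H.inth.norm.const_mul _).add hv0.norm
  · refine (ae_restrict_iff' measurableSet_Ioi).2 (Eventually.of_forall fun v hv => ?_)
    refine tendsto_const_nhds.congr' ?_
    filter_upwards [eventually_ge_atTop v] with T hT
    rw [Phi_eq hv hT, ← hc]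
    congr 2; ring

end FD

namespace FD
variable {α : ℝ} {f f1 f2 : ℝ → ℂ}

lemma voronoi_integral (H : FD α f f1 f2) {x : ℝ} (hx : 0 < x) :
    ∫ y in Ioi (0:ℝ), f (x * y) * ((Real.log y + 2 * Real.eulerMascheroniConstant : ℝ) : ℂ) =
      (x : ℂ)⁻¹ * ((∫ v in Ioi (0:ℝ), ((Real.log v : ℝ) : ℂ) * f v)
        - (Real.log x : ℂ) * (∫ v in Ioi (0:ℝ), f v)
        + 2 * (Real.eulerMascheroniConstant : ℂ) * ∫ v in Ioi (0:ℝ), f v) := by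
  have hl0 : IntegrableOn (fun x => ((Real.log x : ℝ) : ℂ) * f x) (Ioi 0) := by
    simpa using H.b0.int_log H.hα H.mf 0
  have h := integral_comp_mul_left_Ioi (fun v => f v *
    ((Real.log v - Real.log x + 2 * Real.eulerMascheroniConstant : ℝ) : ℂ)) 0 hx
  rw [mul_zero, real_smul, ofReal_inv] at h
  have h1 : ∫ y in Ioi (0:ℝ), f (x * y) *
      ((Real.log y + 2 * Real.eulerMascheroniConstant : ℝ) : ℂ) =
      ∫ y in Ioi (0:ℝ), f (x * y) *
      ((Real.log (x * y) - Real.log x + 2 * Real.eulerMascheroniConstant : ℝ) : ℂ) := by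
    refine setIntegral_congr_fun measurableSet_Ioi fun y hy => ?_
    have hy' : 0 < y := hy
    simp only [Real.log_mul hx.ne' hy'.ne', add_sub_cancel_left]
  rw [h1, h]
  congr 1
  have h2 : ∀ v : ℝ, f v *
      ((Real.log v - Real.log x + 2 * Real.eulerMascheroniConstant : ℝ) : ℂ) =
      ((Real.log v : ℝ) : ℂ) * f v +
        (-(Real.log x : ℂ) + 2 * (Real.eulerMascheroniConstant : ℂ)) * f v := by
    intro v; push_cast; ring
  simp only [h2]
  rw [integral_add hl0 (H.intf.const_mul _), integral_const_mul]
  ring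

lemma QQ (H : FD α f f1 f2) {x : ℝ} (hx : 0 < x) :
    Qop (Qop f) x = (∑' n : ℕ, ((n + 1 : ℕ).divisors.card : ℂ) * f ((n + 1 : ℝ) * x)) -
      ∫ y in Ioi (0:ℝ), f (x * y) *
        ((Real.log y + 2 * Real.eulerMascheroniConstant : ℝ) : ℂ) := by
  have hx0 : (x : ℂ) ≠ 0 := by exact_mod_cast hx.ne'
  rw [H.voronoi_integral hx]
  set I := ∫ v in Ioi (0:ℝ), f v with hI
  set A := ∫ v in Ioi (0:ℝ), ((Real.log v : ℝ) : ℂ) * f v with hA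
  have hE := H.admQ.euler_scale hx
  have hsp := H.b0.summable_prod H.hα hx
  have hS : Tendsto (fun N : ℕ => ∑ m ∈ Finset.range N, ∑' n : ℕ, f (x * (m + 1) * (n + 1))) atTop
      (nhds (∑' n : ℕ, ((n + 1 : ℕ).divisors.card : ℂ) * f ((n + 1 : ℝ) * x))) := by
    have h1 := hsp.prod.hasSum.tendsto_sum_nat
    have h2 := divisor_sum (F := fun k : ℕ => f ((k : ℝ) * x)) (by
      refine hsp.congr fun p => ?_
      push_cast; congr 1; ring)
    have h3 : (∑' m : ℕ, ∑' n : ℕ, f (x * (m + 1) * (n + 1))) =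
        ∑' n : ℕ, ((n + 1 : ℕ).divisors.card : ℂ) * f ((n + 1 : ℝ) * x) := by
      push_cast at h2
      rw [← h2]
      congr 1; ext m; congr 1; ext n; congr 1; ring
    rw [← h3]; exact h1
  have hH : Tendsto (fun N : ℕ => (((harmonic N : ℝ) - Real.log N : ℝ) : ℂ)) atTop
      (nhds (Real.eulerMascheroniConstant : ℂ)) :=
    (Complex.continuous_ofReal.tendsto _).comp Real.tendsto_harmonic_sub_log
  have hT := H.Q_tendsto.comp
    ((tendsto_natCast_atTop_atTop (R := ℝ)).const_mul_atTop hx)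
  have hR := hS.sub ((((hH.mul_const I).add hT).sub_const ((Real.log x : ℂ) * I)).const_mul
    (x : ℂ)⁻¹)
  have hR' := tendsto_nhds_unique (hE.congr' ?_) hR
  · rw [hR']; ring
  filter_upwards [eventually_gt_atTop 0] with N hN
  have hN' : (0:ℝ) < N := by exact_mod_cast hN
  have e1 : ∫ y in (0:ℝ)..N, Qop f (x * y) = (x : ℂ)⁻¹ * ∫ u in (0:ℝ)..(x * N), Qop f u := by
    rw [intervalIntegral.integral_comp_mul_left _ hx.ne', mul_zero, real_smul, ofReal_inv]
  have e2 : ∑ m ∈ Finset.range N, Qop f (x * (m + 1)) =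
      (∑ m ∈ Finset.range N, ∑' n : ℕ, f (x * (m + 1) * (n + 1))) -
        (x : ℂ)⁻¹ * (((harmonic N : ℝ) : ℝ) : ℂ) * I := by
    have : ∀ m : ℕ, Qop f (x * (m + 1)) = (∑' n : ℕ, f (x * (m + 1) * (n + 1))) -
        (x : ℂ)⁻¹ * (((m : ℂ) + 1)⁻¹ * I) := by
      intro m
      rw [H.Qf (by positivity : 0 < x * ((m : ℝ) + 1))]
      push_cast; rw [mul_inv]; ring
    simp only [this]
    rw [Finset.sum_sub_distrib, ← Finset.mul_sum, ← Finset.sum_mul, harmonic]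
    push_cast; ring
  rw [e1, e2]
  simp only [Function.comp]
  rw [Real.log_mul hx.ne' hN'.ne']
  push_cast; ring

end FD

lemma MuntzFD {α : ℝ} (hα : 1 < α) {f : ℝ → ℂ} (h1 : ContDiffOn ℝ 2 f (Ici 0))
    (h2 : ∀ j : ℕ, j ≤ 2 →
    (iteratedDerivWithin j f (Ici 0)) =O[atTop] fun x : ℝ => x ^ (-(α + (j : ℝ)))) :
    FD α f (iteratedDerivWithin 1 f (Ici 0)) (iteratedDerivWithin 2 f (Ici 0)) := by
  have hu := uniqueDiffOn_Ici (0:ℝ)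
  have hd : ∀ j : ℕ, j < 2 → ∀ x : ℝ, 0 < x →
      HasDerivAt (iteratedDerivWithin j f (Ici 0)) (iteratedDerivWithin (j + 1) f (Ici 0) x) x := by
    intro j hj x hx
    have := (h1.differentiableOn_iteratedDerivWithin (m := j) (by exact_mod_cast hj) hu) x hx.le
    have h := this.hasDerivWithinAt
    rw [iteratedDerivWithin_succ]
    exact h.hasDerivAt (Ici_mem_nhds hx)
  have hb : ∀ j : ℕ, j ≤ 2 → Dec (α + j) (iteratedDerivWithin j f (Ici 0)) := by
    intro j hj
    exact Dec.of_bigO (h1.continuousOn_iteratedDerivWithin (by exact_mod_cast hj) hu) (h2 j hj)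
      (by positivity)
  refine ⟨hα, ?_, hd 1 (by norm_num), ?_, ?_, ?_⟩
  · have := hd 0 (by norm_num)
    simpa [iteratedDerivWithin_zero] using this
  · have := hb 0 (by norm_num)
    simpa [iteratedDerivWithin_zero] using this
  · simpa using hb 1 (by norm_num)
  · simpa using hb 2 (by norm_num)

/-- the Müntz type formula for the Voronoi operator. -/
theorem muntz_formula_voronoi (α : ℝ) (hα : 1 < α) (f : ℝ → ℂ) (hf : MuntzClass α f) :
    ∀ s : ℂ, 0 < s.re → s.re < 1 →
      riemannZeta s ^ 2 * mellinT f s =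
        ∫ x in Ioi (0:ℝ), (x : ℂ) ^ (s - 1) *
          ((∑' n : ℕ, ((n + 1 : ℕ).divisors.card : ℂ) * f ((n + 1 : ℝ) * x)) -
            ∫ y in Ioi (0:ℝ), f (x * y) *
              ((Real.log y + 2 * Real.eulerMascheroniConstant : ℝ) : ℂ)) := by
  intro s hs hs1
  have H := MuntzFD hα hf.1 hf.2
  have h : ∫ x in Ioi (0:ℝ), (x : ℂ) ^ (s - 1) *
          ((∑' n : ℕ, ((n + 1 : ℕ).divisors.card : ℂ) * f ((n + 1 : ℝ) * x)) -
            ∫ y in Ioi (0:ℝ), f (x * y) *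
              ((Real.log y + 2 * Real.eulerMascheroniConstant : ℝ) : ℂ)) =
      ∫ x in Ioi (0:ℝ), (x : ℂ) ^ (s - 1) * Qop (Qop f) x := by
    refine setIntegral_congr_fun measurableSet_Ioi fun x hx => ?_
    simp only [H.QQ hx]
  rw [mellinT, h, H.admQ.muntz hs hs1, H.adm.muntz hs hs1]
  ring
end
end

section
/- Let α > 2 and suppose both f(x) and the function x ↦ x^{−1}(F_c f)(x^{−1}) belong to the Müntz class M_α. Then for all x > 0 the Voronoi summation formula holds: Σ_{n=1}^∞ d(n) f(nx) − ∫₀^∞ f(xy)(log y + 2γ) dy = f(0)/4 + (1/x) Σ_{n=1}^∞ d(n) G(n/x), where G(w) = ∫₀^∞ [4 K₀(4π√(wy)) − 2π Y₀(4π√(wy))] f(y) dy. -/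
open MeasureTheory Filter Asymptotics Set Complex

noncomputable section

/-- The kernel transform `G` of the Voronoi summation formula, written (via the identity
`K₀(2√(ab)) - (π/2) Y₀(2√(ab)) = ∫₀^∞ cos(at) cos(b/t) dt/t`) as an iterated cosine integral:
`G(w) = 4 ∫₀^∞ (1/t) cos(2πwt) (∫₀^∞ cos(2πy/t) f(y) dy) dt`. -/
def voronoiG (f : ℝ → ℂ) (w : ℝ) : ℂ :=
  4 * ∫ t in Ioi (0:ℝ), (t : ℂ)⁻¹ * (Real.cos (2 * Real.pi * w * t) : ℂ) *
      ∫ y in Ioi (0:ℝ), (Real.cos (2 * Real.pi * y / t) : ℂ) * f y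


lemma vs_bound (q : ℝ → ℂ) (hc : ContinuousOn q (Ici 0)) (b : ℝ) (hb : 2 ≤ b)
    (hO : q =O[atTop] fun x : ℝ => x ^ (-b)) :
    ∃ C, 0 ≤ C ∧ ∀ t, 0 ≤ t → ‖q t‖ ≤ C * (1 + t ^ 2)⁻¹ := by
  obtain ⟨c, hcpos, hc1⟩ := hO.exists_pos
  rw [IsBigOWith] at hc1
  obtain ⟨T, hT⟩ := Filter.eventually_atTop.1 hc1
  set R := max T 1
  obtain ⟨B, hB⟩ := (isCompact_Icc (a := (0:ℝ)) (b := R)).exists_bound_of_continuousOn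
    (hc.mono Icc_subset_Ici_self)
  have hB0 : 0 ≤ B := (norm_nonneg _).trans (hB 0 ⟨le_rfl, by positivity⟩)
  refine ⟨B * (1 + R ^ 2) + 2 * c, by positivity, fun t ht => ?_⟩
  rw [← div_eq_mul_inv, le_div_iff₀ (by positivity)]
  by_cases h : t ≤ R
  · have h1 := hB t ⟨ht, h⟩
    have : ‖q t‖ * (1 + t ^ 2) ≤ B * (1 + R ^ 2) := by gcongr
    linarith
  · push Not at h
    have ht1 : 1 ≤ t := (le_max_right T 1).trans h.le
    have h1 := hT t ((le_max_left T 1).trans h.le)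
    have h2 : t ^ (-b) ≤ t ^ (-2 : ℝ) := Real.rpow_le_rpow_of_exponent_le ht1 (by linarith)
    have h3 : t ^ (-2 : ℝ) = (t ^ 2)⁻¹ := by
      rw [Real.rpow_neg ht]; norm_cast
    rw [Real.norm_of_nonneg (by positivity)] at h1
    have h4 : ‖q t‖ ≤ c * (t ^ 2)⁻¹ := h1.trans (by rw [← h3]; gcongr)
    have h5 : ‖q t‖ * (1 + t ^ 2) ≤ c * (t ^ 2)⁻¹ * (2 * t ^ 2) := by
      gcongr; nlinarith
    have h6 : c * (t ^ 2)⁻¹ * (2 * t ^ 2) = 2 * c := by field_simp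
    have : 0 ≤ B * (1 + R ^ 2) := by positivity
    linarith

/-- Data extracted from membership in the Müntz class. -/
structure VsNice (p p' p'' : ℝ → ℂ) (C : ℝ) : Prop where
  C0 : 0 ≤ C
  c2 : ContinuousOn p'' (Ici 0)
  d1 : ∀ t, 0 ≤ t → HasDerivWithinAt p (p' t) (Ici 0) t
  d2 : ∀ t, 0 ≤ t → HasDerivWithinAt p' (p'' t) (Ici 0) t
  b0 : ∀ t, 0 ≤ t → ‖p t‖ ≤ C * (1 + t ^ 2)⁻¹
  b1 : ∀ t, 0 ≤ t → ‖p' t‖ ≤ C * (1 + t ^ 2)⁻¹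
  b2 : ∀ t, 0 ≤ t → ‖p'' t‖ ≤ C * (1 + t ^ 2)⁻¹

lemma VsNice.c0 {p p' p'' : ℝ → ℂ} {C : ℝ} (h : VsNice p p' p'' C) : ContinuousOn p (Ici 0) :=
  fun t ht => (h.d1 t ht).continuousWithinAt

lemma VsNice.c1 {p p' p'' : ℝ → ℂ} {C : ℝ} (h : VsNice p p' p'' C) : ContinuousOn p' (Ici 0) :=
  fun t ht => (h.d2 t ht).continuousWithinAt

lemma vs_nice (α : ℝ) (hα : 2 < α) (p : ℝ → ℂ) (hp : MuntzClass α p) :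
    ∃ p' p'' C, VsNice p p' p'' C := by
  obtain ⟨hd, hO⟩ := hp
  have hu : UniqueDiffOn ℝ (Ici (0:ℝ)) := uniqueDiffOn_Ici 0
  obtain ⟨C0, hC0, h0⟩ := vs_bound _ (hd.continuousOn_iteratedDerivWithin (m := 0) (by norm_num) hu)
    _ (by norm_num; linarith) (hO 0 (by norm_num))
  obtain ⟨C1, hC1, h1⟩ := vs_bound _ (hd.continuousOn_iteratedDerivWithin (m := 1) (by norm_num) hu)
    _ (by norm_num; linarith) (hO 1 (by norm_num))
  obtain ⟨C2, hC2, h2⟩ := vs_bound _ (hd.continuousOn_iteratedDerivWithin (m := 2) (by norm_num) hu)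
    _ (by norm_num; linarith) (hO 2 (by norm_num))
  refine ⟨iteratedDerivWithin 1 p (Ici 0), iteratedDerivWithin 2 p (Ici 0), C0 + C1 + C2,
    by positivity, hd.continuousOn_iteratedDerivWithin (m := 2) (by norm_num) hu, ?_, ?_, ?_, ?_, ?_⟩
  · intro t ht
    have := (hd.differentiableOn_iteratedDerivWithin (m := 0) (by norm_num) hu t ht).hasDerivWithinAt
    rw [← iteratedDerivWithin_succ] at this
    simpa using this
  · intro t ht
    have := (hd.differentiableOn_iteratedDerivWithin (m := 1) (by norm_num) hu t ht).hasDerivWithinAt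
    rwa [← iteratedDerivWithin_succ] at this
  · intro t ht
    have := h0 t ht
    rw [iteratedDerivWithin_zero] at this
    refine this.trans ?_
    gcongr; linarith
  · intro t ht
    refine (h1 t ht).trans ?_
    gcongr; linarith
  · intro t ht
    refine (h2 t ht).trans ?_
    gcongr; linarith

/-- scaling -/
lemma VsNice.scale {p p' p'' : ℝ → ℂ} {C : ℝ} (h : VsNice p p' p'' C) (c : ℂ) (r : ℝ)
    (hr : 0 < r) :
    ∃ q' q'' D, VsNice (fun t => c * p (r * t)) q' q'' D := by
  have key : ∀ (u u' : ℝ → ℂ), (∀ t, 0 ≤ t → HasDerivWithinAt u (u' t) (Ici 0) t) → ∀ e : ℂ,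
      ∀ t, 0 ≤ t → HasDerivWithinAt (fun t => e * u (r * t)) (e * r * u' (r * t)) (Ici 0) t := by
    intro u u' hu e t ht
    have h1 : HasDerivWithinAt (fun t : ℝ => r * t) (r * 1) (Ici 0) t :=
      ((hasDerivAt_id t).const_mul r).hasDerivWithinAt
    have h2 := HasDerivWithinAt.scomp t (hu (r * t) (by positivity)) h1
      (fun s (hs : 0 ≤ s) => by simp only [mem_Ici]; positivity)
    have h3 := h2.const_mul e
    refine h3.congr_deriv ?_
    simp; ring
  have bd : ∀ (u : ℝ → ℂ), (∀ t, 0 ≤ t → ‖u t‖ ≤ C * (1 + t ^ 2)⁻¹) → ∀ e : ℂ,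
      ∀ t, 0 ≤ t → ‖e * u (r * t)‖ ≤ (‖e‖ * (C * (1 + (r ^ 2)⁻¹))) * (1 + t ^ 2)⁻¹ := by
    intro u hu e t ht
    rw [norm_mul, mul_assoc]
    gcongr
    refine (hu _ (by positivity)).trans ?_
    rw [mul_assoc]
    have := h.C0
    gcongr
    rw [← div_eq_mul_inv, le_div_iff₀ (by positivity), inv_mul_le_iff₀ (by positivity)]
    have : (1 + (r * t) ^ 2) * (1 + (r ^ 2)⁻¹) = 1 + t ^ 2 + (r * t) ^ 2 + (r ^ 2)⁻¹ := by
      field_simp; ring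
    rw [this]
    have : 0 ≤ (r * t) ^ 2 + (r ^ 2)⁻¹ := by positivity
    linarith
  set B := C * (1 + (r ^ 2)⁻¹)
  have hB : 0 ≤ B := by have := h.C0; positivity
  have d1 := key p p' h.d1 c
  have d2 := key p' p'' h.d2 (c * r)
  refine ⟨_, _, ‖c‖ * B + ‖c * r‖ * B + ‖c * r * r‖ * B, by positivity, ?_, d1, d2, ?_, ?_, ?_⟩
  · refine ContinuousOn.mul continuousOn_const (h.c2.comp (by fun_prop) ?_)
    intro s (hs : 0 ≤ s); simp only [mem_Ici]; positivity
  · intro t ht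
    refine (bd p h.b0 c t ht).trans ?_
    gcongr
    have : 0 ≤ ‖c * r‖ * B := by positivity
    have : 0 ≤ ‖c * r * r‖ * B := by positivity
    linarith
  · intro t ht
    refine (bd p' h.b1 _ t ht).trans ?_
    gcongr
    have : 0 ≤ ‖c‖ * B := by positivity
    have : 0 ≤ ‖c * r * r‖ * B := by positivity
    linarith
  · intro t ht
    refine (bd p'' h.b2 _ t ht).trans ?_
    gcongr
    have : 0 ≤ ‖c‖ * B := by positivity
    have : 0 ≤ ‖c * r‖ * B := by positivity
    linarith

/-- cosine transform -/
def vsC (p : ℝ → ℂ) (u : ℝ) : ℂ := ∫ y in Ioi (0:ℝ), (Real.cos (2 * Real.pi * u * y) : ℂ) * p y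

/-- the reflected cosine transform -/
def vsH (f : ℝ → ℂ) (t : ℝ) : ℂ :=
  (t : ℂ)⁻¹ * ∫ y in Ioi (0:ℝ), (Real.cos (2 * Real.pi * y / t) : ℂ) * f y

lemma vsH_eq (f : ℝ → ℂ) (t : ℝ) : vsH f t = (t : ℂ)⁻¹ * vsC f t⁻¹ := by
  unfold vsH vsC
  congr 2; ext y; congr 3
  ring

lemma vsH_zero (f : ℝ → ℂ) : vsH f 0 = 0 := by simp [vsH]

lemma vsH_scale (f : ℝ → ℂ) : ∃ c : ℂ, vsH f = fun t : ℝ =>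
    c * ((fun x : ℝ => (x : ℂ)⁻¹ * fourierCos f x⁻¹) ((2 * Real.pi)⁻¹ * t)) := by
  have hpi := Real.pi_pos
  have hs : (Real.sqrt (2 / Real.pi) : ℂ) ≠ 0 := by
    have : 0 < Real.sqrt (2 / Real.pi) := by positivity
    exact_mod_cast this.ne'
  have hpic : (Real.pi : ℂ) ≠ 0 := by exact_mod_cast hpi.ne'
  refine ⟨(2 * Real.pi)⁻¹ * (Real.sqrt (2 / Real.pi) : ℂ)⁻¹, ?_⟩
  ext t
  have : (∫ y in Ioi (0:ℝ), f y * (Real.cos (((2 * Real.pi)⁻¹ * t)⁻¹ * y) : ℂ)) =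
      ∫ y in Ioi (0:ℝ), (Real.cos (2 * Real.pi * y / t) : ℂ) * f y := by
    congr 1; ext y
    rw [mul_comm]; congr 3
    rw [mul_inv, inv_inv]; ring
  simp only [vsH, fourierCos]
  rw [this]
  push_cast
  rw [mul_inv]
  field_simp

lemma VsNice.intOn {p : ℝ → ℂ} {C : ℝ} (hc : ContinuousOn p (Ici 0))
    (hb : ∀ t, 0 ≤ t → ‖p t‖ ≤ C * (1 + t ^ 2)⁻¹) : IntegrableOn p (Ioi 0) := by
  refine Integrable.mono' (g := fun t => C * (1 + t ^ 2)⁻¹)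
    ((integrable_inv_one_add_sq.const_mul C).integrableOn)
    ((hc.mono Ioi_subset_Ici_self).aestronglyMeasurable measurableSet_Ioi) ?_
  exact (ae_restrict_iff' measurableSet_Ioi).2 (ae_of_all _ fun t ht => hb t (le_of_lt ht))

lemma VsNice.cosInt {p : ℝ → ℂ} (hi : IntegrableOn p (Ioi 0)) (a : ℝ) :
    IntegrableOn (fun y => (Real.cos (a * y) : ℂ) * p y) (Ioi 0) := by
  refine Integrable.mono' hi.norm (AEStronglyMeasurable.mul ?_ hi.aestronglyMeasurable) ?_
  · exact (by fun_prop : Continuous fun y : ℝ => (Real.cos (a * y) : ℂ)).aestronglyMeasurable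
  · refine ae_of_all _ fun y => ?_
    rw [norm_mul, Complex.norm_real, Real.norm_eq_abs]
    exact mul_le_of_le_one_left (norm_nonneg _) (Real.abs_cos_le_one _)

lemma vs_int_zero (f : ℝ → ℂ) (hi : IntegrableOn f (Ioi 0)) (C : ℝ)
    (hb : ∀ t, 0 ≤ t → ‖vsH f t‖ ≤ C * (1 + t ^ 2)⁻¹) : ∫ y in Ioi (0:ℝ), f y = 0 := by
  have h1 : Tendsto (fun t : ℝ => vsC f t⁻¹) atTop (nhds (∫ y in Ioi (0:ℝ), f y)) := by
    unfold vsC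
    refine tendsto_integral_filter_of_dominated_convergence (fun y => ‖f y‖) ?_ ?_ hi.norm ?_
    · exact Eventually.of_forall fun t => (VsNice.cosInt hi _).aestronglyMeasurable
    · refine Eventually.of_forall fun t => ae_of_all _ fun y => ?_
      rw [norm_mul, Complex.norm_real, Real.norm_eq_abs]
      exact mul_le_of_le_one_left (norm_nonneg _) (Real.abs_cos_le_one _)
    · refine ae_of_all _ fun y => ?_
      have : Tendsto (fun t : ℝ => (Real.cos (2 * Real.pi * t⁻¹ * y) : ℂ) * f y) atTop
          (nhds ((Real.cos (2 * Real.pi * 0 * y) : ℂ) * f y)) := by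
        have hc : Continuous fun s : ℝ => (Real.cos (2 * Real.pi * s * y) : ℂ) * f y := by fun_prop
        exact (hc.tendsto 0).comp tendsto_inv_atTop_zero
      simpa using this
  have h2 : Tendsto (fun t : ℝ => vsC f t⁻¹) atTop (nhds 0) := by
    refine squeeze_zero_norm' (a := fun t => C * t⁻¹) ?_ ?_
    · filter_upwards [eventually_gt_atTop 0] with t ht
      have h3 : vsC f t⁻¹ = t * vsH f t := by
        have : (t : ℂ) ≠ 0 := by exact_mod_cast ht.ne'
        rw [vsH_eq]; field_simp
      have hC : 0 ≤ C := by simpa using (norm_nonneg _).trans (hb 0 le_rfl)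
      rw [h3, norm_mul, Complex.norm_real, Real.norm_of_nonneg ht.le]
      calc t * ‖vsH f t‖ ≤ t * (C * (t ^ 2)⁻¹) := by
            gcongr
            refine (hb t ht.le).trans ?_
            gcongr; linarith
        _ = C * t⁻¹ := by field_simp
    · simpa using tendsto_inv_atTop_zero.const_mul C
  exact tendsto_nhds_unique h1 h2

lemma vs_bound_tendsto {p : ℝ → ℂ} {C : ℝ} (hb : ∀ t, 0 ≤ t → ‖p t‖ ≤ C * (1 + t ^ 2)⁻¹) :
    Tendsto p atTop (nhds 0) := by
  refine squeeze_zero_norm' (a := fun t => C * (1 + t ^ 2)⁻¹) ?_ ?_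
  · filter_upwards [eventually_ge_atTop 0] with t ht using hb t ht
  · have : Tendsto (fun t : ℝ => (1 + t ^ 2)⁻¹) atTop (nhds 0) :=
      tendsto_inv_atTop_zero.comp
        (tendsto_atTop_add_const_left _ _ (tendsto_pow_atTop (by norm_num)))
    simpa using this.const_mul C

lemma vs_cos_decay {p p' p'' : ℝ → ℂ} {C : ℝ} (h : VsNice p p' p'' C) :
    ∃ B, 0 ≤ B ∧ ∀ u, 0 < u → ‖vsC p u‖ ≤ B * (u ^ 2)⁻¹ := by
  have i0 := VsNice.intOn h.c0 h.b0
  have i2 := VsNice.intOn h.c2 h.b2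
  refine ⟨‖p' 0‖ + ∫ y in Ioi (0:ℝ), ‖p'' y‖, by positivity, fun u hu => ?_⟩
  set a := 2 * Real.pi * u with ha
  have hpi := Real.pi_gt_three
  have hapos : 0 < a := by positivity
  have hac : (a : ℂ) ≠ 0 := by exact_mod_cast hapos.ne'
  have c0 := VsNice.cosInt i0 a
  have c2 := VsNice.cosInt i2 a
  have key : ∫ y in Ioi (0:ℝ), ((Real.cos (a * y) : ℂ) * p y +
      ((a : ℂ) ^ 2)⁻¹ * ((Real.cos (a * y) : ℂ) * p'' y)) = 0 - ((a : ℂ) ^ 2)⁻¹ * p' 0 := by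
    have := integral_Ioi_of_hasDerivAt_of_tendsto (a := 0)
      (f := fun t : ℝ => (a : ℂ)⁻¹ * ((Real.sin (a * t) : ℂ) * p t)
        + ((a : ℂ) ^ 2)⁻¹ * ((Real.cos (a * t) : ℂ) * p' t))
      (f' := fun y => (Real.cos (a * y) : ℂ) * p y +
      ((a : ℂ) ^ 2)⁻¹ * ((Real.cos (a * y) : ℂ) * p'' y)) (m := 0) ?_ ?_ ?_ ?_
    · simpa using this
    · have q0 := h.c0 0 self_mem_Ici
      have q1 := h.c1 0 self_mem_Ici
      refine ContinuousWithinAt.add (continuousWithinAt_const.mul (ContinuousWithinAt.mul ?_ q0))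
        (continuousWithinAt_const.mul (ContinuousWithinAt.mul ?_ q1)) <;>
      exact Continuous.continuousWithinAt (by fun_prop)
    · intro t ht
      have e0 := (h.d1 t (le_of_lt ht)).hasDerivAt (Ici_mem_nhds ht)
      have e1 := (h.d2 t (le_of_lt ht)).hasDerivAt (Ici_mem_nhds ht)
      have l : HasDerivAt (fun t : ℝ => a * t) a t := by
        simpa using (hasDerivAt_id t).const_mul a
      have s := ((Real.hasDerivAt_sin (a * t)).comp t l).ofReal_comp
      have c := ((Real.hasDerivAt_cos (a * t)).comp t l).ofReal_comp
      have := ((s.mul e0).const_mul (a : ℂ)⁻¹).add ((c.mul e1).const_mul ((a : ℂ) ^ 2)⁻¹)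
      refine this.congr_deriv ?_
      simp only [Function.comp]
      push_cast
      field_simp
      ring
    · exact c0.add (c2.const_mul _)
    · have t0 : Tendsto (fun t : ℝ => (Real.sin (a * t) : ℂ) * p t) atTop (nhds 0) := by
        refine squeeze_zero_norm (fun t => ?_) (tendsto_zero_iff_norm_tendsto_zero.1 (vs_bound_tendsto h.b0))
        rw [norm_mul, Complex.norm_real, Real.norm_eq_abs]
        exact mul_le_of_le_one_left (norm_nonneg _) (Real.abs_sin_le_one _)
      have t1 : Tendsto (fun t : ℝ => (Real.cos (a * t) : ℂ) * p' t) atTop (nhds 0) := by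
        refine squeeze_zero_norm (fun t => ?_) (tendsto_zero_iff_norm_tendsto_zero.1 (vs_bound_tendsto h.b1))
        rw [norm_mul, Complex.norm_real, Real.norm_eq_abs]
        exact mul_le_of_le_one_left (norm_nonneg _) (Real.abs_cos_le_one _)
      simpa using (t0.const_mul (a : ℂ)⁻¹).add (t1.const_mul ((a : ℂ) ^ 2)⁻¹)
  rw [integral_add c0 (c2.const_mul _), integral_const_mul] at key
  have h3 : vsC p u = -((a : ℂ) ^ 2)⁻¹ * (p' 0 + ∫ y in Ioi (0:ℝ), (Real.cos (a * y) : ℂ) * p'' y) := by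
    unfold vsC
    rw [← ha]
    linear_combination key
  rw [h3, norm_mul, norm_neg, norm_inv, norm_pow, Complex.norm_real, Real.norm_of_nonneg hapos.le,
    mul_comm]
  gcongr
  · refine (norm_add_le _ _).trans ?_
    gcongr
    refine norm_integral_le_of_norm_le i2.norm (ae_of_all _ fun y => ?_)
    rw [norm_mul, Complex.norm_real, Real.norm_eq_abs]
    exact mul_le_of_le_one_left (norm_nonneg _) (Real.abs_cos_le_one _)
  · rw [ha]; nlinarith

lemma vs_fourier_even (q : ℝ → ℂ) (hi : IntegrableOn q (Ioi 0)) (he : ∀ y, q (-y) = q y) (u : ℝ) :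
    FourierTransform.fourier q u = 2 * vsC q u := by
  have hi' : IntegrableOn q (Iic 0) := by
    have := (integrable_indicator_iff measurableSet_Ioi).2 hi
    have h2 := this.comp_neg
    have h3 : IntegrableOn q (Iio 0) := by
      rw [← integrable_indicator_iff measurableSet_Iio]
      refine h2.congr (ae_of_all _ fun y => ?_)
      by_cases hy : y < 0
      · simp [hy, he]
      · simp [hy]
    rwa [integrableOn_Iic_iff_integrableOn_Iio]
  have hq : Integrable q := by
    rw [← integrableOn_univ, ← Iic_union_Ioi (a := (0:ℝ))]
    exact hi'.union hi
  rw [Real.fourier_real_eq_integral_exp_smul]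
  set g : ℝ → ℂ := fun v => Complex.exp (↑(-2 * Real.pi * v * u) * Complex.I) • q v with hg
  have hgi : Integrable g := by
    have hm : AEStronglyMeasurable (fun v : ℝ =>
        Complex.exp (↑(-2 * Real.pi * v * u) * Complex.I)) volume := by
      exact (by fun_prop : Continuous fun v : ℝ =>
        Complex.exp (↑(-2 * Real.pi * v * u) * Complex.I)).aestronglyMeasurable
    refine Integrable.mono' hq.norm (hm.smul hq.aestronglyMeasurable) ?_
    · refine ae_of_all _ fun v => ?_
      rw [hg, norm_smul, Complex.norm_exp_ofReal_mul_I, one_mul]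
  have h1 : ∫ v, g v = (∫ v in Iic 0, g v) + ∫ v in Ioi 0, g v := by
    rw [← setIntegral_univ, ← Iic_union_Ioi (a := (0:ℝ)), setIntegral_union
      (Iic_disjoint_Ioi le_rfl)
      measurableSet_Ioi hgi.integrableOn hgi.integrableOn]
  have h2 : (∫ v in Iic 0, g v) = ∫ v in Ioi 0, g (-v) := by
    have := integral_comp_neg_Ioi (0:ℝ) g
    rw [this]; simp
  rw [h1, h2, ← integral_add hgi.comp_neg.integrableOn hgi.integrableOn, vsC, ← integral_const_mul]
  congr 1; ext v
  simp only [hg, he, smul_eq_mul]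
  rw [Complex.ofReal_cos, Complex.cos]
  push_cast
  ring_nf

lemma vs_sq_bound {p : ℝ → ℂ} {C : ℝ} (hb : ∀ t, 0 ≤ t → ‖p t‖ ≤ C * (1 + t ^ 2)⁻¹) (t : ℝ)
    (ht : 0 < t) : ‖p t‖ ≤ C * (t ^ 2)⁻¹ := by
  have hC : 0 ≤ C := by simpa using (norm_nonneg _).trans (hb 0 le_rfl)
  refine (hb t ht.le).trans ?_
  gcongr; linarith

lemma vs_summable_sq : Summable fun k : ℕ => (((k : ℝ) + 1) ^ 2)⁻¹ := by
  have := (summable_nat_add_iff 1).2 (Real.summable_nat_pow_inv.2 (by norm_num : 1 < 2))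
  simpa using this

lemma vs_summable_of_sq {a : ℕ → ℂ} (B : ℝ) (h : ∀ k, ‖a k‖ ≤ B * (((k : ℝ) + 1) ^ 2)⁻¹) :
    Summable a := Summable.of_norm_bounded (vs_summable_sq.mul_left B) h

lemma vs_poisson (p : ℝ → ℂ) (C B : ℝ) (hc : ContinuousOn p (Ici 0))
    (hb : ∀ t, 0 ≤ t → ‖p t‖ ≤ C * (1 + t ^ 2)⁻¹)
    (hB : ∀ u, 0 < u → ‖vsC p u‖ ≤ B * (u ^ 2)⁻¹) (δ : ℝ) (hδ : 0 < δ) :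
    p 0 / 2 + ∑' k : ℕ, p ((k + 1 : ℝ) * δ) =
      (δ : ℂ)⁻¹ * (∫ y in Ioi (0:ℝ), p y) + 2 * ∑' k : ℕ, (δ : ℂ)⁻¹ * vsC p ((k + 1 : ℝ) / δ) := by
  set q : ℝ → ℂ := fun y => p (δ * |y|) with hq
  have hδc : (δ : ℂ) ≠ 0 := by exact_mod_cast hδ.ne'
  have hqc : Continuous q := by
    rw [← continuousOn_univ]
    refine hc.comp (by fun_prop) fun y _ => ?_
    simp only [mem_Ici]; positivity
  have hpi : IntegrableOn p (Ioi 0) := VsNice.intOn hc hb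
  have hqi : IntegrableOn q (Ioi 0) := by
    have : IntegrableOn (fun y => p (δ * y)) (Ioi 0) := by
      have := (integrableOn_Ioi_comp_mul_left_iff p 0 hδ).2 (by simpa using hpi)
      exact this
    refine this.congr_fun (fun y (hy : 0 < y) => ?_) measurableSet_Ioi
    simp [hq, abs_of_pos hy]
  have hF : ∀ u, FourierTransform.fourier q u = 2 * ((δ : ℂ)⁻¹ * vsC p (u / δ)) := by
    intro u
    rw [vs_fourier_even q hqi (fun y => by simp [hq])]
    congr 1
    have := integral_comp_mul_left_Ioi (fun y => (Real.cos (2 * Real.pi * (u / δ) * y) : ℂ) * p y) 0 hδ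
    rw [mul_zero] at this
    rw [vsC, vsC]
    have h3 : (δ : ℂ)⁻¹ = ((δ⁻¹ : ℝ) : ℂ) := by push_cast; rfl
    rw [h3, ← Complex.real_smul, ← this]
    refine setIntegral_congr_fun measurableSet_Ioi fun y (hy : 0 < y) => ?_
    simp only [hq, abs_of_pos hy]
    congr 3
    field_simp
  have hodd : ∀ u, vsC p (-u) = vsC p u := by
    intro u; unfold vsC; congr 1; ext y; congr 2
    rw [← Real.cos_neg]; congr 1; ring
  have hO : ∀ (r : ℝ → ℂ) (K : ℝ), (∀ y, y ≠ 0 → ‖r y‖ ≤ K * (y ^ 2)⁻¹) →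
      r =O[cocompact ℝ] (|·| ^ (-(2:ℝ))) := by
    intro r K hK
    refine IsBigO.of_bound K ?_
    have : ∀ᶠ y : ℝ in cocompact ℝ, y ≠ 0 := by
      have := (isCompact_singleton (x := (0:ℝ))).compl_mem_cocompact
      filter_upwards [this] with y hy using hy
    filter_upwards [this] with y hy
    refine (hK y hy).trans (le_of_eq ?_)
    rw [Real.norm_of_nonneg (by positivity), Real.rpow_neg (abs_nonneg _)]
    congr 2
    rw [Real.rpow_two, sq_abs]
  have hqb : ∀ y, y ≠ 0 → ‖q y‖ ≤ (C * (δ ^ 2)⁻¹) * (y ^ 2)⁻¹ := by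
    intro y hy
    have := vs_sq_bound hb (δ * |y|) (by positivity)
    refine this.trans (le_of_eq ?_)
    rw [mul_pow, sq_abs, mul_inv]; ring
  have hvb : ∀ u, u ≠ 0 → ‖vsC p (u / δ)‖ ≤ (B * δ ^ 2) * (u ^ 2)⁻¹ := by
    intro u hu
    have h1 : vsC p (u / δ) = vsC p (|u| / δ) := by
      rcases abs_choice u with h | h
      · rw [h]
      · rw [h, neg_div, hodd]
    rw [h1]
    refine (hB _ (by positivity)).trans (le_of_eq ?_)
    rw [div_pow, sq_abs, inv_div]; ring
  have hFb : ∀ u, u ≠ 0 → ‖FourierTransform.fourier q u‖ ≤ (2 * δ⁻¹ * (B * δ ^ 2)) * (u ^ 2)⁻¹ := by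
    intro u hu
    rw [hF, norm_mul, norm_mul, norm_inv, Complex.norm_real, Real.norm_of_nonneg hδ.le]
    have := hvb u hu
    have h2 : ‖(2:ℂ)‖ = 2 := by simp
    rw [h2, mul_assoc, mul_assoc, mul_assoc]
    gcongr
    linarith
  have P := Real.tsum_eq_tsum_fourier_of_rpow_decay hqc (by norm_num : (1:ℝ) < 2) (hO _ _ hqb)
    (hO _ _ hFb) 0
  have fold : ∀ (r : ℝ → ℂ) (K : ℝ), (∀ y, y ≠ 0 → ‖r y‖ ≤ K * (y ^ 2)⁻¹) → (∀ y, r (-y) = r y) →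
      ∑' n : ℤ, r n = r 0 + 2 * ∑' k : ℕ, r (k + 1) := by
    intro r K hK he
    have hs : Summable fun k : ℕ => r (k + 1) :=
      vs_summable_of_sq K fun k => hK _ (by positivity)
    rw [tsum_of_add_one_of_neg_add_one (f := fun n : ℤ => r n)]
    · simp only [Int.cast_neg, he]
      push_cast
      ring
    · simpa using hs
    · simp only [Int.cast_neg, he]; simpa using hs
  have hz : ∀ n : ℤ, FourierTransform.fourier q n * fourier n ((0:ℝ) : UnitAddCircle) =
      FourierTransform.fourier q n := by
    intro n; simp
  simp only [zero_add] at P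
  rw [tsum_congr hz, fold q _ hqb (fun y => by simp [hq]),
    fold (FourierTransform.fourier q) _ hFb (fun y => by rw [hF, hF, neg_div, hodd])] at P
  have e1 : ∀ k : ℕ, q (k + 1) = p ((k + 1 : ℝ) * δ) := by
    intro k
    simp only [hq]
    rw [abs_of_pos (by positivity), mul_comm]
  have e0 : q 0 = p 0 := by simp [hq]
  have e3 : vsC p 0 = ∫ y in Ioi (0:ℝ), p y := by simp [vsC]
  rw [tsum_congr e1, e0] at P
  simp only [hF, zero_div, e3, tsum_mul_left] at P ⊢
  linear_combination P / 2

lemma vs_trap {p p' p'' : ℝ → ℂ} {C : ℝ} (h : VsNice p p' p'' C) (a b : ℝ) (ha : 0 ≤ a)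
    (hab : a ≤ b) :
    ‖((b - a : ℝ) : ℂ) * (p a + p b) / 2 - ∫ t in a..b, p t‖ ≤
      (b - a) ^ 2 * ∫ t in a..b, ‖p'' t‖ := by
  have hsub : Icc a b ⊆ Ici 0 := fun t ht => ha.trans ht.1
  have c0 := h.c0.mono hsub
  have c1 := h.c1.mono hsub
  have c2 := h.c2.mono hsub
  have i0 : IntervalIntegrable p volume a b := c0.intervalIntegrable_of_Icc hab
  have hcq : Continuous fun t : ℝ => (((t - a) * (b - t) : ℝ) : ℂ) := by fun_prop
  have cq : ContinuousOn (fun t => (((t - a) * (b - t) : ℝ) : ℂ) * p'' t) (Icc a b) :=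
    hcq.continuousOn.mul c2
  have iq := cq.intervalIntegrable_of_Icc (μ := volume) hab
  have key : ∫ t in a..b, ((((t - a) * (b - t) : ℝ) : ℂ) * p'' t + 2 * p t) =
      ((b - a : ℝ) : ℂ) * (p a + p b) := by
    rw [intervalIntegral.integral_eq_sub_of_hasDerivAt_of_le hab
      (f := fun t => (((t - a) * (b - t) : ℝ) : ℂ) * p' t - ((a + b - 2 * t : ℝ) : ℂ) * p t)]
    · push_cast; ring
    · refine (hcq.continuousOn.mul c1).sub (ContinuousOn.mul ?_ c0)
      exact Continuous.continuousOn (by fun_prop)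
    · intro t ht
      have t0 : 0 < t := lt_of_le_of_lt ha ht.1
      have e0 := (h.d1 t t0.le).hasDerivAt (Ici_mem_nhds t0)
      have e1 := (h.d2 t t0.le).hasDerivAt (Ici_mem_nhds t0)
      have q0 : HasDerivAt (fun t : ℝ => (t - a) * (b - t)) (1 * (b - t) + (t - a) * (0 - 1)) t :=
        ((hasDerivAt_id t).sub_const a).mul ((hasDerivAt_const t b).sub (hasDerivAt_id t))
      have q1 : HasDerivAt (fun t : ℝ => a + b - 2 * t) (0 - 2 * 1) t :=
        (hasDerivAt_const t (a + b)).sub ((hasDerivAt_id t).const_mul 2)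
      refine ((q0.ofReal_comp.mul e1).sub (q1.ofReal_comp.mul e0)).congr_deriv ?_
      push_cast; ring
    · exact iq.add (i0.const_mul 2)
  rw [intervalIntegral.integral_add iq (i0.const_mul 2), intervalIntegral.integral_const_mul] at key
  have h2 : ((b - a : ℝ) : ℂ) * (p a + p b) / 2 - ∫ t in a..b, p t =
      (∫ t in a..b, (((t - a) * (b - t) : ℝ) : ℂ) * p'' t) / 2 := by
    linear_combination -key / 2
  have h3 : ‖∫ t in a..b, (((t - a) * (b - t) : ℝ) : ℂ) * p'' t‖ ≤
      (b - a) ^ 2 * ∫ t in a..b, ‖p'' t‖ := by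
    rw [← intervalIntegral.integral_const_mul]
    refine intervalIntegral.norm_integral_le_of_norm_le hab ?_
      ((c2.intervalIntegrable_of_Icc hab).norm.const_mul _)
    refine ae_of_all _ fun t ht => ?_
    have h4 : 0 ≤ (t - a) * (b - t) := mul_nonneg (by linarith [ht.1]) (by linarith [ht.2])
    rw [norm_mul, Complex.norm_real, Real.norm_of_nonneg h4]
    gcongr
    nlinarith [ht.1, ht.2]
  rw [h2, norm_div]
  have : ‖(2:ℂ)‖ = 2 := by simp
  rw [this]
  have hnn := norm_nonneg (∫ t in a..b, (((t - a) * (b - t) : ℝ) : ℂ) * p'' t)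
  linarith

/-- trapezoidal error on `[0, Mδ]` (for a function vanishing at `0`) -/
def vsE (p : ℝ → ℂ) (δ : ℝ) (M : ℕ) : ℂ :=
  (∑ m ∈ Finset.range M, p ((m + 1 : ℝ) * δ)) - p (M * δ) / 2 - (δ : ℂ)⁻¹ * ∫ t in (0:ℝ)..(M * δ), p t

lemma vsE_bound {p p' p'' : ℝ → ℂ} {C : ℝ} (h : VsNice p p' p'' C) (h0 : p 0 = 0) (δ : ℝ)
    (hδ : 0 < δ) (M : ℕ) : ‖vsE p δ M‖ ≤ δ * ∫ t in Ioi (0:ℝ), ‖p'' t‖ := by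
  have i2 := (VsNice.intOn h.c2 h.b2).norm
  have hδc : (δ : ℂ) ≠ 0 := by exact_mod_cast hδ.ne'
  have key : ‖vsE p δ M‖ ≤ δ * ∫ t in (0:ℝ)..(M * δ), ‖p'' t‖ := by
    induction M with
    | zero => simp [vsE, h0]
    | succ M ih =>
      have hM : (0:ℝ) ≤ M * δ := by positivity
      have hM1 : (M : ℝ) * δ ≤ ((M + 1 : ℕ) : ℝ) * δ := by
        push_cast; nlinarith
      have ii : ∀ (r : ℝ → ℂ), ContinuousOn r (Ici 0) → ∀ a b : ℝ, 0 ≤ a → 0 ≤ b →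
          IntervalIntegrable r volume a b := fun r hr a b ha hb =>
        (hr.mono fun t ht => (le_min ha hb).trans ht.1).intervalIntegrable
      have t := vs_trap h (M * δ) ((M + 1 : ℕ) * δ) hM hM1
      have e1 : vsE p δ (M + 1) = vsE p δ M + (δ : ℂ)⁻¹ *
          ((((M + 1 : ℕ) * δ - M * δ : ℝ) : ℂ) * (p (M * δ) + p ((M + 1 : ℕ) * δ)) / 2
            - ∫ t in (M * δ)..((M + 1 : ℕ) * δ), p t) := by
        have := intervalIntegral.integral_add_adjacent_intervals
          (ii p h.c0 0 (M * δ) le_rfl hM) (ii p h.c0 (M * δ) ((M + 1 : ℕ) * δ) hM (by positivity))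
        unfold vsE
        rw [← this, Finset.sum_range_succ]
        have e2 : (((M + 1 : ℕ) * δ - M * δ : ℝ) : ℂ) = δ := by push_cast; ring
        rw [e2]
        push_cast
        generalize ∑ m ∈ Finset.range M, p ((m + 1 : ℝ) * δ) = A
        generalize (∫ x in (0:ℝ)..(M * δ), p x) = I1
        generalize (∫ x in (M * δ)..((M + 1) * δ), p x) = I2
        field_simp
        ring
      have e3 := intervalIntegral.integral_add_adjacent_intervals
          (ii p'' h.c2 0 (M * δ) le_rfl hM).norm
          (ii p'' h.c2 (M * δ) ((M + 1 : ℕ) * δ) hM (by positivity)).norm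
      rw [e1, ← e3, mul_add δ]
      refine (norm_add_le _ _).trans (add_le_add ih ?_)
      rw [norm_mul, norm_inv, Complex.norm_real, Real.norm_of_nonneg hδ.le,
        inv_mul_le_iff₀ hδ]
      refine t.trans (le_of_eq ?_)
      push_cast; ring
  refine key.trans ?_
  gcongr
  rw [intervalIntegral.integral_of_le (by positivity)]
  exact setIntegral_mono_set i2 (ae_of_all _ fun t => norm_nonneg _)
    (Ioc_subset_Ioi_self.eventuallyLE)

lemma vs_summable_mul {p : ℝ → ℂ} {C : ℝ} (hb : ∀ t, 0 ≤ t → ‖p t‖ ≤ C * (1 + t ^ 2)⁻¹)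
    (y : ℝ) (hy : 0 < y) : Summable fun k : ℕ => p ((k + 1 : ℝ) * y) := by
  refine vs_summable_of_sq (C * (y ^ 2)⁻¹) fun k => ?_
  refine (vs_sq_bound hb _ (by positivity)).trans (le_of_eq ?_)
  rw [mul_pow, mul_inv]; ring

lemma vsE_tendsto {p : ℝ → ℂ} {C : ℝ} (hc : ContinuousOn p (Ici 0))
    (hb : ∀ t, 0 ≤ t → ‖p t‖ ≤ C * (1 + t ^ 2)⁻¹) (δ : ℝ) (hδ : 0 < δ) :
    Tendsto (vsE p δ) atTop
      (nhds ((∑' k : ℕ, p ((k + 1 : ℝ) * δ)) - (δ : ℂ)⁻¹ * ∫ t in Ioi (0:ℝ), p t)) := by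
  have hM : Tendsto (fun M : ℕ => (M : ℝ) * δ) atTop atTop :=
    tendsto_natCast_atTop_atTop.atTop_mul_const hδ
  have h1 := (vs_summable_mul hb δ hδ).hasSum.tendsto_sum_nat
  have h2 := (vs_bound_tendsto hb).comp hM
  have h3 := intervalIntegral_tendsto_integral_Ioi 0 (VsNice.intOn hc hb) hM
  have := (h1.sub (h2.div_const 2)).sub (h3.const_mul (δ : ℂ)⁻¹)
  simp only [zero_div, sub_zero] at this
  exact this

lemma vs_divisor (φ : ℕ → ℂ) (C : ℝ) (hφ : ∀ n, 0 < n → ‖φ n‖ ≤ C * ((n : ℝ) ^ 2)⁻¹) :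
    HasSum (fun m : ℕ => ∑' k : ℕ, φ ((m + 1) * (k + 1)))
      (∑' n : ℕ, ((n + 1 : ℕ).divisors.card : ℂ) * φ (n + 1)) := by
  have hs0 : Summable fun x : ℕ × ℕ => φ ((x.1 + 1) * (x.2 + 1)) := by
    have h1 := (vs_summable_sq.mul_of_nonneg vs_summable_sq
      (fun k => by positivity) (fun k => by positivity)).mul_left C
    refine Summable.of_norm_bounded h1 fun x => ?_
    refine (hφ _ (by positivity)).trans (le_of_eq ?_)
    push_cast
    rw [mul_pow, mul_inv]
  set e : ℕ × ℕ ≃ ℕ+ × ℕ+ := Equiv.prodCongr Equiv.pnatEquivNat.symm Equiv.pnatEquivNat.symm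
  have hs1 : Summable fun x : ℕ+ × ℕ+ => φ (x.1 * x.2) := by
    rw [← e.summable_iff]
    refine hs0.congr fun x => ?_
    simp [e]
  have hs2 : Summable fun x : (Σ n : ℕ+, Nat.divisorsAntidiagonal n) => φ x.1 := by
    rw [← sigmaAntidiagonalEquivProd.symm.summable_iff]
    exact hs1
  have t1 : ∑' x : ℕ × ℕ, φ ((x.1 + 1) * (x.2 + 1)) = ∑' n : ℕ, ((n + 1 : ℕ).divisors.card : ℂ) * φ (n + 1) := by
    calc ∑' x : ℕ × ℕ, φ ((x.1 + 1) * (x.2 + 1)) = ∑' x : ℕ+ × ℕ+, φ (x.1 * x.2) := by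
          rw [← e.tsum_eq]; simp [e]
      _ = ∑' x : (Σ n : ℕ+, Nat.divisorsAntidiagonal n), φ x.1 := by
          rw [← sigmaAntidiagonalEquivProd.symm.tsum_eq]; rfl
      _ = ∑' n : ℕ+, ((n : ℕ).divisors.card : ℂ) * φ n := by
          rw [hs2.tsum_sigma]
          refine tsum_congr fun n => ?_
          simp only [tsum_fintype, Finset.sum_const, nsmul_eq_mul]
          congr 2
          simp only [Finset.univ_eq_attach, Finset.card_attach]
          rw [← Nat.map_div_right_divisors, Finset.card_map]
      _ = _ := by
          rw [← Equiv.pnatEquivNat.symm.tsum_eq]; simp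
  rw [← t1]
  exact hs0.hasSum.prod_fiberwise fun m => (hs0.prod_factor m).hasSum

lemma vs_log_int {f : ℝ → ℂ} {C : ℝ} (hc : ContinuousOn f (Ici 0))
    (hb : ∀ t, 0 ≤ t → ‖f t‖ ≤ C * (1 + t ^ 2)⁻¹) :
    IntegrableOn (fun v => ‖f v‖ * |Real.log v|) (Ioi 0) := by
  have hC : 0 ≤ C := by simpa using (norm_nonneg _).trans (hb 0 le_rfl)
  have hm : AEStronglyMeasurable (fun v => ‖f v‖ * |Real.log v|) (volume.restrict (Ioi 0)) := by
    refine AEStronglyMeasurable.mul ?_ ?_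
    · exact ((hc.mono Ioi_subset_Ici_self).aestronglyMeasurable measurableSet_Ioi).norm
    · exact Real.measurable_log.norm.aestronglyMeasurable
  rw [← Ioc_union_Ioi_eq_Ioi (zero_le_one' ℝ)]
  refine IntegrableOn.union ?_ ?_
  · have h1 : IntegrableOn (fun v => C * |Real.log v|) (Ioc 0 1) := by
      have := (intervalIntegral.intervalIntegrable_log' (a := 0) (b := 1)).norm.const_mul C
      rwa [intervalIntegrable_iff_integrableOn_Ioc_of_le zero_le_one] at this
    refine Integrable.mono' h1 (hm.mono_measure (Measure.restrict_mono Ioc_subset_Ioi_self le_rfl)) ?_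
    refine (ae_restrict_iff' measurableSet_Ioc).2 (ae_of_all _ fun v hv => ?_)
    rw [Real.norm_of_nonneg (by positivity)]
    gcongr
    refine (hb v hv.1.le).trans (mul_le_of_le_one_right hC (inv_le_one_of_one_le₀ ?_))
    nlinarith [sq_nonneg v]
  · have h1 : IntegrableOn (fun v : ℝ => (2 * C) * v ^ (-(3/2) : ℝ)) (Ioi 1) :=
      (integrableOn_Ioi_rpow_of_lt (by norm_num) one_pos).const_mul _
    refine Integrable.mono' h1 (hm.mono_measure (Measure.restrict_mono (Ioi_subset_Ioi zero_le_one) le_rfl)) ?_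
    refine (ae_restrict_iff' measurableSet_Ioi).2 (ae_of_all _ fun v (hv : 1 < v) => ?_)
    have v0 : 0 < v := by linarith
    rw [Real.norm_of_nonneg (by positivity), abs_of_pos (Real.log_pos hv)]
    have h2 := vs_sq_bound hb v v0
    have h3 := Real.log_le_rpow_div v0.le (by norm_num : (0:ℝ) < 1/2)
    calc ‖f v‖ * Real.log v ≤ (C * (v ^ 2)⁻¹) * (v ^ (1/2 : ℝ) / (1/2)) := by
          have := Real.log_pos hv
          gcongr
      _ = 2 * C * ((v ^ 2)⁻¹ * v ^ (1/2 : ℝ)) := by ring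
      _ = 2 * C * v ^ (-(3/2) : ℝ) := by
          congr 1
          rw [← Real.rpow_natCast, ← Real.rpow_neg v0.le, ← Real.rpow_add v0]
          norm_num

/-- the sum `∑ f(ky)` -/
def vsS (f : ℝ → ℂ) (y : ℝ) : ℂ := ∑' k : ℕ, f ((k + 1 : ℝ) * y)

lemma vs_subst {E : Type*} [NormedAddCommGroup E] [NormedSpace ℝ E] (g : ℝ → E) (k : ℕ) (ε : ℝ)
    (hε : 0 < ε) : ∫ y in Ioi ε, g ((k + 1 : ℝ) * y) =
      ∫ v in Ioi (0:ℝ), (k + 1 : ℝ)⁻¹ • (Ici ((k + 1 : ℝ) * ε)).indicator g v := by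
  have hk : (0:ℝ) < (k + 1 : ℝ) := by positivity
  rw [integral_comp_mul_left_Ioi g ε hk, integral_smul, setIntegral_indicator measurableSet_Ici,
    ← integral_Ici_eq_integral_Ioi]
  congr 3
  refine (inter_eq_right.2 fun v (hv : _ ≤ v) => ?_).symm
  exact lt_of_lt_of_le (by positivity : (0:ℝ) < (k + 1 : ℝ) * ε) hv

lemma vs_harm {f : ℝ → ℂ} {C : ℝ} (hc : ContinuousOn f (Ici 0))
    (hb : ∀ t, 0 ≤ t → ‖f t‖ ≤ C * (1 + t ^ 2)⁻¹) (ε : ℝ) (hε : 0 < ε) :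
    ∫ y in Ioi ε, vsS f y = ∫ v in Ioi (0:ℝ), ((harmonic ⌊v / ε⌋₊ : ℝ) : ℂ) * f v := by
  have hC : 0 ≤ C := by simpa using (norm_nonneg _).trans (hb 0 le_rfl)
  have hi : IntegrableOn f (Ioi 0) := VsNice.intOn hc hb
  have i1 : ∀ k : ℕ, IntegrableOn (fun y => f ((k + 1 : ℝ) * y)) (Ioi ε) := fun k =>
    (integrableOn_Ioi_comp_mul_left_iff f ε (by positivity)).2
      (hi.mono_set (Ioi_subset_Ioi (by positivity)))
  set D := C * (1 + (ε ^ 2)⁻¹) with hD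
  set I := ∫ y in Ioi ε, (1 + y ^ 2 : ℝ)⁻¹ with hI
  have s1 : Summable fun k : ℕ => ∫ y in Ioi ε, ‖f ((k + 1 : ℝ) * y)‖ := by
    refine Summable.of_nonneg_of_le (fun k => by positivity) (fun k => ?_)
      (vs_summable_sq.mul_left (D * I))
    calc ∫ y in Ioi ε, ‖f ((k + 1 : ℝ) * y)‖
        ≤ ∫ y in Ioi ε, (D * (((k : ℝ) + 1) ^ 2)⁻¹) * (1 + y ^ 2 : ℝ)⁻¹ := by
          refine setIntegral_mono_on (i1 k).norm
            (integrable_inv_one_add_sq.integrableOn.const_mul _) measurableSet_Ioi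
            fun y (hy : ε < y) => ?_
          have y0 : 0 < y := hε.trans hy
          refine (vs_sq_bound hb _ (by positivity)).trans ?_
          rw [hD, mul_pow, mul_inv]
          have : (y ^ 2)⁻¹ ≤ (1 + (ε ^ 2)⁻¹) * (1 + y ^ 2)⁻¹ := by
            rw [← div_eq_mul_inv, le_div_iff₀ (by positivity), inv_mul_le_iff₀ (by positivity)]
            have : 1 ≤ y ^ 2 * (ε ^ 2)⁻¹ := by
              rw [← div_eq_mul_inv, one_le_div (by positivity)]
              gcongr
            linarith
          calc C * ((((k : ℝ) + 1) ^ 2)⁻¹ * (y ^ 2)⁻¹)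
              ≤ C * ((((k : ℝ) + 1) ^ 2)⁻¹ * ((1 + (ε ^ 2)⁻¹) * (1 + y ^ 2)⁻¹)) := by gcongr
            _ = _ := by ring
      _ = D * I * (((k : ℝ) + 1) ^ 2)⁻¹ := by rw [integral_const_mul]; ring
  have H1 := hasSum_integral_of_summable_integral_norm i1 s1
  have i2 : ∀ k : ℕ, IntegrableOn
      (fun v => (k + 1 : ℝ)⁻¹ • (Ici ((k + 1 : ℝ) * ε)).indicator f v) (Ioi 0) := fun k =>
    by
    have := (Integrable.indicator hi (measurableSet_Ici (a := (k + 1 : ℝ) * ε))).smul ((k + 1 : ℝ)⁻¹)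
    exact this
  have s2 : Summable fun k : ℕ => ∫ v in Ioi (0:ℝ),
      ‖(k + 1 : ℝ)⁻¹ • (Ici ((k + 1 : ℝ) * ε)).indicator f v‖ := by
    refine s1.congr fun k => ?_
    rw [vs_subst (fun v => ‖f v‖) k ε hε]
    congr 1; ext v
    rw [norm_smul, norm_indicator_eq_indicator_norm, Real.norm_of_nonneg (by positivity), smul_eq_mul]
  have H2 := hasSum_integral_of_summable_integral_norm i2 s2
  have H3 : HasSum (fun k : ℕ => ∫ y in Ioi ε, f ((k + 1 : ℝ) * y)) _ := H2.congr_fun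
    fun k => vs_subst f k ε hε
  have := H1.unique H3
  unfold vsS
  rw [this]
  refine setIntegral_congr_fun measurableSet_Ioi fun v (hv : 0 < v) => ?_
  have hn : ∀ k : ℕ, v ∈ Ici ((k + 1 : ℝ) * ε) ↔ k ∈ Finset.range ⌊v / ε⌋₊ := by
    intro k
    rw [mem_Ici, Finset.mem_range, ← Nat.succ_le_iff, Nat.le_floor_iff (by positivity),
      le_div_iff₀ hε]
    push_cast; rfl
  rw [tsum_eq_sum (s := Finset.range ⌊v / ε⌋₊)]
  · rw [harmonic]
    push_cast
    rw [Finset.sum_mul]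
    refine Finset.sum_congr rfl fun k hk => ?_
    rw [indicator_of_mem ((hn k).2 hk), Complex.real_smul]
    push_cast; rfl
  · intro k hk
    rw [indicator_of_notMem (fun h => hk ((hn k).1 h)), smul_zero]

lemma vs_harm_tendsto :
    Tendsto (fun w : ℝ => (harmonic ⌊w⌋₊ : ℝ) - Real.log w) atTop
      (nhds Real.eulerMascheroniConstant) := by
  have h1 := Real.tendsto_harmonic_sub_log.comp (tendsto_nat_floor_atTop (α := ℝ))
  have h2 : Tendsto (fun w : ℝ => Real.log ((⌊w⌋₊ : ℝ) / w)) atTop (nhds (Real.log 1)) :=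
    (Real.continuousAt_log one_ne_zero).tendsto.comp (tendsto_nat_floor_div_atTop (R := ℝ))
  rw [Real.log_one] at h2
  have := h1.add h2
  rw [add_zero] at this
  refine this.congr' ?_
  filter_upwards [eventually_ge_atTop 1] with w hw
  have : (0:ℝ) < ⌊w⌋₊ := by
    exact_mod_cast Nat.floor_pos.2 hw
  rw [Real.log_div this.ne' (by positivity)]
  simp

lemma vs_harm_bound (w : ℝ) (hw : 0 < w) :
    |(harmonic ⌊w⌋₊ : ℝ) - Real.log w| ≤ 1 + max 0 (-Real.log w) := by
  have h1 := log_le_harmonic_floor w hw.le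
  rw [abs_of_nonneg (by linarith)]
  by_cases h : 1 ≤ w
  · have := harmonic_floor_le_one_add_log w h
    have := le_max_left 0 (-Real.log w)
    linarith
  · push Not at h
    rw [Nat.floor_eq_zero.2 h]
    have := le_max_right 0 (-Real.log w)
    simp only [harmonic_zero, Rat.cast_zero]
    linarith

lemma vs_int_S {f : ℝ → ℂ} {C : ℝ} (hc : ContinuousOn f (Ici 0))
    (hb : ∀ t, 0 ≤ t → ‖f t‖ ≤ C * (1 + t ^ 2)⁻¹) (h0 : ∫ y in Ioi (0:ℝ), f y = 0)
    (hS : IntegrableOn (vsS f) (Ioi 0)) :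
    ∫ y in Ioi (0:ℝ), vsS f y = ∫ v in Ioi (0:ℝ), f v * (Real.log v : ℂ) := by
  have hi : IntegrableOn f (Ioi 0) := VsNice.intOn hc hb
  have hl := vs_log_int hc hb
  set ε : ℕ → ℝ := fun n => 1 / ((n : ℝ) + 1) with hεd
  have hε : ∀ n, 0 < ε n := fun n => by positivity
  have hε1 : ∀ n, ε n ≤ 1 := fun n => by
    rw [hεd]; simp only; rw [div_le_one (by positivity)]; linarith [Nat.cast_nonneg (α := ℝ) n]
  have hε0 : Tendsto ε atTop (nhds 0) := tendsto_one_div_add_atTop_nhds_zero_nat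
  have t1 : Tendsto (fun n => ∫ y in Ioi (ε n), vsS f y) atTop
      (nhds (∫ y in Ioi (0:ℝ), vsS f y)) := by
    have := (aecover_Ioi_of_Ioi (μ := volume) hε0).integral_tendsto_of_countably_generated hS
    refine this.congr fun n => ?_
    rw [Measure.restrict_restrict measurableSet_Ioi, inter_eq_left.2 (Ioi_subset_Ioi (hε n).le)]
  set γ := Real.eulerMascheroniConstant
  have t2 : Tendsto (fun n => ∫ v in Ioi (0:ℝ),
      (((harmonic ⌊v / ε n⌋₊ : ℝ) - Real.log (1 / ε n) - γ : ℝ) : ℂ) * f v) atTop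
      (nhds (∫ v in Ioi (0:ℝ), f v * (Real.log v : ℂ))) := by
    refine tendsto_integral_of_dominated_convergence
      (fun v => (1 + |γ|) * ‖f v‖ + 2 * (‖f v‖ * |Real.log v|)) ?_ ?_ ?_ ?_
    · intro n
      refine AEStronglyMeasurable.mul ?_ hi.aestronglyMeasurable
      refine Measurable.aestronglyMeasurable ?_
      refine Complex.measurable_ofReal.comp ?_
      refine Measurable.sub_const (Measurable.sub_const ?_ _) _
      have hm : Measurable fun m : ℕ => (harmonic m : ℝ) := measurable_from_top
      exact hm.comp (Nat.measurable_floor.comp (measurable_id.div_const _))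
    · exact (hi.norm.const_mul _).add (hl.const_mul 2)
    · intro n
      refine (ae_restrict_iff' measurableSet_Ioi).2 (ae_of_all _ fun v (hv : 0 < v) => ?_)
      rw [norm_mul, Complex.norm_real, Real.norm_eq_abs]
      have hw : 0 < v / ε n := div_pos hv (hε n)
      have b1 := vs_harm_bound _ hw
      have e1 : Real.log (v / ε n) = Real.log v + Real.log (1 / ε n) := by
        rw [← Real.log_mul hv.ne' (by have := hε n; positivity)]; congr 1; ring
      have l0 : 0 ≤ Real.log (1 / ε n) := Real.log_nonneg (by rw [le_div_iff₀ (hε n)]; linarith [hε1 n])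
      have b2 : max 0 (-Real.log (v / ε n)) ≤ |Real.log v| := by
        refine max_le (abs_nonneg _) ?_
        rw [e1]
        linarith [neg_abs_le (Real.log v)]
      have b3 : |(harmonic ⌊v / ε n⌋₊ : ℝ) - Real.log (1 / ε n) - γ| ≤ 1 + |γ| + 2 * |Real.log v| := by
        have e2 : (harmonic ⌊v / ε n⌋₊ : ℝ) - Real.log (1 / ε n) - γ =
            ((harmonic ⌊v / ε n⌋₊ : ℝ) - Real.log (v / ε n)) + Real.log v - γ := by rw [e1]; ring
        rw [e2]
        refine (abs_sub _ _).trans ?_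
        have := abs_add_le ((harmonic ⌊v / ε n⌋₊ : ℝ) - Real.log (v / ε n)) (Real.log v)
        linarith
      calc _ ≤ (1 + |γ| + 2 * |Real.log v|) * ‖f v‖ := by gcongr
        _ = _ := by ring
    · refine (ae_restrict_iff' measurableSet_Ioi).2 (ae_of_all _ fun v (hv : 0 < v) => ?_)
      have hw : Tendsto (fun n => v / ε n) atTop atTop := by
        have : (fun n => v / ε n) = fun n : ℕ => v * ((n : ℝ) + 1) := by
          ext n; simp [hεd]
        rw [this]
        exact (tendsto_atTop_add_const_right _ _ tendsto_natCast_atTop_atTop).const_mul_atTop hv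
      have h3 := vs_harm_tendsto.comp hw
      have h4 : Tendsto (fun n => (harmonic ⌊v / ε n⌋₊ : ℝ) - Real.log (1 / ε n) - γ) atTop
          (nhds (Real.log v)) := by
        have h5 := (h3.add_const (Real.log v)).sub_const γ
        have e : γ + Real.log v - γ = Real.log v := by ring
        rw [e] at h5
        refine h5.congr fun n => ?_
        have e1 : Real.log (v / ε n) = Real.log v + Real.log (1 / ε n) := by
          rw [← Real.log_mul hv.ne' (by have := hε n; positivity)]; congr 1; ring
        simp only [Function.comp, e1]; ring
      have h6 := ((Complex.continuous_ofReal.tendsto _).comp h4).mul_const (f v)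
      rw [mul_comm (f v)]
      exact h6
  refine tendsto_nhds_unique t1 (t2.congr fun n => ?_)
  rw [vs_harm hc hb (ε n) (hε n)]
  set c : ℂ := ((Real.log (1 / ε n) + γ : ℝ) : ℂ) with hcd
  have e1 : ∀ v, (((harmonic ⌊v / ε n⌋₊ : ℝ) : ℂ) * f v) =
      (((harmonic ⌊v / ε n⌋₊ : ℝ) - Real.log (1 / ε n) - γ : ℝ) : ℂ) * f v + c * f v := by
    intro v; rw [hcd]; push_cast; ring
  simp only [e1]
  rw [integral_add _ (hi.const_mul c), integral_const_mul, h0, mul_zero, add_zero]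
  -- integrability
  have hm : AEStronglyMeasurable (fun v => (((harmonic ⌊v / ε n⌋₊ : ℝ) - Real.log (1 / ε n) - γ : ℝ) : ℂ) * f v)
      (volume.restrict (Ioi 0)) := by
    refine AEStronglyMeasurable.mul ?_ hi.aestronglyMeasurable
    refine Measurable.aestronglyMeasurable ?_
    refine Complex.measurable_ofReal.comp ?_
    refine Measurable.sub_const (Measurable.sub_const ?_ _) _
    have hm : Measurable fun m : ℕ => (harmonic m : ℝ) := measurable_from_top
    exact hm.comp (Nat.measurable_floor.comp (measurable_id.div_const _))
  refine Integrable.mono' ((hi.norm.const_mul (1 + |γ|)).add (hl.const_mul 2)) hm ?_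
  refine (ae_restrict_iff' measurableSet_Ioi).2 (ae_of_all _ fun v (hv : 0 < v) => ?_)
  rw [norm_mul, Complex.norm_real, Real.norm_eq_abs]
  have hw : 0 < v / ε n := div_pos hv (hε n)
  have b1 := vs_harm_bound _ hw
  have e1 : Real.log (v / ε n) = Real.log v + Real.log (1 / ε n) := by
    rw [← Real.log_mul hv.ne' (by have := hε n; positivity)]; congr 1; ring
  have l0 : 0 ≤ Real.log (1 / ε n) := Real.log_nonneg (by rw [le_div_iff₀ (hε n)]; linarith [hε1 n])
  have b2 : max 0 (-Real.log (v / ε n)) ≤ |Real.log v| := by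
    refine max_le (abs_nonneg _) ?_
    rw [e1]
    linarith [neg_abs_le (Real.log v)]
  have b3 : |(harmonic ⌊v / ε n⌋₊ : ℝ) - Real.log (1 / ε n) - γ| ≤ 1 + |γ| + 2 * |Real.log v| := by
    have e2 : (harmonic ⌊v / ε n⌋₊ : ℝ) - Real.log (1 / ε n) - γ =
        ((harmonic ⌊v / ε n⌋₊ : ℝ) - Real.log (v / ε n)) + Real.log v - γ := by rw [e1]; ring
    rw [e2]
    refine (abs_sub _ _).trans ?_
    have := abs_add_le ((harmonic ⌊v / ε n⌋₊ : ℝ) - Real.log (v / ε n)) (Real.log v)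
    linarith
  calc _ ≤ (1 + |γ| + 2 * |Real.log v|) * ‖f v‖ := by gcongr
    _ = _ := by simp only [Pi.add_apply]; ring

lemma vs_lin {p p' p'' : ℝ → ℂ} {C : ℝ} (h : VsNice p p' p'' C) (h0 : p 0 = 0) (t : ℝ)
    (ht : 0 ≤ t) : ‖p t‖ ≤ C * t := by
  have := (convex_Ici (0:ℝ)).norm_image_sub_le_of_norm_hasDerivWithin_le (C := C)
    (fun x hx => h.d1 x hx) (fun x hx => (h.b1 x hx).trans
      (mul_le_of_le_one_right h.C0 (inv_le_one_of_one_le₀ (by nlinarith [sq_nonneg x]))))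
    (self_mem_Ici (a := (0:ℝ))) (mem_Ici.2 ht)
  simpa [h0, abs_of_nonneg ht] using this

/-- the terms of the dual sum -/
def vsT (h : ℝ → ℂ) (k : ℕ) (y : ℝ) : ℂ := ((k + 1 : ℝ) : ℂ)⁻¹ * h (y / (k + 1 : ℝ))

lemma vsT_bound {h : ℝ → ℂ} {C : ℝ} (hl : ∀ t, 0 ≤ t → ‖h t‖ ≤ C * t) (k : ℕ) (y : ℝ)
    (hy : 0 ≤ y) : ‖vsT h k y‖ ≤ (C * y) * (((k : ℝ) + 1) ^ 2)⁻¹ := by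
  have hk : (0:ℝ) < k + 1 := by positivity
  rw [vsT, norm_mul, norm_inv, Complex.norm_real, Real.norm_of_nonneg hk.le]
  have := hl (y / (k + 1)) (by positivity)
  calc ((k : ℝ) + 1)⁻¹ * ‖h (y / (k + 1))‖ ≤ ((k : ℝ) + 1)⁻¹ * (C * (y / (k + 1))) := by gcongr
    _ = _ := by field_simp

lemma vs_dual {f h' h'' : ℝ → ℂ} {C D : ℝ} (hc : ContinuousOn f (Ici 0))
    (hb : ∀ t, 0 ≤ t → ‖f t‖ ≤ C * (1 + t ^ 2)⁻¹) (hh : VsNice (vsH f) h' h'' D) (y : ℝ)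
    (hy : 0 < y) : f 0 / 2 + vsS f y = 2 * ∑' k : ℕ, vsT (vsH f) k y := by
  have h0 := vs_int_zero f (VsNice.intOn hc hb) D hh.b0
  have hl := vs_lin hh (vsH_zero f)
  have hB : ∀ u, 0 < u → ‖vsC f u‖ ≤ D * (u ^ 2)⁻¹ := by
    intro u hu
    have hu' : (u : ℂ) ≠ 0 := by exact_mod_cast hu.ne'
    have e : vsC f u = (u : ℂ)⁻¹ * vsH f u⁻¹ := by
      rw [vsH_eq, inv_inv]; push_cast; field_simp
    rw [e, norm_mul, norm_inv, Complex.norm_real, Real.norm_of_nonneg hu.le]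
    calc u⁻¹ * ‖vsH f u⁻¹‖ ≤ u⁻¹ * (D * u⁻¹) := by gcongr; exact hl _ (by positivity)
      _ = _ := by field_simp
  have P := vs_poisson f C D hc hb hB y hy
  rw [h0, mul_zero, zero_add] at P
  rw [vsS, P]
  congr 1
  refine tsum_congr fun k => ?_
  have hk : ((k + 1 : ℝ) : ℂ) ≠ 0 := by
    have : (0:ℝ) < k + 1 := by positivity
    exact_mod_cast this.ne'
  have hy' : (y : ℂ) ≠ 0 := by exact_mod_cast hy.ne'
  rw [vsT, vsH_eq, inv_div, Complex.ofReal_div]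
  field_simp

lemma vsS_bound {f h' h'' : ℝ → ℂ} {C D : ℝ} (hc : ContinuousOn f (Ici 0))
    (hb : ∀ t, 0 ≤ t → ‖f t‖ ≤ C * (1 + t ^ 2)⁻¹) (hh : VsNice (vsH f) h' h'' D) :
    ∃ K, ∀ y, 0 ≤ y → ‖vsS f y‖ ≤ K * (1 + y ^ 2)⁻¹ := by
  have hC : 0 ≤ C := by simpa using (norm_nonneg _).trans (hb 0 le_rfl)
  have hD := hh.C0
  have hl := vs_lin hh (vsH_zero f)
  set Z := ∑' k : ℕ, (((k : ℝ) + 1) ^ 2)⁻¹ with hZ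
  have hZ0 : 0 ≤ Z := tsum_nonneg fun k => by positivity
  refine ⟨2 * (C * Z + 2 * (D * Z) + ‖f 0‖), fun y hy => ?_⟩
  rcases hy.eq_or_lt with rfl | hy
  · have : vsS f 0 = 0 := by simp [vsS]
    rw [this, norm_zero]; positivity
  by_cases h1 : y ≤ 1
  · have e : vsS f y = 2 * ∑' k : ℕ, vsT (vsH f) k y - f 0 / 2 := by
      rw [← vs_dual hc hb hh y hy]; ring
    have b : ‖∑' k : ℕ, vsT (vsH f) k y‖ ≤ D * y * Z :=
      tsum_of_norm_bounded (vs_summable_sq.hasSum.mul_left (D * y)) fun k => vsT_bound hl k y hy.le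
    have b2 : D * y * Z ≤ D * Z := by
      have : D * y ≤ D := mul_le_of_le_one_right hD h1
      gcongr
    have b3 : ‖vsS f y‖ ≤ 2 * (D * Z) + ‖f 0‖ := by
      rw [e]
      refine (norm_sub_le _ _).trans ?_
      rw [norm_mul, norm_div]
      have : ‖(2:ℂ)‖ = 2 := by simp
      rw [this]
      have := norm_nonneg (f 0)
      linarith
    rw [← div_eq_mul_inv, le_div_iff₀ (by positivity)]
    have h5 : 0 ≤ C * Z := by positivity
    calc ‖vsS f y‖ * (1 + y ^ 2) ≤ (2 * (D * Z) + ‖f 0‖) * 2 := by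
          gcongr; nlinarith
      _ ≤ _ := by linarith
  · push Not at h1
    have b : ‖vsS f y‖ ≤ C * (y ^ 2)⁻¹ * Z := by
      refine tsum_of_norm_bounded (vs_summable_sq.hasSum.mul_left (C * (y ^ 2)⁻¹)) fun k => ?_
      refine (vs_sq_bound hb _ (by positivity)).trans (le_of_eq ?_)
      rw [mul_pow, mul_inv]; ring
    have b2 : (y ^ 2)⁻¹ ≤ 2 * (1 + y ^ 2)⁻¹ := by
      rw [← div_eq_mul_inv, le_div_iff₀ (by positivity), inv_mul_le_iff₀ (by positivity)]
      nlinarith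
    calc ‖vsS f y‖ ≤ C * (2 * (1 + y ^ 2)⁻¹) * Z := b.trans (by gcongr)
      _ = 2 * (C * Z) * (1 + y ^ 2)⁻¹ := by ring
      _ ≤ _ := by
        gcongr
        have : 0 ≤ D * Z := by positivity
        linarith [norm_nonneg (f 0)]

lemma vsS_int {f h' h'' : ℝ → ℂ} {C D : ℝ} (hc : ContinuousOn f (Ici 0))
    (hb : ∀ t, 0 ≤ t → ‖f t‖ ≤ C * (1 + t ^ 2)⁻¹) (hh : VsNice (vsH f) h' h'' D) :
    IntegrableOn (vsS f) (Ioi 0) := by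
  obtain ⟨K, hK⟩ := vsS_bound hc hb hh
  refine Integrable.mono' (g := fun t => K * (1 + t ^ 2)⁻¹)
    ((integrable_inv_one_add_sq.const_mul K).integrableOn) ?_
    ((ae_restrict_iff' measurableSet_Ioi).2 (ae_of_all _ fun t ht => hK t (le_of_lt ht)))
  refine aestronglyMeasurable_of_tendsto_ae atTop
    (f := fun (n : ℕ) y => ∑ k ∈ Finset.range n, f ((k + 1 : ℝ) * y)) (fun n => ?_) ?_
  · refine ContinuousOn.aestronglyMeasurable ?_ measurableSet_Ioi
    refine continuousOn_finsetSum _ fun k _ => hc.comp (by fun_prop) fun y (hy : 0 < y) => ?_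
    simp only [mem_Ici]; positivity
  · exact (ae_restrict_iff' measurableSet_Ioi).2 (ae_of_all _ fun y hy =>
      (vs_summable_mul hb y hy).hasSum.tendsto_sum_nat)

lemma vs_key {f h' h'' : ℝ → ℂ} {C D : ℝ} (hc : ContinuousOn f (Ici 0))
    (hb : ∀ t, 0 ≤ t → ‖f t‖ ≤ C * (1 + t ^ 2)⁻¹) (hh : VsNice (vsH f) h' h'' D) (x : ℝ)
    (hx : 0 < x) (M : ℕ) (hM : 0 < M) :
    ∑' k : ℕ, 2 * (((k + 1 : ℝ) : ℂ)⁻¹ * vsE (vsH f) (x / (k + 1 : ℝ)) M) =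
      (∑ m ∈ Finset.range M, vsS f ((m + 1 : ℝ) * x)) - vsS f (M * x) / 2 - f 0 / 4
        - (x : ℂ)⁻¹ * ∫ y in (0:ℝ)..(M * x), vsS f y := by
  have hl := vs_lin hh (vsH_zero f)
  have hxc : (x : ℂ) ≠ 0 := by exact_mod_cast hx.ne'
  have hMx : 0 < (M : ℝ) * x := by positivity
  have sT : ∀ y, 0 < y → HasSum (fun k => vsT (vsH f) k y) (vsS f y / 2 + f 0 / 4) := by
    intro y hy
    have h1 := (vs_summable_of_sq _ fun k => vsT_bound hl k y hy.le).hasSum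
    have h2 : ∑' k : ℕ, vsT (vsH f) k y = vsS f y / 2 + f 0 / 4 := by
      linear_combination -(vs_dual hc hb hh y hy) / 2
    rwa [h2] at h1
  have cT : ∀ k, ContinuousOn (vsT (vsH f) k) (Ici 0) := by
    intro k
    refine continuousOn_const.mul (hh.c0.comp (by fun_prop) fun y (hy : 0 ≤ y) => ?_)
    simp only [mem_Ici]; positivity
  have iT : ∀ k, IntegrableOn (vsT (vsH f) k) (Ioc 0 (M * x)) := fun k =>
    ((cT k).mono Icc_subset_Ici_self).integrableOn_Icc.mono_set Ioc_subset_Icc_self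
  have HI : HasSum (fun k => ∫ y in (0:ℝ)..(M * x), vsT (vsH f) k y)
      ((∫ y in (0:ℝ)..(M * x), vsS f y) / 2 + (M * x) * f 0 / 4) := by
    have h1 := hasSum_integral_of_summable_integral_norm iT ?_
    · have h2 : ∫ y in Ioc 0 (M * x), ∑' k, vsT (vsH f) k y =
          (∫ y in (0:ℝ)..(M * x), vsS f y) / 2 + (M * x) * f 0 / 4 := by
        have h3 : ∫ y in Ioc 0 (M * x), ∑' k, vsT (vsH f) k y =
            ∫ y in Ioc 0 (M * x), ((1/2 : ℂ) * vsS f y + f 0 / 4) :=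
          setIntegral_congr_fun measurableSet_Ioc fun y hy => by
            simp only [(sT y hy.1).tsum_eq]; ring
        rw [h3, integral_add (((vsS_int hc hb hh).mono_set Ioc_subset_Ioi_self).const_mul _)
          (integrableOn_const measure_Ioc_lt_top.ne), integral_const_mul,
          intervalIntegral.integral_of_le hMx.le]
        simp [hMx.le]
        ring
      rw [h2] at h1
      simpa only [intervalIntegral.integral_of_le hMx.le] using h1
    · refine Summable.of_nonneg_of_le (fun k => by positivity) (fun k => ?_)
        (vs_summable_sq.mul_left (D * (M * x) * (M * x)))
      calc ∫ y in Ioc 0 (M * x), ‖vsT (vsH f) k y‖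
          ≤ ∫ y in Ioc 0 (M * x), (D * (M * x)) * (((k : ℝ) + 1) ^ 2)⁻¹ := by
            refine setIntegral_mono_on (iT k).norm (integrableOn_const measure_Ioc_lt_top.ne)
              measurableSet_Ioc fun y hy => (vsT_bound hl k y hy.1.le).trans ?_
            have := hh.C0
            have := hy.2
            gcongr
        _ = _ := by
          simp [hMx.le]
          ring
  have HS : HasSum (fun k => ∑ m ∈ Finset.range M, vsT (vsH f) k ((m + 1 : ℝ) * x))
      (∑ m ∈ Finset.range M, (vsS f ((m + 1 : ℝ) * x) / 2 + f 0 / 4)) :=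
    hasSum_sum fun m _ => sT _ (by positivity)
  have H := (((HS.sub ((sT _ hMx).div_const 2)).sub (HI.mul_left (x : ℂ)⁻¹))).mul_left 2
  have e : ∀ k : ℕ, 2 * (((k + 1 : ℝ) : ℂ)⁻¹ * vsE (vsH f) (x / (k + 1 : ℝ)) M) =
      2 * (∑ m ∈ Finset.range M, vsT (vsH f) k ((m + 1 : ℝ) * x) - vsT (vsH f) k (M * x) / 2 -
        (x : ℂ)⁻¹ * ∫ y in (0:ℝ)..(M * x), vsT (vsH f) k y) := by
    intro k
    have hk : (0:ℝ) < k + 1 := by positivity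
    have hkc : ((k + 1 : ℝ) : ℂ) ≠ 0 := by exact_mod_cast hk.ne'
    congr 1
    unfold vsE vsT
    rw [intervalIntegral.integral_const_mul, intervalIntegral.integral_comp_div _ hk.ne',
      zero_div, ← Finset.mul_sum, Complex.real_smul]
    simp only [mul_div_assoc]
    rw [Complex.ofReal_div]
    generalize (∑ m ∈ Finset.range M, vsH f ((m + 1 : ℝ) * (x / (k + 1 : ℝ)))) = A
    generalize (∫ t in (0:ℝ)..(M * (x / (k + 1 : ℝ))), vsH f t) = I1
    field_simp
  rw [tsum_congr e, H.tsum_eq, Finset.sum_add_distrib, ← Finset.sum_div]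
  simp only [Finset.sum_const, Finset.card_range, nsmul_eq_mul]
  generalize (∑ m ∈ Finset.range M, vsS f ((m + 1 : ℝ) * x)) = A
  generalize vsS f (M * x) = B
  generalize (∫ y in (0:ℝ)..(M * x), vsS f y) = I
  field_simp
  ring

lemma vs_left {f h' h'' : ℝ → ℂ} {D : ℝ} (hh : VsNice (vsH f) h' h'' D) (x : ℝ) (hx : 0 < x) :
    Tendsto (fun M : ℕ => ∑' k : ℕ, 2 * (((k + 1 : ℝ) : ℂ)⁻¹ * vsE (vsH f) (x / (k + 1 : ℝ)) M))
      atTop (nhds ((x : ℂ)⁻¹ *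
        ∑' n : ℕ, ((n + 1 : ℕ).divisors.card : ℂ) * voronoiG f ((n + 1 : ℝ) / x))) := by
  obtain ⟨B, hB0, hB⟩ := vs_cos_decay hh
  have hxc : (x : ℂ) ≠ 0 := by exact_mod_cast hx.ne'
  set I := ∫ t in Ioi (0:ℝ), ‖h'' t‖ with hI
  have hI0 : 0 ≤ I := by positivity
  have T := tendsto_tsum_of_dominated_convergence (𝓕 := atTop)
    (f := fun (M k : ℕ) => 2 * (((k + 1 : ℝ) : ℂ)⁻¹ * vsE (vsH f) (x / (k + 1 : ℝ)) M))
    (g := fun k : ℕ => 2 * (((k + 1 : ℝ) : ℂ)⁻¹ *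
      ((∑' j : ℕ, vsH f ((j + 1 : ℝ) * (x / (k + 1 : ℝ)))) -
        ((x / (k + 1 : ℝ) : ℝ) : ℂ)⁻¹ * ∫ t in Ioi (0:ℝ), vsH f t)))
    (bound := fun k : ℕ => (2 * x * I) * (((k : ℝ) + 1) ^ 2)⁻¹)
    (vs_summable_sq.mul_left _)
    (fun k => ((vsE_tendsto hh.c0 hh.b0 _ (by positivity)).const_mul _).const_mul _)
    (Eventually.of_forall fun M k => by
      have hk : (0:ℝ) < k + 1 := by positivity
      rw [norm_mul, norm_mul, norm_inv, Complex.norm_real, Real.norm_of_nonneg hk.le]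
      have := vsE_bound hh (vsH_zero f) (x / (k + 1 : ℝ)) (by positivity) M
      have h2 : ‖(2:ℂ)‖ = 2 := by simp
      rw [h2]
      calc 2 * (((k : ℝ) + 1)⁻¹ * ‖vsE (vsH f) (x / (k + 1 : ℝ)) M‖)
          ≤ 2 * (((k : ℝ) + 1)⁻¹ * (x / (k + 1 : ℝ) * I)) := by gcongr
        _ = _ := by field_simp)
  convert T using 2
  have dv := vs_divisor (fun n : ℕ => vsC (vsH f) ((n : ℝ) / x)) (B * x ^ 2) (fun n hn => by
    have hn' : (0:ℝ) < n := by exact_mod_cast hn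
    refine (hB _ (by positivity)).trans (le_of_eq ?_)
    field_simp)
  have hG : ∀ w, voronoiG f w = 4 * vsC (vsH f) w := by
    intro w
    unfold voronoiG vsC vsH
    congr 1
    refine integral_congr_ae (ae_of_all _ fun t => ?_)
    simp only
    ring
  have e1 : ∑' n : ℕ, ((n + 1 : ℕ).divisors.card : ℂ) * voronoiG f ((n + 1 : ℝ) / x) =
      4 * ∑' n : ℕ, ((n + 1 : ℕ).divisors.card : ℂ) * vsC (vsH f) (((n + 1 : ℕ) : ℝ) / x) := by
    rw [← tsum_mul_left]
    refine tsum_congr fun n => ?_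
    rw [hG]; push_cast; ring
  rw [e1, ← dv.tsum_eq, ← mul_assoc, ← tsum_mul_left]
  refine tsum_congr fun k => ?_
  have hk : (0:ℝ) < k + 1 := by positivity
  have hkc : ((k + 1 : ℝ) : ℂ) ≠ 0 := by exact_mod_cast hk.ne'
  have P := vs_poisson (vsH f) D B hh.c0 hh.b0 hB (x / (k + 1 : ℝ)) (by positivity)
  rw [vsH_zero, zero_div, zero_add] at P
  rw [P, add_sub_cancel_left, tsum_mul_left]
  have e2 : ∀ j : ℕ, vsC (vsH f) ((j + 1 : ℝ) / (x / (k + 1 : ℝ))) =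
      vsC (vsH f) ((((k + 1) * (j + 1) : ℕ) : ℝ) / x) := by
    intro j
    congr 1
    push_cast
    field_simp
  simp only [e2]
  generalize (∑' j : ℕ, vsC (vsH f) ((((k + 1) * (j + 1) : ℕ) : ℝ) / x)) = A
  rw [Complex.ofReal_div]
  field_simp
  ring

lemma vs_right {f h' h'' : ℝ → ℂ} {C D : ℝ} (hc : ContinuousOn f (Ici 0))
    (hb : ∀ t, 0 ≤ t → ‖f t‖ ≤ C * (1 + t ^ 2)⁻¹) (hh : VsNice (vsH f) h' h'' D) (x : ℝ)
    (hx : 0 < x) :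
    Tendsto (fun M : ℕ => (∑ m ∈ Finset.range M, vsS f ((m + 1 : ℝ) * x)) - vsS f (M * x) / 2
        - f 0 / 4 - (x : ℂ)⁻¹ * ∫ y in (0:ℝ)..(M * x), vsS f y) atTop
      (nhds ((∑' n : ℕ, ((n + 1 : ℕ).divisors.card : ℂ) * f ((n + 1 : ℝ) * x)) - 0 / 2
        - f 0 / 4 - (x : ℂ)⁻¹ * ∫ y in Ioi (0:ℝ), vsS f y)) := by
  have hM : Tendsto (fun M : ℕ => (M : ℝ) * x) atTop atTop :=
    tendsto_natCast_atTop_atTop.atTop_mul_const hx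
  obtain ⟨K, hK⟩ := vsS_bound hc hb hh
  have dv := vs_divisor (fun n : ℕ => f ((n : ℝ) * x)) (C * (x ^ 2)⁻¹) (fun n hn => by
    have hn' : (0:ℝ) < n := by exact_mod_cast hn
    refine (vs_sq_bound hb _ (by positivity)).trans (le_of_eq ?_)
    rw [mul_pow, mul_inv]; ring)
  have h1 : Tendsto (fun M : ℕ => ∑ m ∈ Finset.range M, vsS f ((m + 1 : ℝ) * x)) atTop
      (nhds (∑' n : ℕ, ((n + 1 : ℕ).divisors.card : ℂ) * f ((n + 1 : ℝ) * x))) := by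
    have := dv.tendsto_sum_nat
    have e : ∑' n : ℕ, ((n + 1 : ℕ).divisors.card : ℂ) * f ((n + 1 : ℝ) * x) =
        ∑' n : ℕ, ((n + 1 : ℕ).divisors.card : ℂ) * f (((n + 1 : ℕ) : ℝ) * x) :=
      tsum_congr fun n => by push_cast; rfl
    rw [e]
    refine this.congr fun M => Finset.sum_congr rfl fun m _ => tsum_congr fun k => ?_
    congr 1
    push_cast
    ring
  have h2 := (vs_bound_tendsto hK).comp hM
  have h3 := intervalIntegral_tendsto_integral_Ioi 0 (vsS_int hc hb hh) hM
  exact ((h1.sub (h2.div_const 2)).sub_const _).sub (h3.const_mul _)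

lemma vs_log_subst {f : ℝ → ℂ} {C : ℝ} (hc : ContinuousOn f (Ici 0))
    (hb : ∀ t, 0 ≤ t → ‖f t‖ ≤ C * (1 + t ^ 2)⁻¹) (h0 : ∫ y in Ioi (0:ℝ), f y = 0) (x : ℝ)
    (hx : 0 < x) (c : ℝ) :
    ∫ y in Ioi (0:ℝ), f (x * y) * ((Real.log y + c : ℝ) : ℂ) =
      (x : ℂ)⁻¹ * ∫ v in Ioi (0:ℝ), f v * (Real.log v : ℂ) := by
  have hi : IntegrableOn f (Ioi 0) := VsNice.intOn hc hb
  have hl : IntegrableOn (fun v => f v * (Real.log v : ℂ)) (Ioi 0) := by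
    refine (vs_log_int hc hb).mono' ?_ (ae_of_all _ fun v => by
      rw [norm_mul, Complex.norm_real, Real.norm_eq_abs])
    exact hi.aestronglyMeasurable.mul
      (Complex.measurable_ofReal.comp Real.measurable_log).aestronglyMeasurable
  have s := integral_comp_mul_left_Ioi
    (fun v => f v * (Real.log v : ℂ) + ((c - Real.log x : ℝ) : ℂ) * f v) 0 hx
  rw [mul_zero, integral_add hl (hi.const_mul _), integral_const_mul, h0, mul_zero, add_zero,
    Complex.real_smul, Complex.ofReal_inv] at s
  rw [← s]
  refine setIntegral_congr_fun measurableSet_Ioi fun y (hy : 0 < y) => ?_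
  rw [Real.log_mul hx.ne' hy.ne']
  push_cast
  ring

/-- the Voronoi summation formula. -/
theorem voronoi_summation (α : ℝ) (hα : 2 < α) (f : ℝ → ℂ) (hf : MuntzClass α f)
    (hg : MuntzClass α (fun x : ℝ => (x : ℂ)⁻¹ * fourierCos f x⁻¹)) :
    ∀ x : ℝ, 0 < x →
      (∑' n : ℕ, ((n + 1 : ℕ).divisors.card : ℂ) * f ((n + 1 : ℝ) * x)) -
          (∫ y in Ioi (0:ℝ), f (x * y) *
            ((Real.log y + 2 * Real.eulerMascheroniConstant : ℝ) : ℂ)) =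
        f 0 / 4 + (x : ℂ)⁻¹ *
          ∑' n : ℕ, ((n + 1 : ℕ).divisors.card : ℂ) * voronoiG f ((n + 1 : ℝ) / x) := by
  intro x hx
  obtain ⟨f', f'', C, hF⟩ := vs_nice α hα f hf
  obtain ⟨h', h'', D, hh⟩ : ∃ q' q'' D, VsNice (vsH f) q' q'' D := by
    obtain ⟨g', g'', E, hE⟩ := vs_nice α hα _ hg
    obtain ⟨c, e⟩ := vsH_scale f
    have hpi := Real.pi_pos
    rw [e]
    exact hE.scale c (2 * Real.pi)⁻¹ (by positivity)
  have h0 := vs_int_zero f (VsNice.intOn hF.c0 hF.b0) D hh.b0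
  have L := vs_left hh x hx
  have R := vs_right hF.c0 hF.b0 hh x hx
  have L2 := L.congr' (by
    filter_upwards [eventually_gt_atTop 0] with M hM
    exact vs_key hF.c0 hF.b0 hh x hx M hM)
  have key := tendsto_nhds_unique R L2
  rw [vs_int_S hF.c0 hF.b0 h0 (vsS_int hF.c0 hF.b0 hh)] at key
  rw [vs_log_subst hF.c0 hF.b0 h0 x hx, ← key]
  ring
end
end
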